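/- arXiv:1304.2141 — 6 statements merged into one kernel-verified Lean document; each statement's English description precedes it below -/
import Mathlib

section
/- Let μ and ν be probability measures on ℝ with equal finite means and C_μ(x) ≤ C_ν(x) for all x, and suppose the Dispersion Assumption holds: (μ − ν)⁺ is supported in an interval E with endpoints a < b and (ν − μ)⁺((a,b)) = 0. Then P(μ,ν) = D̃(μ,ν) = D(μ,ν), and the infimum defining P(μ,ν) is attained by some martingale coupling and the supremum defining D(μ,ν) is attained by some pair (ψ,δ). -/
open Set MeasureTheory
open scoped ENNReal

noncomputable section

/-- A martingale coupling of (μ, ν): a probability measure on ℝ × ℝ with first marginal μ,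
second marginal ν, such that ∫ f(x)(y − x) ρ(dx,dy) = 0 for every bounded Borel f. -/
def IsMartingaleCoupling (μ ν : Measure ℝ) (ρ : Measure (ℝ × ℝ)) : Prop :=
  IsProbabilityMeasure ρ ∧ ρ.map Prod.fst = μ ∧ ρ.map Prod.snd = ν ∧
    ∀ f : ℝ → ℝ, Measurable f → (∃ C : ℝ, ∀ x, |f x| ≤ C) →
      ∫ w : ℝ × ℝ, f w.1 * (w.2 - w.1) ∂ρ = 0

/-- The primal value P(μ,ν) = inf over martingale couplings of ∫ |y − x| dρ. -/
def primalValue (μ ν : Measure ℝ) : ℝ :=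
  sInf {r : ℝ | ∃ ρ : Measure (ℝ × ℝ), IsMartingaleCoupling μ ν ρ ∧
    r = ∫ w : ℝ × ℝ, |w.2 - w.1| ∂ρ}

/-- An admissible dual triple (ψ₀, ψ₁, δ): ψ₀ μ-integrable, ψ₁ ν-integrable, δ Borel,
with ψ₁(y) − ψ₀(x) + δ(x)(x − y) ≤ |y − x| for all x, y. -/
def AdmissibleTriple (μ ν : Measure ℝ) (ψ₀ ψ₁ δ : ℝ → ℝ) : Prop :=
  Integrable ψ₀ μ ∧ Integrable ψ₁ ν ∧ Measurable δ ∧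
    ∀ x y : ℝ, ψ₁ y - ψ₀ x + δ x * (x - y) ≤ |y - x|

/-- The dual value D̃(μ,ν). -/
def dualTildeValue (μ ν : Measure ℝ) : ℝ :=
  sSup {r : ℝ | ∃ ψ₀ ψ₁ δ : ℝ → ℝ, AdmissibleTriple μ ν ψ₀ ψ₁ δ ∧
    r = ∫ y, ψ₁ y ∂ν - ∫ x, ψ₀ x ∂μ}

/-- The dual value D(μ,ν), restricted to triples with ψ₀ = ψ₁. -/
def dualValue (μ ν : Measure ℝ) : ℝ :=
  sSup {r : ℝ | ∃ ψ δ : ℝ → ℝ, AdmissibleTriple μ ν ψ ψ δ ∧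
    r = ∫ y, ψ y ∂ν - ∫ x, ψ x ∂μ}

/-- C_ζ(x) = ∫ (y − x)⁺ ζ(dy). -/
def Cfun (ζ : Measure ℝ) (x : ℝ) : ℝ := ∫ y, max (y - x) 0 ∂ζ

/-- The positive part (μ − ν)⁺ in the Jordan decomposition of the signed measure μ − ν. -/
def posPartMeasure (μ ν : Measure ℝ) [IsFiniteMeasure μ] [IsFiniteMeasure ν] : Measure ℝ :=
  (μ.toSignedMeasure - ν.toSignedMeasure).toJordanDecomposition.posPart

lemma posPartMeasure_eq_sub (μ ν : Measure ℝ) [IsFiniteMeasure μ] [IsFiniteMeasure ν] :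
    posPartMeasure μ ν = μ - ν := by
  simp [posPartMeasure, Measure.jordanDecompositionOfToSignedMeasureSub_posPart]

lemma add_sub_swap_measure (μ ν : Measure ℝ) [IsFiniteMeasure μ] [IsFiniteMeasure ν] :
    μ + (ν - μ) = ν + (μ - ν) := by
  have h := Measure.sub_toSignedMeasure_eq_toSignedMeasure_sub (μ := μ) (ν := ν)
  rw [← Measure.toSignedMeasure_eq_toSignedMeasure_iff, Measure.toSignedMeasure_add,
    Measure.toSignedMeasure_add]
  rw [sub_eq_sub_iff_add_eq_add] at h
  rw [h, add_comm]

/-- Two finite measures split into a common part and the two parts of their difference. -/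
lemma exists_common_part (μ ν : Measure ℝ) [IsFiniteMeasure μ] [IsFiniteMeasure ν] :
    ∃ κ : Measure ℝ, IsFiniteMeasure κ ∧ κ + (μ - ν) = μ ∧ κ + (ν - μ) = ν := by
  have h1 : μ - (μ - ν) + (μ - ν) = μ := Measure.sub_add_cancel_of_le Measure.sub_le
  refine ⟨μ - (μ - ν), inferInstance, h1, ?_⟩
  rw [← Measure.add_left_inj (μ - ν), add_right_comm, h1, add_sub_swap_measure]

/-- Every finite measure on the line is the law of a monotone quantile function. -/
lemma exists_quantile (ζ : Measure ℝ) [IsFiniteMeasure ζ] :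
    ∃ Q : ℝ → ℝ, Measurable Q ∧ MonotoneOn Q (Ioo 0 (ζ.real univ)) ∧
      (volume.restrict (Ioo 0 (ζ.real univ))).map Q = ζ := by
  classical
  set R := ζ.real univ
  set F : ℝ → ℝ := fun y => ζ.real (Iic y)
  have hF : Monotone F := fun x y h => measureReal_mono (Iic_subset_Iic.2 h)
  have hF0 : ∀ y, 0 ≤ F y := fun y => measureReal_nonneg
  have hFR : ∀ y, F y ≤ R := fun y => measureReal_mono (subset_univ _)
  have hbot : ∀ s, 0 < s → ∃ y, F y < s := by
    intro s hs
    have h := tendsto_measure_iInter_atBot (μ := ζ) (s := fun y : ℝ => Iic y)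
      (fun i => measurableSet_Iic.nullMeasurableSet) (fun _ _ h => Iic_subset_Iic.2 h)
      ⟨0, measure_ne_top _ _⟩
    have he : (⋂ y : ℝ, Iic y) = ∅ := by
      ext x; simpa using exists_lt x
    rw [he, measure_empty] at h
    have h2 := (ENNReal.tendsto_toReal (by simp)).comp h
    simp only [ENNReal.toReal_zero] at h2
    exact ((h2.eventually (gt_mem_nhds hs)).exists)
  have htop : ∀ s, s < R → ∃ y, s < F y := by
    intro s hs
    have h := tendsto_measure_Iic_atTop ζ
    have h2 := (ENNReal.tendsto_toReal (measure_ne_top ζ univ)).comp h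
    exact ((h2.eventually (lt_mem_nhds hs)).exists)
  have hright : ∀ s y, (∀ z, y < z → s ≤ F z) → s ≤ F y := by
    intro s y h
    have h1 := tendsto_measure_biInter_gt (μ := ζ) (s := fun y : ℝ => Iic y) (a := y)
      (fun i _ => measurableSet_Iic.nullMeasurableSet) (fun _ _ _ h => Iic_subset_Iic.2 h)
      ⟨y + 1, by simp, measure_ne_top _ _⟩
    have he : (⋂ z : ℝ, ⋂ (_ : z > y), Iic z) = Iic y := by
      ext x
      simp only [mem_iInter, mem_Iic]
      exact ⟨fun hx => le_of_forall_gt_imp_ge_of_dense hx, fun hx z hz => hx.trans hz.le⟩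
    rw [he] at h1
    have h2 := (ENNReal.tendsto_toReal (measure_ne_top ζ (Iic y))).comp h1
    refine ge_of_tendsto h2 ?_
    filter_upwards [self_mem_nhdsWithin] with z hz using h z hz
  set Q : ℝ → ℝ := fun s => if s ∈ Ioo 0 R then sInf {y | s ≤ F y} else 0
  have hQ : ∀ s ∈ Ioo 0 R, ∀ y, Q s ≤ y ↔ s ≤ F y := by
    intro s hs y
    have hbdd : BddBelow {y | s ≤ F y} := by
      obtain ⟨y0, hy0⟩ := hbot s hs.1
      refine ⟨y0, fun z hz => ?_⟩
      by_contra! hlt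
      exact absurd (hF hlt.le) (by simp only [mem_ofPred_eq] at hz; linarith)
    obtain ⟨y1, hy1⟩ := htop s hs.2
    simp only [Q, if_pos hs]
    refine ⟨fun h => hright s y fun z hz => ?_, fun h => csInf_le hbdd h⟩
    obtain ⟨w, hw, hwz⟩ := exists_lt_of_csInf_lt ⟨y1, hy1.le⟩ (h.trans_lt hz)
    exact hw.trans (hF hwz.le)
  have hpre : ∀ y, Q ⁻¹' Iic y ∩ Ioo 0 R = Iic (F y) ∩ Ioo 0 R := by
    intro y; ext s
    simp only [mem_inter_iff, mem_preimage, mem_Iic]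
    exact and_congr_left fun hs => hQ s hs y
  have hmeas : Measurable Q := by
    refine measurable_of_Iic fun y => ?_
    have : Q ⁻¹' Iic y = (Iic (F y) ∩ Ioo 0 R) ∪ (if 0 ≤ y then (Ioo 0 R)ᶜ else ∅) := by
      rw [← hpre]
      ext s
      by_cases hs : s ∈ Ioo 0 R
      · by_cases hy : 0 ≤ y <;> simp [hs, hy]
      · have h0 : Q s = 0 := if_neg hs
        by_cases hy : 0 ≤ y <;> simp [hs, hy, h0]
    rw [this]
    refine (measurableSet_Iic.inter measurableSet_Ioo).union ?_
    split_ifs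
    · exact measurableSet_Ioo.compl
    · exact MeasurableSet.empty
  refine ⟨Q, hmeas, fun s hs t ht hst => ?_, ?_⟩
  · rw [hQ s hs]
    exact hst.trans ((hQ t ht _).1 le_rfl)
  · refine Measure.ext_of_Iic _ _ fun y => ?_
    rw [Measure.map_apply hmeas measurableSet_Iic,
      Measure.restrict_apply (hmeas measurableSet_Iic), hpre]
    have h1 : volume (Iic (F y) ∩ Ioo 0 R) = volume (Ioc 0 (F y)) := by
      refine le_antisymm (measure_mono fun s hs => ⟨hs.2.1, hs.1⟩) ?_
      rw [← Real.volume_Ioo.trans Real.volume_Ioc.symm]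
      exact measure_mono fun s hs => ⟨hs.2.le, hs.1, hs.2.trans_le (hFR y)⟩
    rw [h1, Real.volume_Ioc, sub_zero]
    exact ofReal_measureReal

/-- How much of the left part has been used once the mass `u` has been transported: the split
matching both mass and barycentre. -/
lemma exists_split (G X : ℝ → ℝ) (a b L M : ℝ) (hab : a < b) (hL : 0 ≤ L) (hLM : L ≤ M)
    (hc : ContinuousOn G (Icc 0 M))
    (hG1 : ∀ x y, 0 ≤ x → x ≤ y → y ≤ L → G y - G x ≤ a * (y - x))
    (hG2 : ∀ x y, L ≤ x → x ≤ y → y ≤ M → b * (y - x) ≤ G y - G x)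
    (hX1 : ∀ x y, 0 ≤ x → x ≤ y → y ≤ M → a * (y - x) ≤ X y - X x)
    (hX2 : ∀ x y, 0 ≤ x → x ≤ y → y ≤ M → X y - X x ≤ b * (y - x))
    (hG0 : G 0 = 0) (hX0 : X 0 = 0) (hGX : G M = X M) :
    ∃ l : ℝ → ℝ, (∀ u, 0 ≤ u → u ≤ M → 0 ≤ l u ∧ l u ≤ L ∧ 0 ≤ u - l u ∧ u - l u ≤ M - L ∧
        G (l u) + G (L + (u - l u)) - G L = X u) ∧
      ∀ u u', 0 ≤ u → u ≤ u' → u' ≤ M → l u ≤ l u' ∧ u - l u ≤ u' - l u' := by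
  have hex : ∀ u, ∃ l : ℝ, 0 ≤ u → u ≤ M → 0 ≤ l ∧ l ≤ L ∧ 0 ≤ u - l ∧ u - l ≤ M - L ∧
      G l + G (L + (u - l)) - G L = X u := by
    intro u
    by_cases hu : 0 ≤ u ∧ u ≤ M
    swap
    · exact ⟨0, fun h1 h2 => absurd ⟨h1, h2⟩ hu⟩
    obtain ⟨hu0, huM⟩ := hu
    have hle : max 0 (u - (M - L)) ≤ min L u :=
      max_le (le_min hL hu0) (le_min (by linarith) (by linarith))
    have hcont : ContinuousOn (fun l => G l + G (L + (u - l)) - G L)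
        (Icc (max 0 (u - (M - L))) (min L u)) := by
      refine ContinuousOn.sub (ContinuousOn.add (hc.mono ?_) (hc.comp ?_ ?_)) continuousOn_const
      · rintro x ⟨h1, h2⟩
        exact ⟨(le_max_left _ _).trans h1, (h2.trans (min_le_left _ _)).trans hLM⟩
      · fun_prop
      · rintro x ⟨h1, h2⟩
        have := (le_max_right _ _).trans h1
        have := h2.trans (min_le_right _ _)
        constructor <;> linarith
    have hhi : G (min L u) + G (L + (u - min L u)) - G L ≤ X u := by
      rcases le_total L u with h | h
      · rw [min_eq_left h]
        have h1 := hG2 u M h huM le_rfl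
        have h2 := hX2 u M hu0 huM le_rfl
        rw [add_sub_cancel]; linarith
      · rw [min_eq_right h, sub_self, add_zero]
        have h1 := hG1 0 u le_rfl hu0 h
        have h2 := hX1 0 u le_rfl hu0 huM
        linarith
    have hlo : X u ≤ G (max 0 (u - (M - L))) + G (L + (u - max 0 (u - (M - L)))) - G L := by
      rcases le_total 0 (u - (M - L)) with h | h
      · rw [max_eq_right h]
        have h1 := hG1 (u - (M - L)) L h (by linarith) le_rfl
        have h2 := hX1 u M hu0 huM le_rfl
        have h3 : L + (u - (u - (M - L))) = M := by ring
        have h4 : L - (u - (M - L)) = M - u := by ring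
        rw [h4] at h1
        rw [h3]; linarith
      · rw [max_eq_left h, sub_zero]
        have h1 := hG2 L (L + u) le_rfl (by linarith) (by linarith)
        have h2 := hX2 0 u le_rfl hu0 huM
        rw [add_sub_cancel_left] at h1
        linarith
    obtain ⟨l, hl, hlX⟩ := intermediate_value_Icc' hle hcont ⟨hhi, hlo⟩
    have h1 := (le_max_left _ _).trans hl.1
    have h2 := (le_max_right _ _).trans hl.1
    have h3 := hl.2.trans (min_le_left _ _)
    have h4 := hl.2.trans (min_le_right _ _)
    exact ⟨l, fun _ _ => ⟨h1, h3, by linarith, by linarith, hlX⟩⟩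
  choose l hl using hex
  refine ⟨l, hl, fun u u' hu huu' hu' => ?_⟩
  obtain ⟨h1, h2, h3, h4, h5⟩ := hl u hu (huu'.trans hu')
  obtain ⟨k1, k2, k3, k4, k5⟩ := hl u' (hu.trans huu') hu'
  have hx1 := hX1 u u' hu huu' hu'
  have hx2 := hX2 u u' hu huu' hu'
  constructor
  · by_contra! hlt
    have e1 := hG1 (l u') (l u) k1 hlt.le h2
    have e2 := hG2 (L + (u - l u)) (L + (u' - l u')) (by linarith) (by linarith) (by linarith)
    nlinarith [mul_pos (sub_pos.2 hab) (sub_pos.2 hlt)]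
  · by_contra! hlt
    have e1 := hG1 (l u) (l u') h1 (by linarith) k2
    have e2 := hG2 (L + (u' - l u')) (L + (u - l u)) (by linarith) (by linarith) (by linarith)
    nlinarith [mul_pos (sub_pos.2 hab) (sub_pos.2 hlt)]

lemma exists_monotone_section (f : ℝ → ℝ) (M c : ℝ) (hM : 0 ≤ M) (hc : 0 ≤ c)
    (hf : ContinuousOn f (Icc 0 M)) (hmono : MonotoneOn f (Icc 0 M)) (h0 : f 0 = 0)
    (h1 : f M = c) :
    ∃ τ : ℝ → ℝ, Monotone τ ∧ ∀ v ∈ Icc 0 c, τ v ∈ Icc 0 M ∧ f (τ v) = v := by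
  have hex : ∀ v, ∃ u, v ∈ Icc 0 c → u ∈ Icc 0 M ∧ f u = v := by
    intro v
    by_cases hv : v ∈ Icc 0 c
    · rw [← h0, ← h1] at hv
      obtain ⟨u, hu, huv⟩ := intermediate_value_Icc hM hf hv
      exact ⟨u, fun _ => ⟨hu, huv⟩⟩
    · exact ⟨0, fun h => absurd h hv⟩
  choose τ hτ using hex
  have hclamp : ∀ v, max 0 (min v c) ∈ Icc 0 c := fun v =>
    ⟨le_max_left _ _, max_le hc (min_le_right _ _)⟩
  refine ⟨fun v => τ (max 0 (min v c)), fun v w hvw => ?_, fun v hv => ?_⟩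
  · have hle : max 0 (min v c) ≤ max 0 (min w c) := by gcongr
    rcases hle.eq_or_lt with h | h
    · simp only [h, le_refl]
    · by_contra! hlt
      have := hmono (hτ _ (hclamp w)).1 (hτ _ (hclamp v)).1 hlt.le
      rw [(hτ _ (hclamp w)).2, (hτ _ (hclamp v)).2] at this
      linarith
  · have : max 0 (min v c) = v := by rw [min_eq_left hv.2, max_eq_right hv.1]
    simp only [this]
    exact hτ v hv

/-- The time at which the level `v` of the target quantile is reached. -/
lemma exists_time_change (l : ℝ → ℝ) (L M : ℝ) (hL : 0 ≤ L) (hLM : L ≤ M)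
    (hl : ∀ u, 0 ≤ u → u ≤ M → 0 ≤ l u ∧ l u ≤ L ∧ 0 ≤ u - l u ∧ u - l u ≤ M - L)
    (hmono : ∀ u u', 0 ≤ u → u ≤ u' → u' ≤ M → l u ≤ l u' ∧ u - l u ≤ u' - l u') :
    ∃ θ : ℝ → ℝ, Measurable θ ∧ ∀ v ∈ Ioo 0 M, θ v ∈ Icc 0 M ∧ ∀ u ∈ Icc 0 M,
      (v ≤ L → (θ v ≤ u → v ≤ l u) ∧ (u ≤ θ v → l u ≤ v)) ∧
      (L < v → (θ v ≤ u → v ≤ L + (u - l u)) ∧ (u ≤ θ v → L + (u - l u) ≤ v)) := by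
  have hM := hL.trans hLM
  have hlip : LipschitzOnWith 1 l (Icc 0 M) := by
    refine LipschitzOnWith.of_le_add_mul _ fun x hx y hy => ?_
    rcases le_total x y with h | h
    · have := hmono x y hx.1 h hy.2
      have := dist_nonneg (x := x) (y := y)
      simp; linarith
    · have := hmono y x hy.1 h hx.2
      rw [Real.dist_eq, abs_of_nonneg (by linarith)]
      simp; linarith
  have h0 := hl 0 le_rfl hM
  have h1 := hl M hM le_rfl
  obtain ⟨τ, hτm, hτ⟩ := exists_monotone_section l M L hM hL hlip.continuousOn
    (fun x hx y hy hxy => (hmono x y hx.1 hxy hy.2).1) (by linarith) (by linarith)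
  obtain ⟨σ, hσm, hσ⟩ := exists_monotone_section (fun u => u - l u) M (M - L) hM (by linarith)
    (continuousOn_id.sub hlip.continuousOn)
    (fun x hx y hy hxy => (hmono x y hx.1 hxy hy.2).2) (by linarith) (by linarith)
  refine ⟨fun v => if v ≤ L then τ v else σ (v - L),
    Measurable.ite measurableSet_Iic hτm.measurable
      (hσm.measurable.comp (measurable_id.sub_const L)), fun v hv => ?_⟩
  by_cases hvL : v ≤ L
  · obtain ⟨e1, e2⟩ := hτ v ⟨hv.1.le, hvL⟩
    simp only [if_pos hvL]
    refine ⟨e1, fun u hu => ⟨fun _ => ⟨fun h => ?_, fun h => ?_⟩, fun h => by linarith⟩⟩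
    · have := (hmono _ _ e1.1 h hu.2).1; linarith
    · have := (hmono _ _ hu.1 h e1.2).1; linarith
  · obtain ⟨e1, e2⟩ := hσ (v - L) ⟨by linarith, by linarith [hv.2]⟩
    simp only [if_neg hvL]
    refine ⟨e1, fun u hu => ⟨fun h => absurd h hvL, fun _ => ⟨fun h => ?_, fun h => ?_⟩⟩⟩
    · have := (hmono _ _ e1.1 h hu.2).2; linarith
    · have := (hmono _ _ hu.1 h e1.2).2; linarith

/-- A density with vanishing integral over all sublevel sets of `θ` is orthogonal to every bounded
function of `θ`. -/
lemma integral_comp_mul_eq_zero (P : Measure ℝ) (θ D : ℝ → ℝ)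
    (hθ : Measurable θ) (hD : Measurable D) (hDi : Integrable D P)
    (h0 : ∀ u, ∫ v in θ ⁻¹' Iic u, D v ∂P = 0) (g : ℝ → ℝ) (hg : Measurable g) (C : ℝ)
    (hC : ∀ x, |g x| ≤ C) : ∫ v, g (θ v) * D v ∂P = 0 := by
  have key : ∀ E : ℝ → ℝ, Measurable E → Integrable E P →
      IsFiniteMeasure ((P.withDensity fun v => ENNReal.ofReal (E v)).map θ) ∧
      (∀ u, (P.withDensity fun v => ENNReal.ofReal (E v)).map θ (Iic u) =
        ∫⁻ v in θ ⁻¹' Iic u, ENNReal.ofReal (E v) ∂P) ∧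
      ∫ x, g x ∂((P.withDensity fun v => ENNReal.ofReal (E v)).map θ) =
        ∫ v, max (E v) 0 * g (θ v) ∂P := by
    intro E hE hEi
    have : IsFiniteMeasure (P.withDensity fun v => ENNReal.ofReal (E v)) :=
      isFiniteMeasure_withDensity_ofReal hEi.2
    refine ⟨inferInstance, fun u => ?_, ?_⟩
    · rw [Measure.map_apply hθ measurableSet_Iic,
        withDensity_apply _ (hθ measurableSet_Iic)]
    · rw [integral_map hθ.aemeasurable hg.aestronglyMeasurable,
        integral_withDensity_eq_integral_toReal_smul hE.ennreal_ofReal (by simp)]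
      simp [ENNReal.toReal_ofReal']
  obtain ⟨f1, a1, i1⟩ := key D hD hDi
  obtain ⟨f2, a2, i2⟩ := key (fun v => -D v) hD.neg hDi.neg
  have heq : (P.withDensity fun v => ENNReal.ofReal (D v)).map θ =
      (P.withDensity fun v => ENNReal.ofReal (-D v)).map θ := by
    refine Measure.ext_of_Iic _ _ fun u => ?_
    have hfin1 := measure_ne_top ((P.withDensity fun v => ENNReal.ofReal (D v)).map θ) (Iic u)
    have hfin2 := measure_ne_top ((P.withDensity fun v => ENNReal.ofReal (-D v)).map θ) (Iic u)
    rw [a1] at hfin1 ⊢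
    rw [a2] at hfin2 ⊢
    have := h0 u
    rw [integral_eq_lintegral_pos_part_sub_lintegral_neg_part hDi.integrableOn, sub_eq_zero] at this
    exact (ENNReal.toReal_eq_toReal_iff' hfin1 hfin2).1 this
  rw [heq, i2] at i1
  have hint : ∀ E : ℝ → ℝ, Integrable E P → Integrable (fun v => max (E v) 0 * g (θ v)) P :=
    fun E hE => hE.pos_part.mul_bdd (c := C) (hg.comp hθ).aestronglyMeasurable
      (Filter.Eventually.of_forall fun v => hC _)
  have hsplit : (fun v => g (θ v) * D v) =
      fun v => max (D v) 0 * g (θ v) - max (-D v) 0 * g (θ v) := by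
    ext v
    rcases le_total 0 (D v) with h | h
    · rw [max_eq_left h, max_eq_right (neg_nonpos.2 h)]; ring
    · rw [max_eq_right h, max_eq_left (neg_nonneg.2 h)]; ring
  rw [hsplit, integral_sub (hint D hDi) (hint (fun v => -D v) hDi.neg), ← i1, sub_self]

lemma exists_measurable_slope (ψ : ℝ → ℝ) (hψ : Continuous ψ)
    (h : ∀ x, ∃ d, ∀ y, ψ y - ψ x + d * (x - y) ≤ |y - x|) :
    ∃ δ : ℝ → ℝ, Measurable δ ∧ ∀ x y, ψ y - ψ x + δ x * (x - y) ≤ |y - x| := by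
  set δ : ℝ → ℝ := fun x => ⨆ q : {q : ℚ // 0 < q}, ((ψ (x + (q : ℚ)) - ψ x) / (q : ℚ) - 1)
  have hle : ∀ x d, (∀ y, ψ y - ψ x + d * (x - y) ≤ |y - x|) → ∀ q : {q : ℚ // 0 < q},
      (ψ (x + (q : ℚ)) - ψ x) / (q : ℚ) - 1 ≤ d := by
    intro x d hd q
    have hq : (0 : ℝ) < (q : ℚ) := by exact_mod_cast q.2
    have := hd (x + (q : ℚ))
    rw [add_sub_cancel_left, abs_of_pos hq] at this
    rw [sub_le_iff_le_add, div_le_iff₀ hq]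
    linarith
  refine ⟨δ, Measurable.iSup fun q => ?_, fun x y => ?_⟩
  · have := hψ.measurable
    fun_prop
  · obtain ⟨d, hd⟩ := h x
    have : Nonempty {q : ℚ // 0 < q} := ⟨1, one_pos⟩
    have hδd : δ x ≤ d := ciSup_le (hle x d hd)
    rcases lt_trichotomy y x with hyx | rfl | hxy
    · have := hd y
      nlinarith
    · simp
    · by_contra! hlt
      have hopen : IsOpen ({z : ℝ | 0 < z} ∩ {z : ℝ | z < ψ (x + z) - ψ x + δ x * (-z)}) :=
        (isOpen_lt continuous_const continuous_id).inter
          (isOpen_lt continuous_id (by fun_prop))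
      obtain ⟨q, hq0, hq⟩ := Rat.denseRange_cast.exists_mem_open hopen ⟨y - x, by
        rw [abs_of_pos (by linarith)] at hlt
        simp only [mem_inter_iff, mem_ofPred_eq, add_sub_cancel]
        exact ⟨by linarith, by linarith⟩⟩
      simp only [mem_ofPred_eq] at hq0 hq
      have hle' : (ψ (x + q) - ψ x) / q - 1 ≤ δ x :=
        le_ciSup (f := fun q : {q : ℚ // 0 < q} => (ψ (x + (q : ℚ)) - ψ x) / (q : ℚ) - 1)
          ⟨d, by rintro _ ⟨p, rfl⟩; exact hle x d hd p⟩ ⟨q, by exact_mod_cast hq0⟩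
      rw [sub_le_iff_le_add, div_le_iff₀ hq0] at hle'
      linarith

/-- The dual potential generated by the coefficients `k`, `m`, with its contact set. -/
lemma exists_potential (a b C : ℝ) (hab : a < b) (k m : ℝ → ℝ)
    (hk : Measurable k) (hm : Measurable m) (hkC : ∀ t, |k t| ≤ C) (hmC : ∀ t, |m t| ≤ C)
    (hkm : ∀ t, ∀ y ∈ Icc a b, 0 ≤ k t * y + m t ∧ k t * y + m t ≤ 1) :
    ∃ ψ I δ : ℝ → ℝ, (∃ K, LipschitzWith K ψ) ∧ Measurable I ∧ (∃ C', ∀ x, |I x| ≤ C') ∧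
      Measurable δ ∧ (∀ x y, ψ y - ψ x + δ x * (x - y) ≤ |y - x|) ∧
      ∀ x ∈ Icc a b, ∀ y,
        (b ≤ y → (∀ t < x, k t * y + m t ≤ 1) → (∀ t > x, 1 ≤ k t * y + m t) →
          ψ y - ψ x + I x * (x - y) = |y - x|) ∧
        (y ≤ a → (∀ t < x, k t * y + m t ≤ 0) → (∀ t > x, 0 ≤ k t * y + m t) →
          ψ y - ψ x + I x * (x - y) = |y - x|) := by
  have hint : ∀ f : ℝ → ℝ, Measurable f → (∃ B, ∀ t, |f t| ≤ B) → ∀ x y,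
      IntervalIntegrable f volume x y := by
    rintro f hf ⟨B, hB⟩ x y
    rw [intervalIntegrable_iff]
    exact Measure.integrableOn_of_bounded (M := B) (by simp) hf.aestronglyMeasurable
      (Filter.Eventually.of_forall hB)
  have hki := hint k hk ⟨C, hkC⟩
  have hmi := hint m hm ⟨C, hmC⟩
  set I₀ : ℝ → ℝ := fun x => ∫ t in a..x, 2 * k t
  set K₀ : ℝ → ℝ := fun x => ∫ t in a..x, (2 * m t - 1)
  have hki2 : ∀ x y, IntervalIntegrable (fun t => 2 * k t) volume x y :=
    fun x y => (hki x y).const_mul 2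
  have hmi2 : ∀ x y, IntervalIntegrable (fun t => 2 * m t - 1) volume x y :=
    fun x y => ((hmi x y).const_mul 2).sub intervalIntegrable_const
  have hI₀ : Continuous I₀ := intervalIntegral.continuous_primitive hki2 a
  have hK₀ : Continuous K₀ := intervalIntegral.continuous_primitive hmi2 a
  set h : ℝ → ℝ → ℝ := fun x y => |y - x| + I₀ x * y + K₀ x
  have hdiff : ∀ x x' y, h x' y - h x y =
      |y - x'| - |y - x| + ∫ t in x..x', (2 * (k t * y + m t) - 1) := by
    intro x x' y
    have e1 : I₀ x' - I₀ x = ∫ t in x..x', 2 * k t :=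
      intervalIntegral.integral_interval_sub_left (hki2 _ _) (hki2 _ _)
    have e2 : K₀ x' - K₀ x = ∫ t in x..x', (2 * m t - 1) :=
      intervalIntegral.integral_interval_sub_left (hmi2 _ _) (hmi2 _ _)
    have e3 : ∫ t in x..x', (2 * (k t * y + m t) - 1) =
        (∫ t in x..x', 2 * k t) * y + ∫ t in x..x', (2 * m t - 1) := by
      rw [← intervalIntegral.integral_mul_const, ← intervalIntegral.integral_add
        ((hki2 _ _).mul_const y) (hmi2 _ _)]
      congr 1; ext t; ring
    rw [e3, ← e1, ← e2]
    simp only [h]; ring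
  have hji : ∀ y x x', IntervalIntegrable (fun t => 2 * (k t * y + m t) - 1) volume x x' :=
    fun y x x' => ((((hki x x').mul_const y).add (hmi x x')).const_mul 2).sub
      intervalIntegrable_const
  have hub : ∀ y c x x', x ≤ x' → (∀ t ∈ Ioo x x', k t * y + m t ≤ c) →
      ∫ t in x..x', (2 * (k t * y + m t) - 1) ≤ (2 * c - 1) * (x' - x) := by
    intro y c x x' hxx' hc
    have := intervalIntegral.integral_mono_on_of_le_Ioo hxx' (hji y x x')
      (intervalIntegrable_const (c := 2 * c - 1)) fun t ht => by linarith [hc t ht]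
    rwa [intervalIntegral.integral_const, smul_eq_mul, mul_comm] at this
  have hlb : ∀ y c x x', x ≤ x' → (∀ t ∈ Ioo x x', c ≤ k t * y + m t) →
      (2 * c - 1) * (x' - x) ≤ ∫ t in x..x', (2 * (k t * y + m t) - 1) := by
    intro y c x x' hxx' hc
    have := intervalIntegral.integral_mono_on_of_le_Ioo hxx'
      (intervalIntegrable_const (c := 2 * c - 1)) (hji y x x') fun t ht => by linarith [hc t ht]
    rwa [intervalIntegral.integral_const, smul_eq_mul, mul_comm] at this
  have hmin : ∀ y, ∃ x ∈ Icc a b, ∀ x' ∈ Icc a b, h x y ≤ h x' y := by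
    intro y
    have hcont : Continuous fun x => h x y := by
      simp only [h]; fun_prop
    obtain ⟨x, hx, hx'⟩ := isCompact_Icc.exists_isMinOn (nonempty_Icc.2 hab.le) hcont.continuousOn
    exact ⟨x, hx, fun x' h' => hx' h'⟩
  choose X hX hXmin using hmin
  set ψ : ℝ → ℝ := fun y => h (X y) y
  have hψle : ∀ x ∈ Icc a b, ∀ y, ψ y ≤ h x y := fun x hx y => hXmin y x hx
  have hψeq : ∀ x ∈ Icc a b, ∀ y, (∀ x' ∈ Icc a b, h x y ≤ h x' y) → ψ y = h x y :=
    fun x hx y hy => le_antisymm (hψle x hx y) (hy _ (hX y))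
  have hdiag : ∀ x ∈ Icc a b, ψ x = h x x := by
    intro x hx
    refine hψeq x hx x fun x' hx' => ?_
    rcases le_total x x' with hle | hle
    · have h1 := hdiff x x' x
      have h2 := hlb x 0 x x' hle fun t _ => (hkm t x hx).1
      rw [sub_self, abs_zero, abs_sub_comm, abs_of_nonneg (sub_nonneg.2 hle)] at h1
      linarith
    · have h1 := hdiff x' x x
      have h2 := hub x 1 x' x hle fun t _ => (hkm t x hx).2
      rw [sub_self, abs_zero, abs_of_nonneg (sub_nonneg.2 hle)] at h1
      linarith
  obtain ⟨B, hB⟩ : ∃ B, ∀ x ∈ Icc a b, |I₀ x| ≤ B :=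
    (isCompact_Icc.exists_bound_of_continuousOn hI₀.continuousOn)
  have hB0 : 0 ≤ B := (abs_nonneg _).trans (hB a (left_mem_Icc.2 hab.le))
  have hψlip : LipschitzWith (1 + B).toNNReal ψ := by
    refine LipschitzWith.of_le_add_mul' _ fun y z => ?_
    have h1 := hψle (X z) (hX z) y
    have h2 : I₀ (X z) * (y - z) ≤ B * dist y z := by
      rw [Real.dist_eq]
      exact (le_abs_self _).trans (by
        rw [abs_mul]; gcongr; exact hB _ (hX z))
    have h3 : |y - X z| ≤ |y - z| + |z - X z| := abs_sub_le _ _ _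
    rw [← Real.dist_eq y z] at h3
    simp only [ψ, h] at h1 ⊢
    linarith
  obtain ⟨δ, hδ, hδψ⟩ := exists_measurable_slope ψ hψlip.continuous fun x => ⟨I₀ (X x), fun y => by
    have h1 := hψle (X x) (hX x) y
    have h2 : |y - X x| ≤ |y - x| + |x - X x| := abs_sub_le _ _ _
    simp only [ψ, h] at h1 ⊢
    linarith⟩
  have hcl : ∀ x, max a (min x b) ∈ Icc a b := fun x =>
    ⟨le_max_left _ _, max_le hab.le (min_le_right _ _)⟩
  refine ⟨ψ, fun x => I₀ (max a (min x b)), δ, ⟨_, hψlip⟩,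
    (hI₀.comp (by fun_prop)).measurable, ⟨B, fun x => hB _ (hcl x)⟩, hδ, hδψ, fun x hx y => ?_⟩
  have hxx : max a (min x b) = x := by rw [min_eq_left hx.2, max_eq_right hx.1]
  have hcontact : (∀ x' ∈ Icc a b, h x y ≤ h x' y) →
      ψ y - ψ x + I₀ (max a (min x b)) * (x - y) = |y - x| := by
    intro hle
    rw [hψeq x hx y hle, hdiag x hx, hxx]
    simp only [h, sub_self, abs_zero]
    ring
  constructor
  · refine fun hy h1 h2 => hcontact fun x' hx' => ?_
    have e1 : |y - x'| = y - x' := abs_of_nonneg (by linarith [hx'.2])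
    have e2 : |y - x| = y - x := abs_of_nonneg (by linarith [hx.2])
    rcases le_total x x' with hle | hle
    · have h3 := hdiff x x' y
      have h4 := hlb y 1 x x' hle fun t ht => h2 t ht.1
      rw [e1, e2] at h3
      linarith
    · have h3 := hdiff x' x y
      have h4 := hub y 1 x' x hle fun t ht => h1 t ht.2
      rw [e1, e2] at h3
      linarith
  · refine fun hy h1 h2 => hcontact fun x' hx' => ?_
    have e1 : |y - x'| = x' - y := by rw [abs_sub_comm, abs_of_nonneg (by linarith [hx'.1])]
    have e2 : |y - x| = x - y := by rw [abs_sub_comm, abs_of_nonneg (by linarith [hx.1])]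
    rcases le_total x x' with hle | hle
    · have h3 := hdiff x x' y
      have h4 := hlb y 0 x x' hle fun t ht => h2 t ht.1
      rw [e1, e2] at h3
      linarith
    · have h3 := hdiff x' x y
      have h4 := hub y 0 x' x hle fun t ht => h1 t ht.2
      rw [e1, e2] at h3
      linarith

lemma abs_coeff_le {a b p q : ℝ} (hab : a < b) (hp : p ≤ a) (hq : b ≤ q) :
    |1 / (q - p)| ≤ 1 / (b - a) + 1 + |a| / (b - a) ∧
      |-p / (q - p)| ≤ 1 / (b - a) + 1 + |a| / (b - a) := by
  have hba : 0 < b - a := sub_pos.2 hab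
  have hd : b - a ≤ q - p := by linarith
  have hd0 : 0 < q - p := hba.trans_le hd
  have h1 : 1 / (q - p) ≤ 1 / (b - a) := by gcongr
  have h2 : |a| / (q - p) ≤ |a| / (b - a) := by gcongr
  have h3 : 0 ≤ 1 / (q - p) := by positivity
  have h4 : 0 ≤ |a| / (b - a) := by positivity
  refine ⟨by rw [abs_of_nonneg h3]; linarith, ?_⟩
  rw [show -p / (q - p) = (a - p) / (q - p) - a / (q - p) by ring]
  have h5 : (a - p) / (q - p) ≤ 1 := by rw [div_le_one hd0]; linarith
  have h6 : 0 ≤ (a - p) / (q - p) := div_nonneg (by linarith) hd0.le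
  have h7 : |a / (q - p)| = |a| / (q - p) := by rw [abs_div, abs_of_pos hd0]
  calc |(a - p) / (q - p) - a / (q - p)| ≤ |(a - p) / (q - p)| + |a / (q - p)| := abs_sub _ _
    _ ≤ _ := by rw [abs_of_nonneg h6, h7]; linarith

lemma exists_coeff (G lt wt : ℝ → ℝ) (a b L M : ℝ) (hab : a < b)
    (hG : Measurable G) (hGm : MonotoneOn G (Ioo 0 M))
    (hGa : ∀ v ∈ Ioo 0 L, G v ≤ a) (hGb : ∀ v ∈ Ioo L M, b ≤ G v)
    (hlt : Measurable lt) (hwt : Measurable wt) (hl : ∀ t, lt t ∈ Icc 0 L)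
    (hw : ∀ t, wt t ∈ Icc L M) :
    ∃ k m : ℝ → ℝ, ∃ C : ℝ, Measurable k ∧ Measurable m ∧ (∀ t, |k t| ≤ C) ∧ (∀ t, |m t| ≤ C) ∧
      (∀ t, ∀ y ∈ Icc a b, 0 ≤ k t * y + m t ∧ k t * y + m t ≤ 1) ∧
      ∀ t, (∀ v ∈ Ioo 0 L, (v ≤ lt t → k t * G v + m t ≤ 0) ∧ (lt t ≤ v → 0 ≤ k t * G v + m t)) ∧
        (∀ v ∈ Ioo L M, (v ≤ wt t → k t * G v + m t ≤ 1) ∧ (wt t ≤ v → 1 ≤ k t * G v + m t)) := by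
  classical
  have hba : 0 < b - a := sub_pos.2 hab
  set Gl : ℝ → ℝ := fun v => if v < L ∧ 0 < v then G v else a
  set Gr : ℝ → ℝ := fun v => if v ≤ L ∨ M ≤ v then b else G v
  have hGl : Measurable Gl := Measurable.ite (measurableSet_Iio.inter measurableSet_Ioi) hG
    measurable_const
  have hGr : Measurable Gr := Measurable.ite (measurableSet_Iic.union measurableSet_Ici)
    measurable_const hG
  have hGla : ∀ v, Gl v ≤ a := fun v => by
    simp only [Gl]; split_ifs with h
    · exact hGa v ⟨h.2, h.1⟩
    · exact le_rfl
  have hGrb : ∀ v, b ≤ Gr v := fun v => by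
    simp only [Gr]; split_ifs with h
    · exact le_rfl
    · push Not at h; exact hGb v ⟨h.1, h.2⟩
  set p : ℝ → ℝ := fun t => Gl (lt t)
  set q : ℝ → ℝ := fun t => Gr (wt t)
  have hp : Measurable p := hGl.comp hlt
  have hq : Measurable q := hGr.comp hwt
  have hS1 : MeasurableSet {t | lt t = 0} := hlt (measurableSet_singleton 0)
  have hS2 : MeasurableSet {t | wt t = M} := hwt (measurableSet_singleton M)
  have hd : ∀ t, 0 < q t - p t := fun t => by linarith [hGla (lt t), hGrb (wt t)]
  have hval : ∀ t y, 1 / (q t - p t) * y + -p t / (q t - p t) = (y - p t) / (q t - p t) :=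
    fun t y => by ring
  have hC0 : 0 ≤ 1 / (b - a) + |a| / (b - a) := by positivity
  refine ⟨fun t => if wt t = M then 0 else if lt t = 0 then 0 else 1 / (q t - p t),
    fun t => if wt t = M then 0 else if lt t = 0 then 1 else -p t / (q t - p t),
    1 / (b - a) + 1 + |a| / (b - a),
    Measurable.ite hS2 measurable_const (Measurable.ite hS1 measurable_const (by fun_prop)),
    Measurable.ite hS2 measurable_const (Measurable.ite hS1 measurable_const (by fun_prop)),
    fun t => ?_, fun t => ?_, fun t y hy => ?_, fun t => ⟨fun v hv => ?_, fun v hv => ?_⟩⟩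
  · dsimp only; split_ifs
    · rw [abs_zero]; linarith
    · rw [abs_zero]; linarith
    · exact (abs_coeff_le hab (hGla _) (hGrb _)).1
  · dsimp only; split_ifs
    · rw [abs_zero]; linarith
    · rw [abs_one]; linarith
    · exact (abs_coeff_le hab (hGla _) (hGrb _)).2
  · dsimp only; split_ifs
    · simp
    · simp
    · rw [hval, div_le_one (hd t)]
      exact ⟨div_nonneg (by linarith [hy.1, hGla (lt t)]) (hd t).le,
        by linarith [hy.2, hGrb (wt t)]⟩
  · dsimp only; split_ifs with h1 h2
    · simp
    · simp only [zero_mul, zero_add, zero_le_one, implies_true, and_true, h2]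
      exact fun h => absurd h hv.1.not_ge
    · have hl0 : 0 < lt t := lt_of_le_of_ne (hl t).1 (Ne.symm h2)
      have hvM : ∀ x ∈ Ioo 0 L, x ∈ Ioo 0 M := fun x hx =>
        ⟨hx.1, hx.2.trans_le ((hw t).1.trans (hw t).2)⟩
      rw [hval]
      constructor
      · intro hvl
        refine div_nonpos_of_nonpos_of_nonneg (sub_nonpos.2 ?_) (hd t).le
        simp only [p, Gl]
        split_ifs with h3
        · exact hGm (hvM v hv) (hvM _ ⟨h3.2, h3.1⟩) hvl
        · exact hGa v hv
      · intro hvl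
        refine div_nonneg (sub_nonneg.2 ?_) (hd t).le
        have h3 : lt t < L ∧ 0 < lt t := ⟨hvl.trans_lt hv.2, hl0⟩
        simp only [p, Gl, if_pos h3]
        exact hGm (hvM _ ⟨h3.2, h3.1⟩) (hvM v hv) hvl
  · dsimp only; split_ifs with h1 h2
    · simp only [zero_mul, zero_add, zero_le_one, implies_true, true_and, h1]
      exact fun h => absurd h hv.2.not_ge
    · simp
    · have hwM : wt t < M := lt_of_le_of_ne (hw t).2 h1
      have hL : 0 ≤ L := (hl t).1.trans (hl t).2
      have hvM : ∀ x ∈ Ioo L M, x ∈ Ioo 0 M := fun x hx => ⟨hL.trans_lt hx.1, hx.2⟩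
      rw [hval, div_le_one (hd t), one_le_div (hd t)]
      constructor
      · intro hvl
        refine sub_le_sub_right ?_ _
        have h3 : ¬ (wt t ≤ L ∨ M ≤ wt t) := by
          push Not; exact ⟨hv.1.trans_le hvl, hwM⟩
        simp only [q, Gr, if_neg h3]
        exact hGm (hvM v hv) (hvM _ ⟨hv.1.trans_le hvl, hwM⟩) hvl
      · intro hvl
        refine sub_le_sub_right ?_ _
        simp only [q, Gr]
        split_ifs with h3
        · exact hGb v hv
        · push Not at h3
          exact hGm (hvM _ h3) (hvM v hv) hvl

/-- Generalized inverse of a nonincreasing function. -/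
lemma exists_antitone_inverse (X : ℝ → ℝ) (hX : Antitone X) (M : ℝ) (hM : 0 ≤ M) :
    ∃ N : ℝ → ℝ, Antitone N ∧ (∀ t, N t ∈ Icc 0 M) ∧
      ∀ t, ∀ u ∈ Icc 0 M, (t < X u → u ≤ N t) ∧ (X u < t → N t ≤ u) := by
  set S : ℝ → Set ℝ := fun t => {u | u ∈ Icc 0 M ∧ (u = 0 ∨ t < X u)}
  have hbdd : ∀ t, BddAbove (S t) := fun t => ⟨M, fun u hu => hu.1.2⟩
  have h0 : ∀ t, (0 : ℝ) ∈ S t := fun t => ⟨⟨le_rfl, hM⟩, Or.inl rfl⟩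
  refine ⟨fun t => sSup (S t), fun s t hst => ?_, fun t => ?_, fun t u hu => ⟨fun h => ?_,
    fun h => ?_⟩⟩
  · exact csSup_le_csSup (hbdd s) ⟨0, h0 t⟩ fun u hu => ⟨hu.1, hu.2.imp id hst.trans_lt⟩
  · exact ⟨le_csSup (hbdd t) (h0 t), csSup_le ⟨0, h0 t⟩ fun u hu => hu.1.2⟩
  · exact le_csSup (hbdd t) ⟨hu, Or.inr h⟩
  · refine csSup_le ⟨0, h0 t⟩ fun w hw => ?_
    rcases hw.2 with rfl | hw2
    · exact hu.1
    · by_contra! hlt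
      exact absurd (hX hlt.le) (by linarith)

lemma restrict_sublevel_time_change (l θ : ℝ → ℝ) (L M u : ℝ) (hLM : L ≤ M)
    (hθ : Measurable θ)
    (hl : 0 ≤ l u ∧ l u ≤ L ∧ 0 ≤ u - l u ∧ u - l u ≤ M - L)
    (h : ∀ v ∈ Ioo 0 M,
      (v ≤ L → (θ v ≤ u → v ≤ l u) ∧ (u ≤ θ v → l u ≤ v)) ∧
      (L < v → (θ v ≤ u → v ≤ L + (u - l u)) ∧ (u ≤ θ v → L + (u - l u) ≤ v))) :
    (volume.restrict (Ioo 0 M)).restrict (θ ⁻¹' Iic u) =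
      volume.restrict (Ioc 0 (l u)) + volume.restrict (Ioc L (L + (u - l u))) := by
  obtain ⟨h1, h2, h3, h4⟩ := hl
  rw [Measure.restrict_restrict (hθ measurableSet_Iic), ← Measure.restrict_union
    (Set.disjoint_left.2 fun v hv hv' => by
      have := hv.2; have := hv'.1; linarith) measurableSet_Ioc]
  refine Measure.restrict_congr_set ?_
  have hfin : ({M, l u, L + (u - l u)} : Set ℝ).Finite := by simp
  filter_upwards [compl_mem_ae_iff.2 (hfin.measure_zero volume)] with v hv
  simp only [mem_compl_iff, mem_insert_iff, mem_singleton_iff, not_or] at hv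
  obtain ⟨n1, n2, n3⟩ := hv
  refine propext ⟨?_, ?_⟩
  · rintro ⟨k1, k2⟩
    rcases le_or_gt v L with hvL | hvL
    · exact Or.inl ⟨k2.1, ((h v k2).1 hvL).1 k1⟩
    · exact Or.inr ⟨hvL, ((h v k2).2 hvL).1 k1⟩
  · rintro (⟨k1, k2⟩ | ⟨k1, k2⟩)
    · have hvM : v ∈ Ioo 0 M := ⟨k1, lt_of_le_of_ne (by linarith) n1⟩
      refine ⟨?_, hvM⟩
      by_contra hlt
      simp only [mem_preimage, mem_Iic, not_le] at hlt
      exact n2 (le_antisymm k2 (((h v hvM).1 (k2.trans h2)).2 hlt.le))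
    · have hvM : v ∈ Ioo 0 M := ⟨by linarith, lt_of_le_of_ne (by linarith) n1⟩
      refine ⟨?_, hvM⟩
      by_contra hlt
      simp only [mem_preimage, mem_Iic, not_le] at hlt
      exact n3 (le_antisymm k2 (((h v hvM).2 k1).2 hlt.le))

/-- The monotone martingale transport on quantile coordinates, together with the coefficients of a
dual potential for which it is tight. -/
lemma exists_quantile_transport (G X : ℝ → ℝ) (a b L M : ℝ) (hab : a < b) (hL : 0 ≤ L)
    (hLM : L ≤ M) (hG : Measurable G) (hGm : MonotoneOn G (Ioo 0 M))
    (hGa : ∀ v ∈ Ioo 0 L, G v ≤ a) (hGb : ∀ v ∈ Ioo L M, b ≤ G v)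
    (hGi : IntegrableOn G (Ioo 0 M)) (hX : Antitone X) (hXab : ∀ u, X u ∈ Icc a b)
    (hmean : ∫ v in Ioo 0 M, G v = ∫ u in Ioo 0 M, X u) :
    ∃ θ k m : ℝ → ℝ, ∃ C : ℝ, Measurable θ ∧
      (volume.restrict (Ioo 0 M)).map θ = volume.restrict (Ioo 0 M) ∧
      (∀ f : ℝ → ℝ, Measurable f → (∃ B, ∀ x, |f x| ≤ B) →
        ∫ v in Ioo 0 M, f (X (θ v)) * (G v - X (θ v)) = 0) ∧
      Measurable k ∧ Measurable m ∧ (∀ t, |k t| ≤ C) ∧ (∀ t, |m t| ≤ C) ∧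
      (∀ t, ∀ y ∈ Icc a b, 0 ≤ k t * y + m t ∧ k t * y + m t ≤ 1) ∧
      ∀ v ∈ Ioo 0 M,
        (v < L → (∀ t < X (θ v), k t * G v + m t ≤ 0) ∧ ∀ t > X (θ v), 0 ≤ k t * G v + m t) ∧
        (L < v → (∀ t < X (θ v), k t * G v + m t ≤ 1) ∧ ∀ t > X (θ v), 1 ≤ k t * G v + m t) := by
  have hM : 0 ≤ M := hL.trans hLM
  have hXm : Measurable X := hX.measurable
  have hXi : ∀ x y, IntervalIntegrable X volume x y := fun x y => hX.intervalIntegrable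
  have hGI : IntervalIntegrable G volume 0 M := by
    rwa [intervalIntegrable_iff_integrableOn_Ioo_of_le hM]
  have hGI' : ∀ x y, x ∈ Icc 0 M → y ∈ Icc 0 M → IntervalIntegrable G volume x y :=
    fun x y hx hy => hGI.mono_set (by
      rw [uIcc_of_le hM]; exact uIcc_subset_Icc hx hy)
  have hGsub : ∀ x y, x ∈ Icc 0 M → y ∈ Icc 0 M →
      (∫ t in (0:ℝ)..y, G t) - ∫ t in (0:ℝ)..x, G t = ∫ t in x..y, G t :=
    fun x y hx hy => intervalIntegral.integral_interval_sub_left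
      (hGI' _ _ ⟨le_rfl, hM⟩ hy) (hGI' _ _ ⟨le_rfl, hM⟩ hx)
  have hXsub : ∀ x y, (∫ t in (0:ℝ)..y, X t) - ∫ t in (0:ℝ)..x, X t = ∫ t in x..y, X t :=
    fun x y => intervalIntegral.integral_interval_sub_left (hXi _ _) (hXi _ _)
  have hub : ∀ (f : ℝ → ℝ) c x y, x ≤ y → IntervalIntegrable f volume x y →
      (∀ t ∈ Ioo x y, f t ≤ c) → ∫ t in x..y, f t ≤ c * (y - x) := by
    intro f c x y hxy hf hc
    have := intervalIntegral.integral_mono_on_of_le_Ioo hxy hf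
      (intervalIntegrable_const (c := c)) hc
    rwa [intervalIntegral.integral_const, smul_eq_mul, mul_comm] at this
  have hlb : ∀ (f : ℝ → ℝ) c x y, x ≤ y → IntervalIntegrable f volume x y →
      (∀ t ∈ Ioo x y, c ≤ f t) → c * (y - x) ≤ ∫ t in x..y, f t := by
    intro f c x y hxy hf hc
    have := intervalIntegral.integral_mono_on_of_le_Ioo hxy
      (intervalIntegrable_const (c := c)) hf hc
    rwa [intervalIntegral.integral_const, smul_eq_mul, mul_comm] at this
  obtain ⟨l, hl, hlm⟩ := exists_split (fun v => ∫ t in (0:ℝ)..v, G t)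
    (fun v => ∫ t in (0:ℝ)..v, X t) a b L M hab hL hLM
    (by
      have := intervalIntegral.continuousOn_primitive_interval (f := G) (μ := volume) (a := 0)
        (b := M) (by
          rw [uIcc_of_le hM]
          exact (intervalIntegrable_iff_integrableOn_Icc_of_le hM).1 hGI)
      rwa [uIcc_of_le hM] at this)
    (fun x y hx hxy hy => by
      have h1 : x ∈ Icc 0 M := ⟨hx, by linarith⟩
      have h2 : y ∈ Icc 0 M := ⟨by linarith, by linarith⟩
      rw [hGsub x y h1 h2]
      exact hub G a x y hxy (hGI' x y h1 h2) fun t ht =>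
        hGa t ⟨hx.trans_lt ht.1, ht.2.trans_le hy⟩)
    (fun x y hx hxy hy => by
      have h1 : x ∈ Icc 0 M := ⟨by linarith, by linarith⟩
      have h2 : y ∈ Icc 0 M := ⟨by linarith, by linarith⟩
      rw [hGsub x y h1 h2]
      exact hlb G b x y hxy (hGI' x y h1 h2) fun t ht =>
        hGb t ⟨hx.trans_lt ht.1, ht.2.trans_le hy⟩)
    (fun x y _ hxy _ => by
      rw [hXsub]
      exact hlb X a x y hxy (hXi x y) fun t _ => (hXab t).1)
    (fun x y _ hxy _ => by
      rw [hXsub]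
      exact hub X b x y hxy (hXi x y) fun t _ => (hXab t).2)
    (by simp) (by simp)
    (by
      simp only [intervalIntegral.integral_of_le hM, integral_Ioc_eq_integral_Ioo]
      exact hmean)
  have hl' : ∀ u, 0 ≤ u → u ≤ M → 0 ≤ l u ∧ l u ≤ L ∧ 0 ≤ u - l u ∧ u - l u ≤ M - L :=
    fun u h0 h1 => ⟨(hl u h0 h1).1, (hl u h0 h1).2.1, (hl u h0 h1).2.2.1, (hl u h0 h1).2.2.2.1⟩
  obtain ⟨θ, hθ, hθv⟩ := exists_time_change l L M hL hLM hl' hlm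
  have hres : ∀ u ∈ Icc 0 M, (volume.restrict (Ioo 0 M)).restrict (θ ⁻¹' Iic u) =
      volume.restrict (Ioc 0 (l u)) + volume.restrict (Ioc L (L + (u - l u))) := fun u hu =>
    restrict_sublevel_time_change l θ L M u hLM hθ (hl' u hu.1 hu.2)
      fun v hv => (hθv v hv).2 u hu
  have hneg : ∀ u < 0, (volume.restrict (Ioo 0 M)).restrict (θ ⁻¹' Iic u) = 0 := by
    intro u hu
    rw [Measure.restrict_restrict (hθ measurableSet_Iic)]
    have : θ ⁻¹' Iic u ∩ Ioo 0 M = ∅ := by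
      ext v
      simp only [mem_inter_iff, mem_preimage, mem_Iic, mem_empty_iff_false, iff_false, not_and]
      intro h1 h2
      linarith [(hθv v h2).1.1]
    rw [this, Measure.restrict_empty]
  have hbig : ∀ u, M < u → (volume.restrict (Ioo 0 M)).restrict (θ ⁻¹' Iic u) =
      (volume.restrict (Ioo 0 M)).restrict (θ ⁻¹' Iic M) := by
    intro u hu
    rw [Measure.restrict_restrict (hθ measurableSet_Iic),
      Measure.restrict_restrict (hθ measurableSet_Iic)]
    congr 1
    ext v
    simp only [mem_inter_iff, mem_preimage, mem_Iic]
    exact and_congr_left fun hv => ⟨fun _ => (hθv v hv).1.2, fun h => h.trans hu.le⟩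
  have hvol : ∀ u ∈ Icc 0 M, volume (Iic u ∩ Ioo 0 M) = ENNReal.ofReal u := by
    intro u hu
    refine le_antisymm ?_ ?_
    · calc volume (Iic u ∩ Ioo 0 M) ≤ volume (Ioc 0 u) :=
          measure_mono fun s hs => ⟨hs.2.1, hs.1⟩
        _ = _ := by rw [Real.volume_Ioc, sub_zero]
    · calc ENNReal.ofReal u = volume (Ioo 0 u) := by rw [Real.volume_Ioo, sub_zero]
        _ ≤ volume (Iic u ∩ Ioo 0 M) := measure_mono fun s hs =>
          ⟨hs.2.le, hs.1, hs.2.trans_le hu.2⟩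
  have hmapM : ∀ u ∈ Icc 0 M, (volume.restrict (Ioo 0 M)).map θ (Iic u) =
      volume.restrict (Ioo 0 M) (Iic u) := by
    intro u hu
    obtain ⟨h1, h2, h3, h4⟩ := hl' u hu.1 hu.2
    rw [Measure.map_apply hθ measurableSet_Iic, ← Measure.restrict_apply_univ (θ ⁻¹' Iic u),
      hres u hu, Measure.restrict_apply measurableSet_Iic, hvol u hu]
    simp only [Measure.coe_add, Pi.add_apply, Measure.restrict_apply_univ, Real.volume_Ioc]
    rw [← ENNReal.ofReal_add (by linarith) (by linarith)]
    congr 1; ring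
  have hmap : (volume.restrict (Ioo 0 M)).map θ = volume.restrict (Ioo 0 M) := by
    refine Measure.ext_of_Iic _ _ fun u => ?_
    rcases lt_or_ge u 0 with hu | hu
    · rw [Measure.map_apply hθ measurableSet_Iic, ← Measure.restrict_apply_univ (θ ⁻¹' Iic u),
        hneg u hu, Measure.restrict_apply measurableSet_Iic]
      have : Iic u ∩ Ioo 0 M = ∅ := by
        ext v
        simp only [mem_inter_iff, mem_Iic, mem_empty_iff_false, iff_false, not_and]
        intro h1 h2
        linarith [h2.1]
      simp [this]
    · rcases le_or_gt u M with huM | huM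
      · exact hmapM u ⟨hu, huM⟩
      · have h1 := hmapM M ⟨hM, le_rfl⟩
        rw [Measure.map_apply hθ measurableSet_Iic, ← Measure.restrict_apply_univ (θ ⁻¹' Iic _)]
          at h1 ⊢
        rw [hbig u huM, h1, Measure.restrict_apply measurableSet_Iic,
          Measure.restrict_apply measurableSet_Iic]
        congr 1
        ext v
        simp only [mem_inter_iff, mem_Iic]
        exact and_congr_left fun hv => ⟨fun _ => hv.2.le.trans huM.le, fun _ => hv.2.le⟩
  have hXb : ∀ x, |X x| ≤ |a| + |b| := fun x => by
    have h1 := hXab x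
    rw [abs_le]
    constructor
    · linarith [neg_abs_le a, abs_nonneg b, h1.1]
    · linarith [le_abs_self b, abs_nonneg a, h1.2]
  have hXθi : Integrable (fun v => X (θ v)) (volume.restrict (Ioo 0 M)) :=
    Measure.integrableOn_of_bounded (M := |a| + |b|) (by simp)
      (hXm.comp hθ).aestronglyMeasurable (Filter.Eventually.of_forall fun v => hXb _)
  have hzero : ∀ u ∈ Icc 0 M,
      ∫ v in θ ⁻¹' Iic u, (G v - X (θ v)) ∂(volume.restrict (Ioo 0 M)) = 0 := by
    intro u hu
    obtain ⟨h1, h2, h3, h4⟩ := hl' u hu.1 hu.2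
    have hw : L + (u - l u) ∈ Icc 0 M := ⟨by linarith, by linarith⟩
    have e1 : ∫ v in θ ⁻¹' Iic u, X (θ v) ∂(volume.restrict (Ioo 0 M)) =
        ∫ t in (0:ℝ)..u, X t := by
      rw [← setIntegral_map measurableSet_Iic hXm.aestronglyMeasurable hθ.aemeasurable, hmap,
        Measure.restrict_restrict measurableSet_Iic, intervalIntegral.integral_of_le hu.1]
      refine setIntegral_congr_set ?_
      filter_upwards [compl_mem_ae_iff.2 (measure_singleton (μ := volume) M)] with v hv
      have : v ∈ Iic u ∩ Ioo 0 M ↔ v ∈ Ioc 0 u :=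
        ⟨fun h => ⟨h.2.1, h.1⟩, fun h => ⟨h.2, h.1, lt_of_le_of_ne (h.2.trans hu.2) hv⟩⟩
      exact propext this
    have hi1 := hGI' 0 (l u) ⟨le_rfl, hM⟩ ⟨h1, by linarith⟩
    have hi2 := hGI' L (L + (u - l u)) ⟨hL, hLM⟩ hw
    rw [intervalIntegrable_iff_integrableOn_Ioc_of_le (by linarith)] at hi1 hi2
    have e2 : ∫ v in θ ⁻¹' Iic u, G v ∂(volume.restrict (Ioo 0 M)) = ∫ t in (0:ℝ)..u, X t := by
      rw [hres u hu, integral_add_measure hi1 hi2, ← (hl u hu.1 hu.2).2.2.2.2, add_sub_assoc,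
        hGsub L _ ⟨hL, hLM⟩ hw, intervalIntegral.integral_of_le (by linarith),
        intervalIntegral.integral_of_le (by linarith)]
    rw [integral_sub hGi.integrableOn hXθi.integrableOn, e1, e2, sub_self]
  have hzero' : ∀ u, ∫ v in θ ⁻¹' Iic u, (G v - X (θ v)) ∂(volume.restrict (Ioo 0 M)) = 0 := by
    intro u
    rcases lt_or_ge u 0 with hu | hu
    · rw [hneg u hu, integral_zero_measure]
    · rcases le_or_gt u M with huM | huM
      · exact hzero u ⟨hu, huM⟩
      · rw [hbig u huM]; exact hzero M ⟨hM, le_rfl⟩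
  obtain ⟨N, hN, hNM, hNX⟩ := exists_antitone_inverse X hX M hM
  have hlN : ∀ t, l (N t) ∈ Icc 0 L := fun t =>
    ⟨(hl' _ (hNM t).1 (hNM t).2).1, (hl' _ (hNM t).1 (hNM t).2).2.1⟩
  have hwN : ∀ t, L + (N t - l (N t)) ∈ Icc L M := fun t => by
    obtain ⟨h1, h2, h3, h4⟩ := hl' _ (hNM t).1 (hNM t).2
    constructor <;> linarith
  have hlNa : Antitone fun t => l (N t) := fun s t hst =>
    (hlm _ _ (hNM t).1 (hN hst) (hNM s).2).1
  have hwNa : Antitone fun t => L + (N t - l (N t)) := fun s t hst =>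
    add_le_add_right (hlm _ _ (hNM t).1 (hN hst) (hNM s).2).2 L
  obtain ⟨k, m, C, hk, hm, hkC, hmC, hkm, hcon⟩ := exists_coeff G (fun t => l (N t))
    (fun t => L + (N t - l (N t))) a b L M hab hG hGm hGa hGb hlNa.measurable hwNa.measurable
    hlN hwN
  refine ⟨θ, k, m, C, hθ, hmap, fun f hf ⟨B, hB⟩ => ?_, hk, hm, hkC, hmC, hkm, fun v hv => ?_⟩
  · exact integral_comp_mul_eq_zero _ θ (fun v => G v - X (θ v)) hθ (hG.sub (hXm.comp hθ))
      (hGi.sub hXθi) hzero' (fun u => f (X u)) (hf.comp hXm) B fun x => hB _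
  · obtain ⟨hθM, hθu⟩ := hθv v hv
    constructor
    · refine fun hvL => ⟨fun t ht => ?_, fun t ht => ?_⟩
      · exact ((hcon t).1 v ⟨hv.1, hvL⟩).1 (((hθu _ (hNM t)).1 hvL.le).1 ((hNX t _ hθM).1 ht))
      · exact ((hcon t).1 v ⟨hv.1, hvL⟩).2 (((hθu _ (hNM t)).1 hvL.le).2 ((hNX t _ hθM).2 ht))
    · refine fun hvL => ⟨fun t ht => ?_, fun t ht => ?_⟩
      · exact ((hcon t).2 v ⟨hvL, hv.2⟩).1 (((hθu _ (hNM t)).2 hvL).1 ((hNX t _ hθM).1 ht))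
      · exact ((hcon t).2 v ⟨hvL, hv.2⟩).2 (((hθu _ (hNM t)).2 hvL).2 ((hNX t _ hθM).2 ht))

/-- The quantile function of a measure that does not charge `(a, b)` jumps across that interval. -/
lemma quantile_jump (γ : Measure ℝ) [IsFiniteMeasure γ] (a b : ℝ)
    (hγ : γ (Ioo a b) = 0) (G : ℝ → ℝ) (hG : Measurable G)
    (hGm : MonotoneOn G (Ioo 0 (γ.real univ)))
    (hmap : (volume.restrict (Ioo 0 (γ.real univ))).map G = γ) :
    (∀ v ∈ Ioo 0 (γ.real (Iic a)), G v ≤ a) ∧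
      ∀ v ∈ Ioo (γ.real (Iic a)) (γ.real univ), b ≤ G v := by
  have hLM : γ.real (Iic a) ≤ γ.real univ := measureReal_mono (subset_univ _)
  have hpre : ∀ s : Set ℝ, MeasurableSet s →
      γ.real s = volume.real (G ⁻¹' s ∩ Ioo 0 (γ.real univ)) := by
    intro s hs
    conv_lhs => rw [← hmap]
    rw [map_measureReal_apply hG hs, measureReal_restrict_apply (hG hs)]
  constructor
  · intro v hv
    by_contra! hlt
    have h : γ.real (Iic a) ≤ v := by
      rw [hpre _ measurableSet_Iic]
      have h1 : G ⁻¹' Iic a ∩ Ioo 0 (γ.real univ) ⊆ Ioo 0 v := by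
        refine fun w hw => ⟨hw.2.1, ?_⟩
        by_contra! hvw
        exact absurd (hGm ⟨hv.1, hv.2.trans_le hLM⟩ hw.2 hvw) (not_le.2 (hw.1.trans_lt hlt))
      refine (measureReal_mono h1 (by simp)).trans ?_
      rw [Real.volume_real_Ioo, sub_zero, max_eq_left hv.1.le]
    exact absurd hv.2 (not_lt.2 h)
  · intro v hv
    by_contra! hlt
    have h0 : 0 ≤ γ.real (Iic a) := measureReal_nonneg
    have hb : γ.real (Iio b) ≤ γ.real (Iic a) := by
      have : Iio b ⊆ Iic a ∪ Ioo a b := fun x hx => by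
        rcases le_or_gt x a with h | h
        · exact Or.inl h
        · exact Or.inr ⟨h, hx⟩
      refine (measureReal_mono this).trans ((measureReal_union_le _ _).trans ?_)
      rw [measureReal_def γ (Ioo a b), hγ]
      simp
    have h : v ≤ γ.real (Iio b) := by
      rw [hpre _ measurableSet_Iio]
      have h1 : Ioc 0 v ⊆ G ⁻¹' Iio b ∩ Ioo 0 (γ.real univ) := fun w hw =>
        ⟨(hGm ⟨hw.1, hw.2.trans_lt hv.2⟩ ⟨h0.trans_lt hv.1, hv.2⟩ hw.2).trans_lt hlt,
          hw.1, hw.2.trans_lt hv.2⟩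
      refine le_trans ?_ (measureReal_mono h1 (measure_inter_lt_top_of_right_ne_top (by simp)).ne)
      rw [Real.volume_real_Ioc, sub_zero]
      exact le_max_left _ _
    linarith [hv.1]

/-- A measure carried by `[a, b]` is the law of a decreasing function with values in `[a, b]`. -/
lemma exists_antitone_quantile (η : Measure ℝ) [IsFiniteMeasure η] (a b : ℝ) (hab : a ≤ b)
    (hη : η (Icc a b)ᶜ = 0) :
    ∃ X : ℝ → ℝ, Antitone X ∧ (∀ u, X u ∈ Icc a b) ∧
      (volume.restrict (Ioo 0 (η.real univ))).map X = η := by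
  obtain ⟨Q, hQ, hQm, hQmap⟩ := exists_quantile η
  set M := η.real univ
  classical
  have hclamp : ∀ x, max a (min x b) ∈ Icc a b := fun x =>
    ⟨le_max_left _ _, max_le hab (min_le_right _ _)⟩
  have hrefl : MeasurePreserving (fun u => M - u) (volume.restrict (Ioo 0 M))
      (volume.restrict (Ioo 0 M)) := by
    have h := (Measure.measurePreserving_sub_left (volume : Measure ℝ) M).restrict_preimage
      (measurableSet_Ioo (a := 0) (b := M))
    simpa using h
  refine ⟨fun u => if u ≤ 0 then b else if M ≤ u then a else max a (min (Q (M - u)) b), ?_, ?_, ?_⟩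
  · intro u v huv
    dsimp only
    by_cases h1 : u ≤ 0
    · rw [if_pos h1]
      split_ifs
      exacts [le_rfl, hab, (hclamp _).2]
    · rw [if_neg h1, if_neg (by linarith : ¬ v ≤ 0)]
      by_cases h2 : M ≤ v
      · rw [if_pos h2]
        split_ifs
        exacts [le_rfl, (hclamp _).1]
      · rw [if_neg h2, if_neg (by linarith : ¬ M ≤ u)]
        push Not at h1 h2
        refine max_le_max le_rfl (min_le_min (hQm ?_ ?_ (by linarith)) le_rfl) <;>
          constructor <;> linarith
  · intro u
    dsimp only
    split_ifs
    exacts [⟨hab, le_rfl⟩, ⟨le_rfl, hab⟩, hclamp _]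
  · have hc : Measurable fun x : ℝ => max a (min x b) := by fun_prop
    have e : (fun u => if u ≤ 0 then b else if M ≤ u then a else max a (min (Q (M - u)) b))
        =ᵐ[volume.restrict (Ioo 0 M)] ((fun x => max a (min x b)) ∘ Q) ∘ fun u => M - u := by
      filter_upwards [ae_restrict_mem measurableSet_Ioo] with u hu
      simp [not_le.2 hu.1, not_le.2 hu.2]
    rw [Measure.map_congr e, ← Measure.map_map (hc.comp hQ) hrefl.measurable, hrefl.map_eq,
      ← Measure.map_map hc hQ, hQmap]
    have e2 : (fun x => max a (min x b)) =ᵐ[η] id := by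
      filter_upwards [compl_mem_ae_iff.2 hη] with x hx
      rw [compl_compl] at hx
      simp [hx.1, hx.2]
    rw [Measure.map_congr e2, Measure.map_id]

lemma IsMartingaleCoupling.integrable_fst {μ ν : Measure ℝ} {ρ : Measure (ℝ × ℝ)}
    (h : IsMartingaleCoupling μ ν ρ) {f : ℝ → ℝ} (hf : Integrable f μ) :
    Integrable (fun w => f w.1) ρ ∧ ∫ w, f w.1 ∂ρ = ∫ x, f x ∂μ := by
  obtain ⟨-, rfl, -, -⟩ := h
  exact ⟨hf.comp_measurable measurable_fst,
    (integral_map measurable_fst.aemeasurable hf.aestronglyMeasurable).symm⟩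

lemma IsMartingaleCoupling.integrable_snd {μ ν : Measure ℝ} {ρ : Measure (ℝ × ℝ)}
    (h : IsMartingaleCoupling μ ν ρ) {f : ℝ → ℝ} (hf : Integrable f ν) :
    Integrable (fun w => f w.2) ρ ∧ ∫ w, f w.2 ∂ρ = ∫ x, f x ∂ν := by
  obtain ⟨-, -, rfl, -⟩ := h
  exact ⟨hf.comp_measurable measurable_snd,
    (integral_map measurable_snd.aemeasurable hf.aestronglyMeasurable).symm⟩

/-- Weak duality. -/
lemma AdmissibleTriple.integral_sub_le {μ ν : Measure ℝ} {ρ : Measure (ℝ × ℝ)}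
    (hμ : Integrable id μ) (hν : Integrable id ν) (hρ : IsMartingaleCoupling μ ν ρ)
    {ψ₀ ψ₁ δ : ℝ → ℝ} (h : AdmissibleTriple μ ν ψ₀ ψ₁ δ) :
    ∫ y, ψ₁ y ∂ν - ∫ x, ψ₀ x ∂μ ≤ ∫ w : ℝ × ℝ, |w.2 - w.1| ∂ρ := by
  obtain ⟨h0, h1, hδ, hle⟩ := h
  obtain ⟨i0, e0⟩ := hρ.integrable_fst h0
  obtain ⟨i1, e1⟩ := hρ.integrable_snd h1
  have hd : Integrable (fun w : ℝ × ℝ => w.2 - w.1) ρ :=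
    (hρ.integrable_snd hν).1.sub (hρ.integrable_fst hμ).1
  have hi : Integrable (fun w : ℝ × ℝ => ψ₁ w.2 - ψ₀ w.1 - |w.2 - w.1|) ρ :=
    (i1.sub i0).sub hd.abs
  have hS : ∀ n : ℕ, MeasurableSet {x : ℝ | |δ x| ≤ n} := fun n =>
    measurableSet_le (hδ.norm) measurable_const
  have hSn : ∀ n : ℕ, MeasurableSet {w : ℝ × ℝ | |δ w.1| ≤ n} := fun n =>
    measurable_fst (hS n)
  have hneg : ∀ n : ℕ, ∫ w in {w : ℝ × ℝ | |δ w.1| ≤ n},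
      (ψ₁ w.2 - ψ₀ w.1 - |w.2 - w.1|) ∂ρ ≤ 0 := by
    intro n
    have hb : ∀ x, |indicator {x : ℝ | |δ x| ≤ n} δ x| ≤ n := fun x => by
      by_cases hx : |δ x| ≤ n
      · rw [indicator_of_mem (s := {x : ℝ | |δ x| ≤ n}) hx]; exact hx
      · rw [indicator_of_notMem (s := {x : ℝ | |δ x| ≤ n}) hx]; simp
    have hm : Measurable (indicator {x : ℝ | |δ x| ≤ n} δ) := hδ.indicator (hS n)
    rw [← hρ.2.2.2 _ hm ⟨n, hb⟩, ← integral_indicator (hSn n)]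
    refine integral_mono (hi.indicator (hSn n)) (hd.bdd_mul (c := n)
      (hm.comp measurable_fst).aestronglyMeasurable
      (Filter.Eventually.of_forall fun w => hb _)) fun w => ?_
    by_cases hw : |δ w.1| ≤ n
    · rw [indicator_of_mem (s := {w : ℝ × ℝ | |δ w.1| ≤ n}) hw]
      simp only [indicator_of_mem (s := {x : ℝ | |δ x| ≤ n}) hw]
      linarith [hle w.1 w.2]
    · rw [indicator_of_notMem (s := {w : ℝ × ℝ | |δ w.1| ≤ n}) hw]
      simp only [indicator_of_notMem (s := {x : ℝ | |δ x| ≤ n}) hw]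
      simp
  have hU : ⋃ n : ℕ, {w : ℝ × ℝ | |δ w.1| ≤ n} = univ :=
    eq_univ_of_forall fun w => mem_iUnion.2 (exists_nat_ge |δ w.1|)
  have hlim := tendsto_setIntegral_of_monotone (μ := ρ)
    (f := fun w : ℝ × ℝ => ψ₁ w.2 - ψ₀ w.1 - |w.2 - w.1|) hSn
    (fun p q hpq w (hw : |δ w.1| ≤ p) => le_trans hw (Nat.cast_le.2 hpq)) (by
      rw [hU]; exact hi.integrableOn)
  rw [hU, setIntegral_univ] at hlim
  have hfin := le_of_tendsto' hlim hneg
  rw [integral_sub (f := fun w : ℝ × ℝ => ψ₁ w.2 - ψ₀ w.1) (i1.sub i0) hd.abs,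
    integral_sub i1 i0, e0, e1] at hfin
  linarith

/-- A martingale coupling and an admissible pair with equal values are both optimal. -/
lemma duality_of_tight {μ ν : Measure ℝ} {ρ : Measure (ℝ × ℝ)} {ψ δ : ℝ → ℝ}
    (hμ : Integrable id μ) (hν : Integrable id ν) (hρ : IsMartingaleCoupling μ ν ρ)
    (h : AdmissibleTriple μ ν ψ ψ δ)
    (heq : ∫ y, ψ y ∂ν - ∫ x, ψ x ∂μ = ∫ w : ℝ × ℝ, |w.2 - w.1| ∂ρ) :
    primalValue μ ν = dualTildeValue μ ν ∧ primalValue μ ν = dualValue μ ν ∧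
      ∫ w : ℝ × ℝ, |w.2 - w.1| ∂ρ = primalValue μ ν := by
  have h1 : primalValue μ ν = ∫ w : ℝ × ℝ, |w.2 - w.1| ∂ρ := by
    refine IsLeast.csInf_eq ⟨⟨ρ, hρ, rfl⟩, ?_⟩
    rintro _ ⟨ρ', hρ', rfl⟩
    rw [← heq]
    exact h.integral_sub_le hμ hν hρ'
  have h2 : dualTildeValue μ ν = ∫ w : ℝ × ℝ, |w.2 - w.1| ∂ρ := by
    refine IsGreatest.csSup_eq ⟨⟨ψ, ψ, δ, h, heq.symm⟩, ?_⟩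
    rintro _ ⟨ψ₀, ψ₁, δ', h', rfl⟩
    exact h'.integral_sub_le hμ hν hρ
  have h3 : dualValue μ ν = ∫ w : ℝ × ℝ, |w.2 - w.1| ∂ρ := by
    refine IsGreatest.csSup_eq ⟨⟨ψ, δ, h, heq.symm⟩, ?_⟩
    rintro _ ⟨ψ', δ', h', rfl⟩
    exact h'.integral_sub_le hμ hν hρ
  exact ⟨h1.trans h2.symm, h1.trans h3.symm, h1.symm⟩

lemma LipschitzWith.integrable_of_integrable_id {K : NNReal} {ψ : ℝ → ℝ} (h : LipschitzWith K ψ)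
    {μ : Measure ℝ} [IsFiniteMeasure μ] (hμ : Integrable id μ) : Integrable ψ μ := by
  refine ((hμ.norm.const_mul (K : ℝ)).add (integrable_const |ψ 0|)).mono'
    h.continuous.aestronglyMeasurable (Filter.Eventually.of_forall fun x => ?_)
  have h1 := h.dist_le_mul x 0
  rw [Real.dist_eq, Real.dist_eq, sub_zero] at h1
  simp only [Real.norm_eq_abs, Pi.add_apply, id]
  linarith [abs_add_le (ψ x - ψ 0) (ψ 0), sub_add_cancel (ψ x) (ψ 0),
    congrArg abs (sub_add_cancel (ψ x) (ψ 0))]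

/-- Keeping the mass of `κ` in place and moving `η` to `γ` along a martingale transport yields a
martingale coupling. -/
lemma isMartingaleCoupling_diag_add (κ η γ P : Measure ℝ) [IsProbabilityMeasure (κ + η)]
    (A G : ℝ → ℝ) (hA : Measurable A) (hG : Measurable G) (hAη : P.map A = η)
    (hGγ : P.map G = γ) (hη : Integrable id η) (hγ : Integrable id γ)
    (horth : ∀ f : ℝ → ℝ, Measurable f → (∃ C, ∀ x, |f x| ≤ C) →
      ∫ v, f (A v) * (G v - A v) ∂P = 0) :
    IsMartingaleCoupling (κ + η) (κ + γ)
        (κ.map (fun x => (x, x)) + P.map (fun v => (A v, G v))) ∧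
      ∫ w : ℝ × ℝ, |w.2 - w.1| ∂(κ.map (fun x => (x, x)) + P.map (fun v => (A v, G v))) =
        ∫ v, |G v - A v| ∂P := by
  have hdiag : Measurable fun x : ℝ => (x, x) := by fun_prop
  have hAG : Measurable fun v => (A v, G v) := hA.prodMk hG
  have hfst : (κ.map (fun x => (x, x)) + P.map (fun v => (A v, G v))).map Prod.fst = κ + η := by
    rw [Measure.map_add _ _ measurable_fst, Measure.map_map measurable_fst hdiag,
      Measure.map_map measurable_fst hAG]
    change κ.map id + P.map A = _
    rw [Measure.map_id, hAη]
  have hsnd : (κ.map (fun x => (x, x)) + P.map (fun v => (A v, G v))).map Prod.snd = κ + γ := by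
    rw [Measure.map_add _ _ measurable_snd, Measure.map_map measurable_snd hdiag,
      Measure.map_map measurable_snd hAG]
    change κ.map id + P.map G = _
    rw [Measure.map_id, hGγ]
  have hAi : Integrable A P := by
    rw [← hAη] at hη; exact hη.comp_measurable hA
  have hGi : Integrable G P := by
    rw [← hGγ] at hγ; exact hγ.comp_measurable hG
  have hint : ∀ F : ℝ × ℝ → ℝ, Measurable F → (∀ x, F (x, x) = 0) →
      Integrable (fun v => F (A v, G v)) P →
      ∫ w, F w ∂(κ.map (fun x => (x, x)) + P.map (fun v => (A v, G v))) =
        ∫ v, F (A v, G v) ∂P := by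
    intro F hF hF0 hFi
    rw [integral_add_measure, integral_map hdiag.aemeasurable hF.aestronglyMeasurable,
      integral_map hAG.aemeasurable hF.aestronglyMeasurable]
    · simp [hF0]
    · rw [integrable_map_measure hF.aestronglyMeasurable hdiag.aemeasurable]
      simp [Function.comp_def, hF0]
    · rw [integrable_map_measure hF.aestronglyMeasurable hAG.aemeasurable]
      exact hFi
  refine ⟨⟨⟨?_⟩, hfst, hsnd, fun f hf ⟨C, hC⟩ => ?_⟩, ?_⟩
  · rw [← preimage_univ (f := Prod.fst), ← Measure.map_apply measurable_fst MeasurableSet.univ,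
      hfst, measure_univ]
  · rw [hint (fun w => f w.1 * (w.2 - w.1)) (by fun_prop) (by simp)]
    · exact horth f hf ⟨C, hC⟩
    · exact (hGi.sub hAi).bdd_mul (c := C) (hf.comp hA).aestronglyMeasurable
        (Filter.Eventually.of_forall fun v => hC _)
  · exact hint (fun w => |w.2 - w.1|) (by fun_prop) (by simp) (hGi.sub hAi).abs

/-- Under the dispersion assumption there are a martingale coupling and an admissible pair with the
same value. -/
lemma exists_tight_pair (κ η γ : Measure ℝ) [IsFiniteMeasure κ] [IsFiniteMeasure η]
    [IsFiniteMeasure γ] [IsProbabilityMeasure (κ + η)] [IsProbabilityMeasure (κ + γ)]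
    (hμ : Integrable id (κ + η)) (hν : Integrable id (κ + γ))
    (hmean : ∫ x, x ∂(κ + η) = ∫ y, y ∂(κ + γ)) (a b : ℝ) (hab : a < b)
    (hη : η (Icc a b)ᶜ = 0) (hγ : γ (Ioo a b) = 0) :
    ∃ ρ ψ δ, IsMartingaleCoupling (κ + η) (κ + γ) ρ ∧ AdmissibleTriple (κ + η) (κ + γ) ψ ψ δ ∧
      ∫ y, ψ y ∂(κ + γ) - ∫ x, ψ x ∂(κ + η) = ∫ w : ℝ × ℝ, |w.2 - w.1| ∂ρ := by
  have hM : η.real univ = γ.real univ := by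
    have e1 : (κ + η).real univ = 1 := by simp
    have e2 : (κ + γ).real univ = 1 := by simp
    rw [measureReal_add_apply] at e1 e2
    linarith
  have hκi := hμ.left_of_add_measure
  have hηi := hμ.right_of_add_measure
  have hγi := hν.right_of_add_measure
  have hmean' : ∫ x, id x ∂η = ∫ y, id y ∂γ := by
    change ∫ x, id x ∂(κ + η) = ∫ y, id y ∂(κ + γ) at hmean
    rw [integral_add_measure hκi hηi, integral_add_measure hκi hγi] at hmean
    exact add_left_cancel hmean
  obtain ⟨G, hG, hGm, hGγ⟩ := exists_quantile γ
  obtain ⟨X, hX, hXab, hXη⟩ := exists_antitone_quantile η a b hab.le hη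
  obtain ⟨hGa, hGb⟩ := quantile_jump γ a b hγ G hG hGm hGγ
  rw [hM] at hXη
  set M := γ.real univ
  set L := γ.real (Iic a)
  have hXm := hX.measurable
  have hGi : IntegrableOn G (Ioo 0 M) := by
    rw [← hGγ] at hγi; exact hγi.comp_measurable hG
  have hGX : ∫ v in Ioo 0 M, G v = ∫ u in Ioo 0 M, X u := by
    rw [← hXη, ← hGγ, integral_map hXm.aemeasurable measurable_id.aestronglyMeasurable,
      integral_map hG.aemeasurable measurable_id.aestronglyMeasurable] at hmean'
    exact hmean'.symm
  obtain ⟨θ, k, m, C, hθ, hθP, horth, hk, hm, hkC, hmC, hkm, hcon⟩ :=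
    exists_quantile_transport G X a b L M hab measureReal_nonneg
      (measureReal_mono (subset_univ _)) hG hGm hGa hGb hGi hX hXab hGX
  obtain ⟨ψ, I, δ, ⟨K, hψ⟩, hI, ⟨C', hIC⟩, hδ, hle, htight⟩ :=
    exists_potential a b C hab k m hk hm hkC hmC hkm
  have hA : Measurable fun v => X (θ v) := hXm.comp hθ
  have hAη : (volume.restrict (Ioo 0 M)).map (fun v => X (θ v)) = η := by
    rw [← Function.comp_def X θ, ← Measure.map_map hXm hθ, hθP, hXη]
  have hAi : IntegrableOn (fun v => X (θ v)) (Ioo 0 M) := by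
    rw [← hAη] at hηi; exact hηi.comp_measurable hA
  obtain ⟨hρ, hval⟩ := isMartingaleCoupling_diag_add κ η γ (volume.restrict (Ioo 0 M))
    (fun v => X (θ v)) G hA hG hAη hGγ hηi hγi horth
  refine ⟨_, ψ, δ, hρ, ⟨hψ.integrable_of_integrable_id hμ, hψ.integrable_of_integrable_id hν,
    hδ, hle⟩, ?_⟩
  have hψη := hψ.integrable_of_integrable_id hηi
  have hψγ := hψ.integrable_of_integrable_id hγi
  have hψκ := hψ.integrable_of_integrable_id hκi
  have hψm := hψ.continuous.measurable
  have hψG : IntegrableOn (fun v => ψ (G v)) (Ioo 0 M) := by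
    rw [← hGγ] at hψγ; exact hψγ.comp_measurable hG
  have hψA : IntegrableOn (fun v => ψ (X (θ v))) (Ioo 0 M) := by
    rw [← hAη] at hψη; exact hψη.comp_measurable hA
  have hIi : IntegrableOn (fun v => I (X (θ v)) * (G v - X (θ v))) (Ioo 0 M) :=
    (hGi.sub hAi).bdd_mul (c := C') (hI.comp hA).aestronglyMeasurable
      (Filter.Eventually.of_forall fun v => hIC _)
  have hpt : ∀ᵐ v ∂volume.restrict (Ioo 0 M), |G v - X (θ v)| =
      ψ (G v) - ψ (X (θ v)) - I (X (θ v)) * (G v - X (θ v)) := by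
    filter_upwards [ae_restrict_mem measurableSet_Ioo,
      ae_restrict_of_ae (compl_mem_ae_iff.2 (measure_singleton (μ := volume) L))] with v hv hvL
    rcases lt_or_gt_of_ne (show v ≠ L from hvL) with h | h
    · obtain ⟨h1, h2⟩ := (hcon v hv).1 h
      have := (htight (X (θ v)) (hXab _) (G v)).2 (hGa v ⟨hv.1, h⟩) h1 h2
      linarith
    · obtain ⟨h1, h2⟩ := (hcon v hv).2 h
      have := (htight (X (θ v)) (hXab _) (G v)).1 (hGb v ⟨h, hv.2⟩) h1 h2
      linarith
  have eG : ∫ v in Ioo 0 M, ψ (G v) = ∫ y, ψ y ∂γ := by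
    conv_rhs => rw [← hGγ, integral_map hG.aemeasurable hψm.aestronglyMeasurable]
  have eA : ∫ v in Ioo 0 M, ψ (X (θ v)) = ∫ y, ψ y ∂η := by
    conv_rhs => rw [← hAη, integral_map hA.aemeasurable hψm.aestronglyMeasurable]
  rw [hval, integral_congr_ae hpt, integral_sub (f := fun v => ψ (G v) - ψ (X (θ v)))
    (hψG.sub hψA) hIi, integral_sub hψG hψA, horth I hI ⟨C', hIC⟩, eG, eA,
    integral_add_measure hψκ hψη, integral_add_measure hψκ hψγ]
  ring

theorem stmt9 (μ ν : Measure ℝ) [IsProbabilityMeasure μ] [IsProbabilityMeasure ν]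
    (hμ : Integrable id μ) (hν : Integrable id ν)
    (hmean : ∫ x, x ∂μ = ∫ y, y ∂ν)
    (hC : ∀ x : ℝ, Cfun μ x ≤ Cfun ν x)
    (a b : ℝ) (hab : a < b)
    (hη : posPartMeasure μ ν (Icc a b)ᶜ = 0)
    (hγ : posPartMeasure ν μ (Ioo a b) = 0) :
    primalValue μ ν = dualTildeValue μ ν ∧ primalValue μ ν = dualValue μ ν ∧
    (∃ ρ : Measure (ℝ × ℝ), IsMartingaleCoupling μ ν ρ ∧
      ∫ w : ℝ × ℝ, |w.2 - w.1| ∂ρ = primalValue μ ν) ∧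
    (∃ ψ δ : ℝ → ℝ, AdmissibleTriple μ ν ψ ψ δ ∧
      ∫ y, ψ y ∂ν - ∫ x, ψ x ∂μ = dualValue μ ν) := by
  rw [posPartMeasure_eq_sub] at hη hγ
  obtain ⟨κ, hκ, h1, h2⟩ := exists_common_part μ ν
  have hμp : IsProbabilityMeasure (κ + (μ - ν)) := by rw [h1]; infer_instance
  have hνp : IsProbabilityMeasure (κ + (ν - μ)) := by rw [h2]; infer_instance
  obtain ⟨ρ, ψ, δ, hρ, hψ, heq⟩ := exists_tight_pair κ (μ - ν) (ν - μ) (by rwa [h1])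
    (by rwa [h2]) (by rwa [h1, h2]) a b hab hη hγ
  rw [h1, h2] at hρ hψ heq
  obtain ⟨e1, e2, e3⟩ := duality_of_tight hμ hν hρ hψ heq
  exact ⟨e1, e2, ⟨ρ, hρ, e3⟩, ψ, δ, hψ, heq.trans (e3.trans e2)⟩
end
end

section
/- Let μ and ν be probability measures on ℝ with equal finite means and C_μ ≤ C_ν, satisfying the Strengthened Dispersion Assumption: (μ ∧ ν)(ℝ) = 0, μ is supported in [a,b] (a < b), and ν((a,b)) = 0. Assume C_ν has a right derivative C_ν′(b+) at b, and that for every u ∈ (0,1) the supremum defining φ(u) is attained at G(u) ≤ a and H(u) ≥ b, with G and H measurable. Let U and V be independent uniform random variables on (0,1), let X = F_μ⁻¹(U) and let Y = G(U) if V ≤ (H(U) − F_μ⁻¹(U))/(H(U) − G(U)), Y = H(U) otherwise. Then X has law μ, Y has law ν, and E[|Y − X|] = sup{∫ |y − x| ρ(dx,dy) : ρ ∈ M(μ,ν)}. -/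
open Set MeasureTheory ProbabilityTheory
open scoped ENNReal Classical

noncomputable section

/-- D(x) = C_γ(x) − C_η(x). -/
def Dfun (η γ : Measure ℝ) (x : ℝ) : ℝ := Cfun γ x - Cfun η x

/-- Left-continuous quantile function F_η⁻¹(u) = inf {x : F_η(x) ≥ u}. -/
def Finv (η : Measure ℝ) (u : ℝ) : ℝ := sInf {x : ℝ | u ≤ (η (Iic x)).toReal}

/-- ℰ_u(x) = D(F_η⁻¹(u)) + (x − F_η⁻¹(u))(γ_a − u) − D(x), where γ_a = γ((−∞,a]). -/
def Efun (η γ : Measure ℝ) (a u x : ℝ) : ℝ :=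
  Dfun η γ (Finv η u) + (x - Finv η u) * ((γ (Iic a)).toReal - u) - Dfun η γ x

/-- φ(u) = sup over p̂ ≤ a, q̂ ≥ b with p̂ < F_η⁻¹(u) < q̂ of (ℰ_u(q̂) − D(p̂))/(q̂ − p̂). -/
def phiFn (η γ : Measure ℝ) (a b u : ℝ) : ℝ :=
  sSup {r : ℝ | ∃ pp qq : ℝ, pp ≤ a ∧ b ≤ qq ∧ pp < Finv η u ∧ Finv η u < qq ∧
    r = (Efun η γ a u qq - Dfun η γ pp) / (qq - pp)}

/-- ζ(u) = γ_a − u − φ(u). -/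
def zetaFn (η γ : Measure ℝ) (a b u : ℝ) : ℝ :=
  (γ (Iic a)).toReal - u - phiFn η γ a b u

/-- The attainment hypothesis: for u ∈ (0,1) the supremum defining φ(u) is attained at
P(u) ≤ a and Q(u) ≥ b with P(u) < F_η⁻¹(u) < Q(u). -/
def AttainsSup (η γ : Measure ℝ) (a b : ℝ) (P Q : ℝ → ℝ) : Prop :=
  ∀ u ∈ Ioo (0 : ℝ) 1,
    P u ≤ a ∧ b ≤ Q u ∧ P u < Finv η u ∧ Finv η u < Q u ∧
    phiFn η γ a b u = (Efun η γ a u (Q u) - Dfun η γ (P u)) / (Q u - P u)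

/-- ℱ_u(y) = C_μ(F_μ⁻¹(u)) + (y − F_μ⁻¹(u))(u − 1) + C_ν(b) + (y − b)C_ν′(b+) − C_ν(y). -/
def FfunU (μ ν : Measure ℝ) (b cb' u y : ℝ) : ℝ :=
  Cfun μ (Finv μ u) + (y - Finv μ u) * (u - 1) + Cfun ν b + (y - b) * cb' - Cfun ν y

/-- φ(u) = sup over g ≤ a, h ≥ b of (ℱ_u(h) − C_ν(g))/(h − g). -/
def phiU (μ ν : Measure ℝ) (a b cb' u : ℝ) : ℝ :=
  sSup {r : ℝ | ∃ g h : ℝ, g ≤ a ∧ b ≤ h ∧ r = (FfunU μ ν b cb' u h - Cfun ν g) / (h - g)}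

open Filter Topology

section StopLoss

variable {ζ : Measure ℝ}

lemma integrable_stopLoss [IsFiniteMeasure ζ] (h : Integrable id ζ) (s : ℝ) :
    Integrable (fun y => max (y - s) 0) ζ :=
  (Integrable.sub h (integrable_const s)).pos_part

lemma Cfun_nonneg (s : ℝ) : 0 ≤ Cfun ζ s :=
  integral_nonneg fun _ => le_max_right _ _

lemma measureReal_Ioi_eq [IsProbabilityMeasure ζ] (s : ℝ) : ζ.real (Ioi s) = 1 - cdf ζ s := by
  rw [cdf_eq_real, ← compl_Iic, probReal_compl_eq_one_sub measurableSet_Iic]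

lemma Cfun_sub_le [IsProbabilityMeasure ζ] (h : Integrable id ζ) {s t : ℝ} (hst : s ≤ t) :
    Cfun ζ s - Cfun ζ t ≤ (t - s) * (1 - cdf ζ s) := by
  have key : ∫ y, (max (y - s) 0 - max (y - t) 0) ∂ζ ≤
      ∫ y, (Ioi s).indicator (fun _ => t - s) y ∂ζ := by
    refine integral_mono ((integrable_stopLoss h s).sub (integrable_stopLoss h t))
      ((integrable_const _).indicator measurableSet_Ioi) fun y => ?_
    simp only [indicator, mem_Ioi]
    split_ifs with hy <;> grind
  rw [integral_sub (integrable_stopLoss h s) (integrable_stopLoss h t),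
    integral_indicator_const _ measurableSet_Ioi, measureReal_Ioi_eq, smul_eq_mul, mul_comm] at key
  exact key

lemma le_Cfun_sub' [IsProbabilityMeasure ζ] (h : Integrable id ζ) {s t : ℝ} (hst : s ≤ t) :
    (t - s) * ζ.real (Ici t) ≤ Cfun ζ s - Cfun ζ t := by
  have key : ∫ y, (Ici t).indicator (fun _ => t - s) y ∂ζ ≤
      ∫ y, (max (y - s) 0 - max (y - t) 0) ∂ζ := by
    refine integral_mono ((integrable_const _).indicator measurableSet_Ici)
      ((integrable_stopLoss h s).sub (integrable_stopLoss h t)) fun y => ?_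
    simp only [indicator, mem_Ici]
    split_ifs with hy <;> grind
  rw [integral_sub (integrable_stopLoss h s) (integrable_stopLoss h t),
    integral_indicator_const _ measurableSet_Ici, smul_eq_mul, mul_comm] at key
  exact key

lemma le_Cfun_sub [IsProbabilityMeasure ζ] (h : Integrable id ζ) {s t : ℝ} (hst : s ≤ t) :
    (t - s) * (1 - cdf ζ t) ≤ Cfun ζ s - Cfun ζ t := by
  refine le_trans ?_ (le_Cfun_sub' h hst)
  rw [← measureReal_Ioi_eq]
  exact mul_le_mul_of_nonneg_left (measureReal_mono Ioi_subset_Ici_self) (by linarith)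

lemma Cfun_anti [IsProbabilityMeasure ζ] (h : Integrable id ζ) : Antitone (Cfun ζ) := by
  intro s t hst
  have := le_Cfun_sub h hst
  have := mul_nonneg (sub_nonneg.2 hst) (sub_nonneg.2 (cdf_le_one ζ t))
  linarith

lemma tendsto_cdf_right (ζ : Measure ℝ) (k : ℝ) : Tendsto (cdf ζ) (𝓝[>] k) (𝓝 (cdf ζ k)) :=
  ((cdf ζ).right_continuous k).mono Ioi_subset_Ici_self

lemma derivWithin_Cfun_eq [IsProbabilityMeasure ζ] (h : Integrable id ζ) {b c : ℝ}
    (hc : HasDerivWithinAt (Cfun ζ) c (Ioi b) b) : c = cdf ζ b - 1 := by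
  have h1 : Tendsto (slope (Cfun ζ) b) (𝓝[>] b) (𝓝 c) :=
    (hasDerivWithinAt_iff_tendsto_slope' self_notMem_Ioi).1 hc
  refine tendsto_nhds_unique h1 ?_
  refine tendsto_of_tendsto_of_tendsto_of_le_of_le' tendsto_const_nhds
    ((tendsto_cdf_right ζ b).sub_const 1) ?_ ?_
  · filter_upwards [self_mem_nhdsWithin] with t (ht : b < t)
    rw [slope_def_field, le_div_iff₀ (by linarith)]
    have := Cfun_sub_le h ht.le
    linarith
  · filter_upwards [self_mem_nhdsWithin] with t (ht : b < t)
    rw [slope_def_field, div_le_iff₀ (by linarith)]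
    have := le_Cfun_sub h ht.le
    linarith

/-- A subgradient of the stop-loss function at `p` (tested on the points of `S`) is bounded
below by the slope at any point to the left of `p`. -/
lemma cdf_sub_one_le_of_subgradient [IsProbabilityMeasure ζ] (h : Integrable id ζ) {S : Set ℝ}
    {p s k : ℝ} (hs : ∀ g ∈ S, Cfun ζ p + s * (g - p) ≤ Cfun ζ g) (hk : k ∈ S) (hkp : k < p) :
    cdf ζ k - 1 ≤ s := by
  have h1 := hs k hk
  have h2 := Cfun_sub_le h hkp.le
  by_contra! hlt
  nlinarith [mul_pos (sub_pos.2 hkp) (sub_pos.2 hlt)]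

lemma subgradient_le_cdf_sub_one [IsProbabilityMeasure ζ] (h : Integrable id ζ) {S : Set ℝ}
    {p s k : ℝ} (hs : ∀ g ∈ S, Cfun ζ p + s * (g - p) ≤ Cfun ζ g) (hkp : p ≤ k)
    (hk : ∀ᶠ g in 𝓝[>] k, g ∈ S) : s ≤ cdf ζ k - 1 := by
  refine ge_of_tendsto ((tendsto_cdf_right ζ k).sub_const 1) ?_
  filter_upwards [hk, self_mem_nhdsWithin] with g hg (hkg : k < g)
  have h1 := hs g hg
  have hpg : p < g := hkp.trans_lt hkg
  have h2 := le_Cfun_sub h hpg.le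
  by_contra! hlt
  nlinarith [mul_pos (sub_pos.2 hpg) (sub_pos.2 hlt)]

end StopLoss

section Quantile

variable {η : Measure ℝ} [IsProbabilityMeasure η]

lemma Finv_le_iff {u : ℝ} (hu : u ∈ Ioo (0 : ℝ) 1) (z : ℝ) : Finv η u ≤ z ↔ u ≤ cdf η z := by
  have hset : {x : ℝ | u ≤ (η (Iic x)).toReal} = {x | u ≤ cdf η x} := by
    ext x
    simp only [mem_ofPred_eq, cdf_eq_real, measureReal_def]
  rw [Finv, hset]
  have hbdd : BddBelow {x | u ≤ cdf η x} := by
    obtain ⟨m, hm⟩ := ((tendsto_cdf_atBot η).eventually (gt_mem_nhds hu.1)).exists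
    refine ⟨m, fun x (hx : u ≤ cdf η x) => ?_⟩
    by_contra! hlt
    have := monotone_cdf η hlt.le
    linarith
  have hne : {x | u ≤ cdf η x}.Nonempty := by
    obtain ⟨m, hm⟩ := ((tendsto_cdf_atTop η).eventually (lt_mem_nhds hu.2)).exists
    exact ⟨m, hm.le⟩
  refine ⟨fun hz => ?_, fun hz => csInf_le hbdd hz⟩
  refine ge_of_tendsto (tendsto_cdf_right η z) ?_
  filter_upwards [self_mem_nhdsWithin] with t (ht : z < t)
  obtain ⟨x, hx, hxt⟩ := (csInf_lt_iff hbdd hne).1 (hz.trans_lt ht)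
  exact le_trans hx (monotone_cdf η hxt.le)

lemma Finv_monotoneOn : MonotoneOn (Finv η) (Ioo 0 1) := fun _ hu _ hv huv =>
  (Finv_le_iff hu _).2 (huv.trans ((Finv_le_iff hv _).1 le_rfl))

/-- The line of slope `u - 1` through the graph of `C_η` at the `u`-quantile is a tangent. -/
lemma tangent_le_Cfun (h : Integrable id η) {u : ℝ} (hu : u ∈ Ioo (0 : ℝ) 1) (z : ℝ) :
    Cfun η (Finv η u) + (z - Finv η u) * (u - 1) ≤ Cfun η z := by
  set x := Finv η u with hx
  rcases le_or_gt x z with hz | hz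
  · have h1 := Cfun_sub_le h hz
    have h2 : u ≤ cdf η x := (Finv_le_iff hu x).1 le_rfl
    nlinarith
  · have hlim : Tendsto (fun t => (t - z) * (1 - u)) (𝓝[<] x) (𝓝 ((x - z) * (1 - u))) :=
      (Continuous.tendsto (by fun_prop) x).mono_left nhdsWithin_le_nhds
    have : (x - z) * (1 - u) ≤ Cfun η z - Cfun η x := by
      refine le_of_tendsto hlim ?_
      filter_upwards [Ioo_mem_nhdsLT hz] with t ht
      have h1 := le_Cfun_sub h ht.1.le
      have h2 : cdf η t < u := by
        by_contra! hc
        exact absurd ((Finv_le_iff hu t).2 hc) (not_le.2 ht.2)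
      have h3 := Cfun_anti h ht.2.le
      nlinarith [ht.1]
    linarith

lemma aemeasurable_Finv : AEMeasurable (Finv η) (volume.restrict (Ioo 0 1)) :=
  aemeasurable_restrict_of_monotoneOn measurableSet_Ioo Finv_monotoneOn

lemma map_Finv : (volume.restrict (Ioo (0 : ℝ) 1)).map (Finv η) = η := by
  have : IsFiniteMeasure (volume.restrict (Ioo (0 : ℝ) 1)) := ⟨by simp⟩
  refine Measure.ext_of_Iic _ _ fun z => ?_
  rw [Measure.map_apply_of_aemeasurable aemeasurable_Finv measurableSet_Iic,
    Measure.restrict_apply₀' measurableSet_Ioo.nullMeasurableSet]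
  have h1 : Finv η ⁻¹' Iic z ∩ Ioo 0 1 = Ioo 0 1 ∩ Iic (cdf η z) := by
    ext u
    simp only [mem_inter_iff, mem_preimage, mem_Iic]
    constructor
    · rintro ⟨h, hu⟩
      exact ⟨hu, (Finv_le_iff hu z).1 h⟩
    · rintro ⟨hu, h⟩
      exact ⟨(Finv_le_iff hu z).2 h, hu⟩
  have h2 : (Ioo (0 : ℝ) 1 ∩ Iic (cdf η z) : Set ℝ) =ᵐ[volume] Ioc 0 (cdf η z) := by
    have : Ioc (0 : ℝ) (cdf η z) = Ioc 0 1 ∩ Iic (cdf η z) := by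
      ext u
      have := cdf_le_one η z
      simp only [mem_inter_iff, mem_Ioc, mem_Iic]
      grind
    rw [this]
    exact Ioo_ae_eq_Ioc.inter (ae_eq_refl _)
  rw [h1, measure_congr h2, Real.volume_Ioc, sub_zero, ofReal_cdf]

end Quantile
section Calculus

/-- For a nondecreasing Lipschitz function on `(0,1)` with derivative `d` almost everywhere, the
integral of `d` over a set squeezed between the strict and the weak sublevel sets at height `c`
is the increment of the function up to height `c`. -/
lemma setIntegral_of_sublevel {φ d : ℝ → ℝ} {c₀ c c₁ : ℝ} {A : Set ℝ}
    (hlip : LipschitzOnWith 1 φ (Ioo 0 1))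
    (hd : ∀ᵐ u, u ∈ Ioo (0 : ℝ) 1 → HasDerivAt φ (d u) u)
    (hd0 : ∀ u ∈ Ioo (0 : ℝ) 1, 0 ≤ d u)
    (hdint : IntegrableOn d (Ioo 0 1))
    (h0 : Tendsto φ (𝓝[>] 0) (𝓝 c₀)) (h1 : Tendsto φ (𝓝[<] 1) (𝓝 c₁))
    (hAm : MeasurableSet A) (hAs : A ⊆ Ioo 0 1)
    (hA : ∀ u ∈ A, φ u ≤ c) (hA' : ∀ u ∈ Ioo (0 : ℝ) 1, u ∉ A → c ≤ φ u)
    (hc₀ : c₀ ≤ c) (hc₁ : c ≤ c₁) : ∫ u in A, d u = c - c₀ := by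
  obtain ⟨g, hg, hgφ⟩ := hlip.extend_real
  have hg0 : g 0 = c₀ := by
    refine tendsto_nhds_unique ((hg.continuous.tendsto 0).mono_left nhdsWithin_le_nhds)
      (h0.congr' ?_)
    filter_upwards [Ioo_mem_nhdsGT (zero_lt_one' ℝ)] with u hu using hgφ hu
  have hg1 : g 1 = c₁ := by
    refine tendsto_nhds_unique ((hg.continuous.tendsto 1).mono_left nhdsWithin_le_nhds)
      (h1.congr' ?_)
    filter_upwards [Ioo_mem_nhdsLT (zero_lt_one' ℝ)] with u hu using hgφ hu
  have hderiv : ∀ᵐ u, u ∈ Ioo (0 : ℝ) 1 → deriv g u = d u := by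
    filter_upwards [hd] with u hu hu01
    refine ((hu hu01).congr_of_eventuallyEq ?_).deriv
    filter_upwards [Ioo_mem_nhds hu01.1 hu01.2] with v hv using (hgφ hv).symm
  have hftc : ∀ s t : ℝ, 0 ≤ s → s ≤ t → t ≤ 1 → ∫ u in Ioo s t, d u = g t - g s := by
    intro s t hs hst ht
    rw [← (hg.lipschitzOnWith (s := uIcc s t)).absolutelyContinuousOnInterval.integral_deriv_eq_sub,
      intervalIntegral.integral_of_le hst, integral_Ioc_eq_integral_Ioo]
    refine setIntegral_congr_ae measurableSet_Ioo ?_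
    filter_upwards [hderiv] with u hu hust
    exact (hu ⟨hs.trans_lt hust.1, hust.2.trans_le ht⟩).symm
  have hle : ∀ (B : Set ℝ) (s t : ℝ), B ⊆ Ioc s t → B ⊆ Ioo 0 1 → 0 ≤ s → s ≤ t → t ≤ 1 →
      ∫ u in B, d u ≤ g t - g s := by
    intro B s t hB hB' hs hst ht
    rw [← hftc s t hs hst ht, ← integral_Ioc_eq_integral_Ioo]
    refine setIntegral_mono_set ?_ ?_ hB.eventuallyLE
    · rw [integrableOn_Ioc_iff_integrableOn_Ioo]
      exact hdint.mono_set (Ioo_subset_Ioo hs ht)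
    · rw [Measure.restrict_congr_set Ioo_ae_eq_Ioc.symm]
      filter_upwards [ae_restrict_mem measurableSet_Ioo] with u hu
      exact hd0 u ⟨hs.trans_lt hu.1, hu.2.trans_le ht⟩
  have hupper : ∫ u in A, d u ≤ c - c₀ := by
    have hK : IsCompact (Icc (0 : ℝ) 1 ∩ g ⁻¹' Iic c) :=
      isCompact_Icc.inter_right (isClosed_Iic.preimage hg.continuous)
    obtain ⟨t, ht, htmax⟩ := hK.exists_isGreatest ⟨0, by simp, by simpa [hg0] using hc₀⟩
    have := hle A 0 t (fun u hu => ⟨(hAs hu).1, htmax ⟨Ioo_subset_Icc_self (hAs hu), by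
      simpa [← hgφ (hAs hu)] using hA u hu⟩⟩) hAs le_rfl ht.1.1 ht.1.2
    have h2 : g t ≤ c := ht.2
    linarith
  have hlower : ∫ u in Ioo 0 1 \ A, d u ≤ c₁ - c := by
    have hK : IsCompact (Icc (0 : ℝ) 1 ∩ g ⁻¹' Ici c) :=
      isCompact_Icc.inter_right (isClosed_Ici.preimage hg.continuous)
    obtain ⟨t, ht, htmin⟩ := hK.exists_isLeast ⟨1, by simp, by simpa [hg1] using hc₁⟩
    have hsub : ∀ u ∈ Ioo (0 : ℝ) 1 \ A, t ≤ u := fun u hu =>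
      htmin ⟨Ioo_subset_Icc_self hu.1, by simpa [← hgφ hu.1] using hA' u hu.1 hu.2⟩
    have h2 : c ≤ g t := ht.2
    have h3 : ∫ u in Ioo 0 1 \ A, d u ≤ ∫ u in Ioo t 1, d u := by
      rw [← integral_Ico_eq_integral_Ioo]
      refine setIntegral_mono_set ?_ ?_
        (LE.le.eventuallyLE fun u hu => ⟨hsub u hu, hu.1.2⟩)
      · rw [integrableOn_Ico_iff_integrableOn_Ioo]
        exact hdint.mono_set (Ioo_subset_Ioo ht.1.1 le_rfl)
      · rw [Measure.restrict_congr_set Ioo_ae_eq_Ico.symm]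
        filter_upwards [ae_restrict_mem measurableSet_Ioo] with u hu
        exact hd0 u ⟨ht.1.1.trans_lt hu.1, hu.2⟩
    have := hftc t 1 ht.1.1 ht.1.2 le_rfl
    linarith
  have htot := hftc 0 1 le_rfl zero_le_one le_rfl
  have hadd := integral_inter_add_sdiff (f := d) hAm hdint
  rw [inter_eq_right.2 hAs] at hadd
  linarith

end Calculus
section OptimalPair

/-- The dispersion assumption on `(μ, ν)`, together with maximizers `G`, `H` of the slopes of
the segments joining `(g, C_ν(g))` to `(h, ℱ_u(h))`, the maximal slope being `φ u`. -/
structure IsOptimalPair (a b : ℝ) (μ ν : Measure ℝ) (φ G H : ℝ → ℝ) : Prop where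
  lt : a < b
  integrable_left : Integrable id μ
  integrable_right : Integrable id ν
  Cfun_le : ∀ x, Cfun μ x ≤ Cfun ν x
  compl_Icc : μ (Icc a b)ᶜ = 0
  measure_Ioo : ν (Ioo a b) = 0
  G_le : ∀ u ∈ Ioo (0 : ℝ) 1, G u ≤ a
  le_H : ∀ u ∈ Ioo (0 : ℝ) 1, b ≤ H u
  slope_le : ∀ u ∈ Ioo (0 : ℝ) 1, ∀ g ≤ a, ∀ h, b ≤ h →
    FfunU μ ν b (cdf ν b - 1) u h - Cfun ν g ≤ φ u * (h - g)
  slope_eq : ∀ u ∈ Ioo (0 : ℝ) 1,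
    FfunU μ ν b (cdf ν b - 1) u (H u) - Cfun ν (G u) = φ u * (H u - G u)

lemma nonneg_of_forall_ge_le_mul {s K t₀ : ℝ} (h : ∀ t ≥ t₀, K ≤ s * t) : 0 ≤ s := by
  by_contra! hs
  have h1 : Tendsto (fun t => s * t) atTop atBot := tendsto_id.const_mul_atTop_of_neg hs
  obtain ⟨t, ht, ht'⟩ := ((h1.eventually (eventually_lt_atBot K)).and
    (eventually_ge_atTop t₀)).exists
  linarith [h t ht']

lemma FfunU_sub_Cfun_le {b : ℝ} {μ ν : Measure ℝ} [IsProbabilityMeasure μ]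
    [IsProbabilityMeasure ν] (hμ : Integrable id μ) (hν : Integrable id ν)
    (hC : ∀ x, Cfun μ x ≤ Cfun ν x) {u g h : ℝ} (hu : u ∈ Ioo (0 : ℝ) 1)
    (hh : b ≤ h) :
    FfunU μ ν b (cdf ν b - 1) u h - Cfun ν g ≤ (u - 1) * (h - g) := by
  have h1 := tangent_le_Cfun hμ hu g
  have h2 := Cfun_sub_le hν hh
  have h3 := hC g
  simp only [FfunU]
  nlinarith

variable {a b : ℝ} {μ ν : Measure ℝ} {φ G H : ℝ → ℝ} {u v : ℝ}

lemma Cfun_eq_zero (h : μ (Icc a b)ᶜ = 0) : Cfun μ b = 0 := by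
  refine integral_eq_zero_of_ae ?_
  have : ∀ᵐ y ∂μ, y ∈ Icc a b := h
  filter_upwards [this] with y hy
  simpa using hy.2

namespace IsOptimalPair

lemma width_pos (P : IsOptimalPair a b μ ν φ G H) (hu : u ∈ Ioo (0 : ℝ) 1) : 0 < H u - G u := by
  linarith [P.lt, P.G_le u hu, P.le_H u hu]

lemma subgradient_G (P : IsOptimalPair a b μ ν φ G H) (hu : u ∈ Ioo (0 : ℝ) 1) :
    ∀ g ∈ Iic a, Cfun ν (G u) + φ u * (g - G u) ≤ Cfun ν g := by
  intro g (hg : g ≤ a)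
  have h1 := P.slope_le u hu g hg (H u) (P.le_H u hu)
  have h2 := P.slope_eq u hu
  linarith

lemma subgradient_H (P : IsOptimalPair a b μ ν φ G H) (hu : u ∈ Ioo (0 : ℝ) 1) :
    ∀ h ∈ Ici b, Cfun ν (H u) + (u - 1 - φ u + (cdf ν b - 1)) * (h - H u) ≤ Cfun ν h := by
  intro h (hh : b ≤ h)
  have h1 := P.slope_le u hu (G u) (P.G_le u hu) h hh
  have h2 := P.slope_eq u hu
  simp only [FfunU] at h1 h2
  linarith

end IsOptimalPair

section RightMarginal

variable [IsProbabilityMeasure ν]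

namespace IsOptimalPair

lemma neg_one_le_slope (P : IsOptimalPair a b μ ν φ G H) (hu : u ∈ Ioo (0 : ℝ) 1) :
    -1 ≤ φ u := by
  suffices 0 ≤ φ u + 1 by linarith
  refine nonneg_of_forall_ge_le_mul
    (K := FfunU μ ν b (cdf ν b - 1) u b - Cfun ν a + (b - a)) (t₀ := b - a) fun t ht => ?_
  have h1 := P.slope_le u hu (b - t) (by linarith) b le_rfl
  have h2 := Cfun_sub_le P.integrable_right (s := b - t) (t := a) (by linarith)
  have h3 := cdf_nonneg ν (b - t)
  nlinarith

lemma sub_one_add_le_slope (P : IsOptimalPair a b μ ν φ G H) (hu : u ∈ Ioo (0 : ℝ) 1) :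
    u - 1 + (cdf ν b - 1) ≤ φ u := by
  suffices 0 ≤ φ u - (u - 1 + (cdf ν b - 1)) by linarith
  refine nonneg_of_forall_ge_le_mul
    (K := Cfun μ (Finv μ u) - Finv μ u * (u - 1) - b * (cdf ν b - 1) - Cfun ν a + φ u * a)
    (t₀ := b) fun t ht => ?_
  have h1 := P.slope_le u hu a le_rfl t ht
  have h2 := Cfun_anti P.integrable_right ht
  simp only [FfunU] at h1
  nlinarith

end IsOptimalPair

end RightMarginal

variable [IsProbabilityMeasure μ]

lemma Finv_mem_Icc (h : μ (Icc a b)ᶜ = 0) (hu : u ∈ Ioo (0 : ℝ) 1) : Finv μ u ∈ Icc a b := by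
  constructor
  · by_contra! hlt
    have h1 := (Finv_le_iff (η := μ) hu (Finv μ u)).1 le_rfl
    have h2 : μ (Iic (Finv μ u)) = 0 := by
      refine measure_mono_null (fun y (hy : y ≤ _) => ?_) h
      simp only [mem_compl_iff, mem_Icc]
      grind
    rw [cdf_eq_real, measureReal_def, h2] at h1
    simp only [ENNReal.toReal_zero] at h1
    linarith [hu.1]
  · rw [Finv_le_iff hu]
    have h2 : μ (Ioi b) = 0 := by
      refine measure_mono_null (fun y (hy : b < y) => ?_) h
      simp only [mem_compl_iff, mem_Icc]
      grind
    have h3 := measureReal_Ioi_eq (ζ := μ) b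
    rw [measureReal_def, h2, ENNReal.toReal_zero] at h3
    linarith [hu.2]

namespace IsOptimalPair

lemma envelope (P : IsOptimalPair a b μ ν φ G H) (hu : u ∈ Ioo (0 : ℝ) 1)
    (hv : v ∈ Ioo (0 : ℝ) 1) :
    (H u - Finv μ v) * (v - u) ≤ (φ v - φ u) * (H u - G u) := by
  have h1 := P.slope_le v hv (G u) (P.G_le u hu) (H u) (P.le_H u hu)
  have h2 := P.slope_eq u hu
  have h3 := tangent_le_Cfun P.integrable_left hu (Finv μ v)
  simp only [FfunU] at h1 h2
  linarith

lemma slope_monotoneOn (P : IsOptimalPair a b μ ν φ G H) : MonotoneOn φ (Ioo 0 1) := by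
  intro u hu v hv huv
  have h1 := P.envelope hu hv
  have h2 := (Finv_mem_Icc P.compl_Icc hv).2
  have h3 : 0 ≤ (H u - Finv μ v) * (v - u) :=
    mul_nonneg (by linarith [P.le_H u hu]) (by linarith)
  have := nonneg_of_mul_nonneg_left (h3.trans h1) (P.width_pos hu)
  linarith

lemma slope_sub_le (P : IsOptimalPair a b μ ν φ G H) (hu : u ∈ Ioo (0 : ℝ) 1)
    (hv : v ∈ Ioo (0 : ℝ) 1) (huv : u ≤ v) : φ v - φ u ≤ v - u := by
  have h1 := P.envelope hv hu
  have h2 := (Finv_mem_Icc P.compl_Icc hu).1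
  have h3 : (H v - Finv μ u) * (v - u) ≤ (H v - G v) * (v - u) :=
    mul_le_mul_of_nonneg_right (by linarith [P.G_le v hv]) (by linarith)
  exact le_of_mul_le_mul_right (by linarith) (P.width_pos hv)

lemma slope_lipschitzOnWith (P : IsOptimalPair a b μ ν φ G H) :
    LipschitzOnWith 1 φ (Ioo 0 1) := by
  refine LipschitzOnWith.of_le_add_mul 1 fun u hu v hv => ?_
  rw [NNReal.coe_one, one_mul, Real.dist_eq]
  rcases le_total u v with h | h
  · linarith [P.slope_monotoneOn hu hv h, abs_nonneg (u - v)]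
  · linarith [P.slope_sub_le hv hu h, le_abs_self (u - v)]

lemma weight_mem_Icc (P : IsOptimalPair a b μ ν φ G H) (hu : u ∈ Ioo (0 : ℝ) 1) :
    (H u - Finv μ u) / (H u - G u) ∈ Icc (0 : ℝ) 1 := by
  have h1 := Finv_mem_Icc P.compl_Icc hu
  have h2 := P.G_le u hu
  have h3 := P.le_H u hu
  constructor
  · exact div_nonneg (by linarith [h1.2]) (P.width_pos hu).le
  · rw [div_le_one (P.width_pos hu)]
    linarith [h1.1]

lemma integrableOn_weight (P : IsOptimalPair a b μ ν φ G H) (hG : Measurable G)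
    (hH : Measurable H) :
    IntegrableOn (fun u => (H u - Finv μ u) / (H u - G u)) (Ioo 0 1) := by
  have : IsFiniteMeasure (volume.restrict (Ioo (0 : ℝ) 1)) := ⟨by simp⟩
  refine Integrable.of_bound (C := 1) ?_ ?_
  · exact ((hH.aemeasurable.sub aemeasurable_Finv).div
      (hH.sub hG).aemeasurable).aestronglyMeasurable
  · filter_upwards [ae_restrict_mem measurableSet_Ioo] with u hu
    have := P.weight_mem_Icc hu
    rw [Real.norm_of_nonneg this.1]
    exact this.2

end IsOptimalPair

variable [IsProbabilityMeasure ν]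

namespace IsOptimalPair

lemma slope_le_sub_one (P : IsOptimalPair a b μ ν φ G H) (hu : u ∈ Ioo (0 : ℝ) 1) :
    φ u ≤ u - 1 := by
  have h1 := FfunU_sub_Cfun_le (g := G u) P.integrable_left P.integrable_right P.Cfun_le hu
    (P.le_H u hu)
  rw [P.slope_eq u hu] at h1
  exact le_of_mul_le_mul_right h1 (P.width_pos hu)

lemma slope_le_cdf_sub_one (P : IsOptimalPair a b μ ν φ G H) (hu : u ∈ Ioo (0 : ℝ) 1) :
    φ u ≤ cdf ν b - 1 := by
  have h1 := P.slope_eq u hu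
  have h2 := tangent_le_Cfun P.integrable_left hu (H u)
  have h3 := P.Cfun_le (H u)
  have h4 := le_Cfun_sub P.integrable_right (s := G u) (t := b) (by linarith [P.G_le u hu, P.lt])
  refine le_of_mul_le_mul_right ?_ (P.width_pos hu)
  rw [← h1]
  simp only [FfunU]
  linarith

/-- Attainment of the supremum for `u` close to `1` forbids an atom of `ν` at `b`. -/
lemma measure_singleton_eq_zero (P : IsOptimalPair a b μ ν φ G H) : ν {b} = 0 := by
  have key : ∀ u ∈ Ioo (0 : ℝ) 1, ν.real (Ici b) ≤ 1 - cdf ν b + (1 - u) := by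
    intro u hu
    have hG := P.G_le u hu
    have hab := P.lt
    have h1 := P.slope_eq u hu
    have h2 := tangent_le_Cfun P.integrable_left hu b
    rw [Cfun_eq_zero P.compl_Icc] at h2
    have h3 := Cfun_nonneg (ζ := ν) (H u)
    have h4 := le_Cfun_sub' P.integrable_right (s := G u) (t := b) (by linarith)
    have h5 := mul_le_mul_of_nonneg_right (P.sub_one_add_le_slope hu) (P.width_pos hu).le
    rw [← h1] at h5
    simp only [FfunU] at h5
    have h6 : (ν.real (Ici b)) * (b - G u) ≤ (1 - cdf ν b + (1 - u)) * (b - G u) := by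
      linarith
    exact le_of_mul_le_mul_right h6 (by linarith)
  have h1 : ν.real (Ici b) ≤ 1 - cdf ν b := by
    have hlim : Tendsto (fun u : ℝ => 1 - cdf ν b + (1 - u)) (𝓝[<] 1) (𝓝 (1 - cdf ν b)) := by
      have : Tendsto (fun u : ℝ => 1 - cdf ν b + (1 - u)) (𝓝 1) (𝓝 (1 - cdf ν b + (1 - 1))) :=
        Continuous.tendsto (by fun_prop) 1
      simpa using this.mono_left nhdsWithin_le_nhds
    refine ge_of_tendsto hlim ?_
    filter_upwards [Ioo_mem_nhdsLT (zero_lt_one' ℝ)] with u hu using key u hu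
  have h2 : ν.real (Ici b) = ν.real {b} + ν.real (Ioi b) := by
    rw [← measureReal_union (by simp) measurableSet_Ioi]
    congr 1
    ext y
    simp [le_iff_eq_or_lt]
  rw [measureReal_Ioi_eq] at h2
  have h3 : ν.real {b} = 0 := le_antisymm (by linarith) measureReal_nonneg
  simpa [measureReal_def, ENNReal.toReal_eq_zero_iff] using h3

lemma cdf_eq (P : IsOptimalPair a b μ ν φ G H) {k : ℝ} (ha : a ≤ k) (hb : k ≤ b) :
    cdf ν k = cdf ν b := by
  refine le_antisymm (monotone_cdf ν hb) ?_
  rw [cdf_eq_real, cdf_eq_real, measureReal_def, measureReal_def]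
  refine ENNReal.toReal_mono (measure_ne_top _ _) ?_
  have hsub : Iic b ⊆ Iic k ∪ (Ioo a b ∪ {b}) := by
    intro y (hy : y ≤ b)
    simp only [mem_union, mem_Iic, mem_Ioo, mem_singleton_iff]
    grind
  calc ν (Iic b) ≤ ν (Iic k) + (ν (Ioo a b) + ν {b}) :=
        (measure_mono hsub).trans ((measure_union_le _ _).trans
          (add_le_add_right (measure_union_le _ _) _))
    _ = ν (Iic k) := by rw [P.measure_Ioo, P.measure_singleton_eq_zero, add_zero, add_zero]

lemma hasDerivAt_slope (P : IsOptimalPair a b μ ν φ G H) :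
    ∀ᵐ u, u ∈ Ioo (0 : ℝ) 1 → HasDerivAt φ ((H u - Finv μ u) / (H u - G u)) u := by
  have hcont : ∀ᵐ u, u ∉ {u ∈ Ioo (0 : ℝ) 1 | ¬ContinuousWithinAt (Finv μ) (Ioo 0 1) u} :=
    (Finv_monotoneOn (η := μ)).countable_not_continuousWithinAt.ae_notMem volume
  filter_upwards [P.slope_lipschitzOnWith.ae_differentiableWithinAt_of_mem, hcont]
    with u hdiff hc hu
  have hc' : ContinuousAt (Finv μ) u := by
    have : ContinuousWithinAt (Finv μ) (Ioo 0 1) u := by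
      by_contra hn
      exact hc ⟨hu, hn⟩
    exact this.continuousAt (Ioo_mem_nhds hu.1 hu.2)
  have hφ := ((hdiff hu).differentiableAt (Ioo_mem_nhds hu.1 hu.2)).hasDerivAt
  have hprod : HasDerivAt (fun v => (Finv μ v - Finv μ u) * (v - u)) 0 u := by
    rw [hasDerivAt_iff_tendsto_slope]
    have h1 : Tendsto (fun v => Finv μ v - Finv μ u) (𝓝[≠] u) (𝓝 0) := by
      simpa using (hc'.tendsto.sub_const (Finv μ u)).mono_left nhdsWithin_le_nhds
    refine h1.congr' ?_
    filter_upwards [self_mem_nhdsWithin] with v (hv : v ≠ u)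
    rw [slope_def_field]
    field_simp [sub_ne_zero.2 hv]
    ring
  have hf := (((hφ.sub_const (φ u)).mul_const (H u - G u)).sub
    (((hasDerivAt_id u).sub_const u).const_mul (H u - Finv μ u))).add hprod
  have hmin : IsLocalMin (((fun v => (φ v - φ u) * (H u - G u)) -
      fun v => (H u - Finv μ u) * (id v - u)) + fun v => (Finv μ v - Finv μ u) * (v - u)) u := by
    filter_upwards [Ioo_mem_nhds hu.1 hu.2] with v hv
    have := P.envelope hu hv
    simp only [Pi.add_apply, Pi.sub_apply, id]
    linarith
  have h0 := hmin.hasDerivAt_eq_zero hf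
  have : deriv φ u = (H u - Finv μ u) / (H u - G u) := by
    rw [eq_div_iff (P.width_pos hu).ne']
    linarith
  exact this ▸ hφ

lemma tendsto_slope_zero (P : IsOptimalPair a b μ ν φ G H) :
    Tendsto φ (𝓝[>] 0) (𝓝 (-1)) := by
  have hlim : Tendsto (fun u : ℝ => u - 1) (𝓝[>] 0) (𝓝 (-1)) := by
    have : Tendsto (fun u : ℝ => u - 1) (𝓝 0) (𝓝 (0 - 1)) := Continuous.tendsto (by fun_prop) 0
    simpa using this.mono_left nhdsWithin_le_nhds
  refine tendsto_of_tendsto_of_tendsto_of_le_of_le' tendsto_const_nhds hlim ?_ ?_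
  · filter_upwards [Ioo_mem_nhdsGT (zero_lt_one' ℝ)] with u hu using P.neg_one_le_slope hu
  · filter_upwards [Ioo_mem_nhdsGT (zero_lt_one' ℝ)] with u hu using P.slope_le_sub_one hu

lemma tendsto_slope_one (P : IsOptimalPair a b μ ν φ G H) :
    Tendsto φ (𝓝[<] 1) (𝓝 (cdf ν b - 1)) := by
  have hlim : Tendsto (fun u : ℝ => u - 1 + (cdf ν b - 1)) (𝓝[<] 1) (𝓝 (cdf ν b - 1)) := by
    have : Tendsto (fun u : ℝ => u - 1 + (cdf ν b - 1)) (𝓝 1) (𝓝 (1 - 1 + (cdf ν b - 1))) :=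
      Continuous.tendsto (by fun_prop) 1
    simpa using this.mono_left nhdsWithin_le_nhds
  refine tendsto_of_tendsto_of_tendsto_of_le_of_le' hlim tendsto_const_nhds ?_ ?_
  · filter_upwards [Ioo_mem_nhdsLT (zero_lt_one' ℝ)] with u hu using P.sub_one_add_le_slope hu
  · filter_upwards [Ioo_mem_nhdsLT (zero_lt_one' ℝ)] with u hu using P.slope_le_cdf_sub_one hu

lemma setIntegral_weight_G (P : IsOptimalPair a b μ ν φ G H) (hG : Measurable G)
    (hH : Measurable H) {k : ℝ} (hk : k < b) :
    ∫ u in Ioo (0 : ℝ) 1 ∩ G ⁻¹' Iic k, (H u - Finv μ u) / (H u - G u) = cdf ν k := by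
  have hcb : cdf ν k ≤ cdf ν b := monotone_cdf ν hk.le
  rw [setIntegral_of_sublevel (c := cdf ν k - 1) P.slope_lipschitzOnWith P.hasDerivAt_slope
    (fun u hu => (P.weight_mem_Icc hu).1) (P.integrableOn_weight hG hH) P.tendsto_slope_zero
    P.tendsto_slope_one (measurableSet_Ioo.inter (hG measurableSet_Iic)) inter_subset_left]
  · ring
  · rintro u ⟨hu, hGk : G u ≤ k⟩
    rcases lt_or_ge k a with hka | hka
    · refine subgradient_le_cdf_sub_one P.integrable_right (P.subgradient_G hu) hGk ?_
      exact mem_of_superset (Ioo_mem_nhdsGT hka) fun g hg => hg.2.le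
    · rw [P.cdf_eq hka hk.le]
      exact P.slope_le_cdf_sub_one hu
  · intro u hu hGk
    have hGk' : k < G u := by
      by_contra! hc
      exact hGk ⟨hu, hc⟩
    exact cdf_sub_one_le_of_subgradient P.integrable_right (P.subgradient_G hu)
      (mem_Iic.2 (hGk'.le.trans (P.G_le u hu))) hGk'
  · linarith [cdf_nonneg ν k]
  · linarith

lemma setIntegral_weight_H (P : IsOptimalPair a b μ ν φ G H) (hG : Measurable G)
    (hH : Measurable H) {k : ℝ} (hk : b ≤ k) :
    ∫ u in Ioo (0 : ℝ) 1 ∩ H ⁻¹' Iic k, (1 - (H u - Finv μ u) / (H u - G u)) =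
      cdf ν k - cdf ν b := by
  have : IsFiniteMeasure (volume.restrict (Ioo (0 : ℝ) 1)) := ⟨by simp⟩
  have hcb : cdf ν b ≤ cdf ν k := monotone_cdf ν hk
  have hlip : LipschitzOnWith 1 (fun u => u - 1 - φ u) (Ioo 0 1) := by
    refine LipschitzOnWith.of_le_add_mul 1 fun u hu v hv => ?_
    rw [NNReal.coe_one, one_mul, Real.dist_eq]
    rcases le_total u v with h | h
    · linarith [P.slope_sub_le hu hv h, abs_nonneg (u - v)]
    · linarith [P.slope_monotoneOn hv hu h, le_abs_self (u - v)]
  have h0 : Tendsto (fun u => u - 1 - φ u) (𝓝[>] 0) (𝓝 0) := by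
    have h1 : Tendsto (fun u : ℝ => u - 1) (𝓝 0) (𝓝 (0 - 1)) := Continuous.tendsto (by fun_prop) 0
    simpa using (h1.mono_left nhdsWithin_le_nhds).sub P.tendsto_slope_zero
  have h1 : Tendsto (fun u => u - 1 - φ u) (𝓝[<] 1) (𝓝 (1 - cdf ν b)) := by
    have h1 : Tendsto (fun u : ℝ => u - 1) (𝓝 1) (𝓝 (1 - 1)) := Continuous.tendsto (by fun_prop) 1
    simpa using (h1.mono_left nhdsWithin_le_nhds).sub P.tendsto_slope_one
  rw [setIntegral_of_sublevel (c := cdf ν k - cdf ν b) hlip ?_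
    (fun u hu => sub_nonneg.2 (P.weight_mem_Icc hu).2)
    ((integrable_const 1).sub (P.integrableOn_weight hG hH)) h0 h1
    (measurableSet_Ioo.inter (hH measurableSet_Iic)) inter_subset_left]
  · ring
  · rintro u ⟨hu, hHk : H u ≤ k⟩
    have := subgradient_le_cdf_sub_one P.integrable_right (P.subgradient_H hu) hHk
      (mem_of_superset self_mem_nhdsWithin fun g (hg : k < g) => hk.trans hg.le)
    linarith
  · intro u hu hHk
    have hHk' : k < H u := by
      by_contra! hc
      exact hHk ⟨hu, hc⟩
    have := cdf_sub_one_le_of_subgradient P.integrable_right (P.subgradient_H hu)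
      (mem_Ici.2 hk) hHk'
    linarith
  · linarith
  · linarith [cdf_le_one ν k]
  · filter_upwards [P.hasDerivAt_slope] with u hu hu01
    exact ((hasDerivAt_id u).sub_const 1).sub (hu hu01)

lemma setIntegral_weight_Iic (P : IsOptimalPair a b μ ν φ G H) (hG : Measurable G)
    (hH : Measurable H) (hv : v ∈ Ioo (0 : ℝ) 1) :
    ∫ u in Ioo (0 : ℝ) 1 ∩ Iic v, (H u - Finv μ u) / (H u - G u) = φ v + 1 := by
  rw [setIntegral_of_sublevel (c := φ v) P.slope_lipschitzOnWith P.hasDerivAt_slope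
    (fun u hu => (P.weight_mem_Icc hu).1) (P.integrableOn_weight hG hH) P.tendsto_slope_zero
    P.tendsto_slope_one (measurableSet_Ioo.inter measurableSet_Iic) inter_subset_left]
  · ring
  · exact fun u hu => P.slope_monotoneOn hu.1 hv hu.2
  · intro u hu hn
    refine P.slope_monotoneOn hv hu ?_
    by_contra! hc
    exact hn ⟨hu, hc.le⟩
  · exact P.neg_one_le_slope hv
  · exact P.slope_le_cdf_sub_one hv

end IsOptimalPair

end OptimalPair
section Duality

variable {a b : ℝ} {μ ν : Measure ℝ} {φ G H : ℝ → ℝ} {ρ ρ' : Measure (ℝ × ℝ)}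

namespace IsMartingaleCoupling

lemma integral_fst (hρ : IsMartingaleCoupling μ ν ρ) {f : ℝ → ℝ} (hf : Measurable f) :
    ∫ x, f x ∂μ = ∫ w, f w.1 ∂ρ := by
  rw [← hρ.2.1, integral_map measurable_fst.aemeasurable hf.aestronglyMeasurable]

lemma integral_snd (hρ : IsMartingaleCoupling μ ν ρ) {f : ℝ → ℝ} (hf : Measurable f) :
    ∫ x, f x ∂ν = ∫ w, f w.2 ∂ρ := by
  rw [← hρ.2.2.1, integral_map measurable_snd.aemeasurable hf.aestronglyMeasurable]

lemma integrable_fst_s11 (hρ : IsMartingaleCoupling μ ν ρ) (h : Integrable id μ) :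
    Integrable (fun w : ℝ × ℝ => w.1) ρ := by
  rw [← hρ.2.1] at h
  exact h.comp_measurable measurable_fst

lemma integrable_snd_s11 (hρ : IsMartingaleCoupling μ ν ρ) (h : Integrable id ν) :
    Integrable (fun w : ℝ × ℝ => w.2) ρ := by
  rw [← hρ.2.2.1] at h
  exact h.comp_measurable measurable_snd

lemma ae_fst (hρ : IsMartingaleCoupling μ ν ρ) {p : ℝ → Prop} (h : ∀ᵐ x ∂μ, p x) :
    ∀ᵐ w ∂ρ, p w.1 := by
  rw [← hρ.2.1] at h
  exact ae_of_ae_map measurable_fst.aemeasurable h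

lemma ae_snd (hρ : IsMartingaleCoupling μ ν ρ) {p : ℝ → Prop} (h : ∀ᵐ x ∂ν, p x) :
    ∀ᵐ w ∂ρ, p w.2 := by
  rw [← hρ.2.2.1] at h
  exact ae_of_ae_map measurable_snd.aemeasurable h

lemma real_fst (hρ : IsMartingaleCoupling μ ν ρ) {s : Set ℝ} (hs : MeasurableSet s) :
    μ.real s = ρ.real (Prod.fst ⁻¹' s) := by
  rw [measureReal_def, measureReal_def, ← hρ.2.1, Measure.map_apply measurable_fst hs]

lemma real_snd (hρ : IsMartingaleCoupling μ ν ρ) {s : Set ℝ} (hs : MeasurableSet s) :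
    ν.real s = ρ.real (Prod.snd ⁻¹' s) := by
  rw [measureReal_def, measureReal_def, ← hρ.2.2.1, Measure.map_apply measurable_snd hs]

end IsMartingaleCoupling

variable [IsProbabilityMeasure μ] [IsProbabilityMeasure ν]

lemma IsOptimalPair.ae_le_or_lt (P : IsOptimalPair a b μ ν φ G H) :
    ∀ᵐ y ∂ν, y ≤ a ∨ b < y := by
  have h1 : ∀ᵐ y ∂ν, y ∉ Ioo a b := measure_eq_zero_iff_ae_notMem.1 P.measure_Ioo
  have h2 : ∀ᵐ y ∂ν, y ∉ ({b} : Set ℝ) :=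
    measure_eq_zero_iff_ae_notMem.1 P.measure_singleton_eq_zero
  filter_upwards [h1, h2] with y hy hy'
  simp only [mem_Ioo, mem_singleton_iff] at hy hy'
  grind

/-- Any martingale coupling transports at least the mass `φ(u) + 1` from the lower `u`-quantile
part of `μ` to the left of `a`. -/
lemma IsOptimalPair.slope_add_one_le (P : IsOptimalPair a b μ ν φ G H)
    (hρ : IsMartingaleCoupling μ ν ρ) {z : ℝ} (hz : cdf μ z ∈ Ioo (0 : ℝ) 1) :
    φ (cdf μ z) + 1 ≤ ρ.real {w | w.1 ≤ z ∧ w.2 ≤ a} := by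
  have := hρ.1
  set u := cdf μ z with hu
  set g := G u
  set h := H u
  have hab := P.lt
  have hg : g ≤ a := P.G_le u hz
  have hh : b ≤ h := P.le_H u hz
  have hLm : MeasurableSet {w : ℝ × ℝ | w.1 ≤ z ∧ w.2 ≤ a} :=
    (measurableSet_le measurable_fst measurable_const).inter
      (measurableSet_le measurable_snd measurable_const)
  have hX : MeasurableSet (Prod.fst ⁻¹' Ioi z : Set (ℝ × ℝ)) := measurable_fst measurableSet_Ioi
  have hY : MeasurableSet (Prod.snd ⁻¹' Ioi b : Set (ℝ × ℝ)) := measurable_snd measurableSet_Ioi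
  have ix := hρ.integrable_fst_s11 P.integrable_left
  have iy := hρ.integrable_snd_s11 P.integrable_right
  have ipx : ∀ s, Integrable (fun w : ℝ × ℝ => max (w.1 - s) 0) ρ := fun s =>
    (Integrable.sub ix (integrable_const s)).pos_part
  have ipy : ∀ s, Integrable (fun w : ℝ × ℝ => max (w.2 - s) 0) ρ := fun s =>
    (Integrable.sub iy (integrable_const s)).pos_part
  have cμ : Cfun μ z = ∫ w, max (w.1 - z) 0 ∂ρ := hρ.integral_fst (by fun_prop)
  have cν : ∀ s, Cfun ν s = ∫ w, max (w.2 - s) 0 ∂ρ := fun s => hρ.integral_snd (by fun_prop)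
  have iA : Integrable ((Prod.fst ⁻¹' Ioi z).indicator fun _ : ℝ × ℝ => h - z) ρ :=
    (integrable_const _).indicator hX
  have iB : Integrable ((Prod.snd ⁻¹' Ioi b).indicator fun _ : ℝ × ℝ => h - b) ρ :=
    (integrable_const _).indicator hY
  have eA : ∫ w, (Prod.fst ⁻¹' Ioi z).indicator (fun _ : ℝ × ℝ => h - z) w ∂ρ =
      (1 - u) * (h - z) := by
    rw [integral_indicator_const _ hX, ← hρ.real_fst measurableSet_Ioi, measureReal_Ioi_eq,
      smul_eq_mul]
  have eB : ∫ w, (Prod.snd ⁻¹' Ioi b).indicator (fun _ : ℝ × ℝ => h - b) w ∂ρ =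
      (1 - cdf ν b) * (h - b) := by
    rw [integral_indicator_const _ hY, ← hρ.real_snd measurableSet_Ioi, measureReal_Ioi_eq,
      smul_eq_mul]
  have eM : ∫ w : ℝ × ℝ, (Ioi z).indicator 1 w.1 * (w.2 - w.1) ∂ρ = 0 := by
    refine hρ.2.2.2 _ (measurable_one.indicator measurableSet_Ioi) ⟨1, fun x => ?_⟩
    by_cases hx : x ∈ Ioi z <;> simp [hx]
  have iM : Integrable (fun w : ℝ × ℝ => (Ioi z).indicator 1 w.1 * (w.2 - w.1)) ρ := by
    refine (Integrable.sub iy ix).bdd_mul (c := 1)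
      ((measurable_one.indicator measurableSet_Ioi).comp measurable_fst).aestronglyMeasurable ?_
    refine ae_of_all _ fun w => ?_
    by_cases hx : w.1 ∈ Ioi z <;> simp [hx]
  have eL : ∫ w, {w : ℝ × ℝ | w.1 ≤ z ∧ w.2 ≤ a}.indicator (fun _ => h - g) w ∂ρ =
      ρ.real {w | w.1 ≤ z ∧ w.2 ≤ a} * (h - g) := by
    rw [integral_indicator_const _ hLm, smul_eq_mul]
  have key := integral_mono_ae
    ((((((ipx z).sub iA).add iM).add (((ipy b).sub iB).sub (ipy h))).sub (ipy g)))
    (((integrable_const (h - g)).indicator hLm).sub (integrable_const (h - g))) (by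
      filter_upwards [hρ.ae_snd P.ae_le_or_lt] with w hw
      have m1 := le_max_left (w.2 - h) 0
      have m2 := le_max_right (w.2 - h) 0
      have m3 := le_max_left (w.2 - g) 0
      have m4 := le_max_right (w.2 - g) 0
      have hab' : a < b := hab
      by_cases hx : z < w.1
      · have m5 : max (w.1 - z) 0 = w.1 - z := max_eq_left (by linarith)
        have hx' : ¬w.1 ≤ z := not_le.2 hx
        rcases hw with hy | hy
        · have m6 : max (w.2 - b) 0 = 0 := max_eq_right (by linarith)
          have hy' : ¬b < w.2 := by linarith
          simp [indicator, hx, hx', hy', m5, m6]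
          linarith
        · have m6 : max (w.2 - b) 0 = w.2 - b := max_eq_left (by linarith)
          simp [indicator, hx, hx', hy, m5, m6]
          linarith
      · have m5 : max (w.1 - z) 0 = 0 := max_eq_right (by linarith)
        have hx' : w.1 ≤ z := not_lt.1 hx
        rcases hw with hy | hy
        · have m6 : max (w.2 - b) 0 = 0 := max_eq_right (by linarith)
          have hy' : ¬b < w.2 := by linarith
          simp [indicator, hx, hx', hy, hy', m6]
        · have m6 : max (w.2 - b) 0 = w.2 - b := max_eq_left (by linarith)
          have hy' : ¬w.2 ≤ a := by linarith
          simp [indicator, hx, hy, hy', m5, m6]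
          linarith)
  rw [integral_sub' ((((ipx z).sub iA).add iM).add (((ipy b).sub iB).sub (ipy h))) (ipy g),
    integral_add' (((ipx z).sub iA).add iM) (((ipy b).sub iB).sub (ipy h)),
    integral_add' ((ipx z).sub iA) iM, integral_sub' (ipx z) iA,
    integral_sub' ((ipy b).sub iB) (ipy h), integral_sub' (ipy b) iB,
    integral_sub' ((integrable_const _).indicator hLm) (integrable_const _),
    eA, eB, eM, eL, ← cμ, ← cν, ← cν, ← cν, integral_const, smul_eq_mul, probReal_univ] at key
  have h1 := P.slope_eq u hz
  have h2 := tangent_le_Cfun P.integrable_left hz z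
  simp only [FfunU] at h1
  have h3 : φ u * (h - g) ≤ (ρ.real {w | w.1 ≤ z ∧ w.2 ≤ a} - 1) * (h - g) := by linarith
  have := le_of_mul_le_mul_right h3 (P.width_pos hz)
  linarith

/-- The expected distance of a martingale coupling in terms of the mass sent to the left of `a`. -/
lemma IsOptimalPair.integral_abs_eq (P : IsOptimalPair a b μ ν φ G H)
    (hρ : IsMartingaleCoupling μ ν ρ) :
    ∫ w : ℝ × ℝ, |w.2 - w.1| ∂ρ = 2 * (∫ y, (Iic a).indicator (fun y => b - y) y ∂ν) -
      2 * ∫ w, (Prod.snd ⁻¹' Iic a).indicator (fun w : ℝ × ℝ => b - w.1) w ∂ρ := by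
  have := hρ.1
  have hm : MeasurableSet (Prod.snd ⁻¹' Iic a : Set (ℝ × ℝ)) := measurable_snd measurableSet_Iic
  have ix := hρ.integrable_fst_s11 P.integrable_left
  have iy := hρ.integrable_snd_s11 P.integrable_right
  have i1 : Integrable ((Prod.snd ⁻¹' Iic a).indicator fun w : ℝ × ℝ => b - w.1) ρ :=
    (Integrable.sub (integrable_const b) ix).indicator hm
  have i2 : Integrable ((Prod.snd ⁻¹' Iic a).indicator fun w : ℝ × ℝ => b - w.2) ρ :=
    (Integrable.sub (integrable_const b) iy).indicator hm
  have e0 : ∫ w : ℝ × ℝ, (w.2 - w.1) ∂ρ = 0 := by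
    simpa using hρ.2.2.2 (fun _ => 1) measurable_const ⟨1, by simp⟩
  have e2 : ∫ y, (Iic a).indicator (fun y => b - y) y ∂ν =
      ∫ w, (Prod.snd ⁻¹' Iic a).indicator (fun w : ℝ × ℝ => b - w.2) w ∂ρ := by
    have hbm : Measurable fun y : ℝ => b - y := by fun_prop
    rw [hρ.integral_snd (hbm.indicator measurableSet_Iic)]
    rfl
  have hIcc : ∀ᵐ x ∂μ, x ∈ Icc a b := P.compl_Icc
  have e3 := integral_add (Integrable.sub iy ix) ((i2.const_mul 2).sub (i1.const_mul 2))
  have e4 := integral_sub (i2.const_mul 2) (i1.const_mul 2)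
  simp only [Pi.sub_apply] at e3
  rw [integral_const_mul, integral_const_mul] at e4
  rw [e0, zero_add] at e3
  rw [e2, ← e4, ← e3]
  refine integral_congr_ae ?_
  filter_upwards [hρ.ae_fst hIcc, hρ.ae_snd P.ae_le_or_lt] with w hx hy
  have hab := P.lt
  simp only [indicator, mem_preimage, mem_Iic]
  rcases hy with hy | hy
  · rw [if_pos hy, if_pos hy, abs_of_nonpos (by linarith [hx.1])]
    ring
  · rw [if_neg (by linarith), if_neg (by linarith), abs_of_nonneg (by linarith [hx.2])]
    ring

lemma IsOptimalPair.integral_abs_le (P : IsOptimalPair a b μ ν φ G H)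
    (hρ : IsMartingaleCoupling μ ν ρ) (hρ' : IsMartingaleCoupling μ ν ρ')
    (hle : ∀ z, ρ'.real {w | w.1 ≤ z ∧ w.2 ≤ a} ≤ ρ.real {w | w.1 ≤ z ∧ w.2 ≤ a}) :
    ∫ w : ℝ × ℝ, |w.2 - w.1| ∂ρ ≤ ∫ w : ℝ × ℝ, |w.2 - w.1| ∂ρ' := by
  have := hρ.1
  have := hρ'.1
  have hm : MeasurableSet (Prod.snd ⁻¹' Iic a : Set (ℝ × ℝ)) := measurable_snd measurableSet_Iic
  have hfm : Measurable ((Prod.snd ⁻¹' Iic a).indicator fun w : ℝ × ℝ => b - w.1) :=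
    (measurable_const.sub measurable_fst).indicator hm
  have hIcc : ∀ᵐ x ∂μ, x ∈ Icc a b := P.compl_Icc
  have hnn : ∀ {ρ}, IsMartingaleCoupling μ ν ρ →
      0 ≤ᵐ[ρ] (Prod.snd ⁻¹' Iic a).indicator fun w : ℝ × ℝ => b - w.1 := by
    intro ρ hρ
    filter_upwards [hρ.ae_fst hIcc] with w hw
    exact indicator_apply_nonneg fun _ => sub_nonneg.2 hw.2
  have hset : ∀ t > 0, {w | t ≤ (Prod.snd ⁻¹' Iic a).indicator (fun w : ℝ × ℝ => b - w.1) w} =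
      {w | w.1 ≤ b - t ∧ w.2 ≤ a} := by
    intro t ht
    ext w
    simp only [indicator, mem_preimage, mem_Iic, mem_ofPred_eq]
    grind
  have key : ∫ w, (Prod.snd ⁻¹' Iic a).indicator (fun w : ℝ × ℝ => b - w.1) w ∂ρ' ≤
      ∫ w, (Prod.snd ⁻¹' Iic a).indicator (fun w : ℝ × ℝ => b - w.1) w ∂ρ := by
    have ix := hρ.integrable_fst_s11 P.integrable_left
    have i1 : Integrable ((Prod.snd ⁻¹' Iic a).indicator fun w : ℝ × ℝ => b - w.1) ρ :=
      (Integrable.sub (integrable_const b) ix).indicator hm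
    rw [integral_eq_lintegral_of_nonneg_ae (hnn hρ) hfm.aestronglyMeasurable,
      integral_eq_lintegral_of_nonneg_ae (hnn hρ') hfm.aestronglyMeasurable]
    refine ENNReal.toReal_mono ?_ ?_
    · exact ((hasFiniteIntegral_iff_ofReal (hnn hρ)).1 i1.2).ne
    · rw [lintegral_eq_lintegral_meas_le _ (hnn hρ) hfm.aemeasurable,
        lintegral_eq_lintegral_meas_le _ (hnn hρ') hfm.aemeasurable]
      refine setLIntegral_mono' measurableSet_Ioi fun t ht => ?_
      rw [hset t ht, ← ENNReal.toReal_le_toReal (measure_ne_top _ _) (measure_ne_top _ _)]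
      exact hle (b - t)
  rw [P.integral_abs_eq hρ, P.integral_abs_eq hρ']
  linarith

end Duality

section Square

/-- The uniform distribution on the open unit interval. -/
abbrev unitUniform : Measure ℝ := volume.restrict (Ioo 0 1)

instance : IsProbabilityMeasure unitUniform := ⟨by simp⟩

lemma unitUniform_Iic {t : ℝ} (ht : t ∈ Icc (0 : ℝ) 1) :
    unitUniform (Iic t) = ENNReal.ofReal t := by
  rw [unitUniform, Measure.restrict_congr_set Ioo_ae_eq_Ioc, Measure.restrict_apply measurableSet_Iic,
    inter_comm, Ioc_inter_Iic, inf_eq_right.2 ht.2, Real.volume_Ioc, sub_zero]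

lemma unitUniform_Ioi {t : ℝ} (ht : t ∈ Icc (0 : ℝ) 1) :
    unitUniform (Ioi t) = ENNReal.ofReal (1 - t) := by
  rw [unitUniform, Measure.restrict_congr_set Ioo_ae_eq_Ioc, Measure.restrict_apply measurableSet_Ioi,
    inter_comm, Ioc_inter_Ioi, sup_eq_right.2 ht.1, Real.volume_Ioc]

variable {A : Set ℝ} {D : ℝ → ℝ}

lemma measureReal_prod_of_section {s : Set (ℝ × ℝ)} {d : ℝ → ℝ} (hs : MeasurableSet s)
    (hA : MeasurableSet A) (hd : Measurable d) (h0 : ∀ u ∈ A, 0 ≤ d u)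
    (hAs : A ⊆ Ioo 0 1)
    (h1 : ∀ u ∈ A, unitUniform (Prod.mk u ⁻¹' s) = ENNReal.ofReal (d u))
    (h2 : ∀ u ∉ A, Prod.mk u ⁻¹' s = ∅) :
    (unitUniform.prod unitUniform).real s = ∫ u in A, d u := by
  have h3 : (fun u => unitUniform (Prod.mk u ⁻¹' s)) = A.indicator fun u => ENNReal.ofReal (d u) := by
    funext u
    by_cases hu : u ∈ A
    · rw [h1 u hu, indicator_of_mem hu]
    · rw [h2 u hu, indicator_of_notMem hu, measure_empty]
  rw [measureReal_def, Measure.prod_apply hs, h3, lintegral_indicator hA,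
    Measure.restrict_restrict_of_subset hAs, integral_eq_lintegral_of_nonneg_ae
      (ae_restrict_of_forall_mem hA h0) hd.aestronglyMeasurable]

lemma measureReal_prod_le (hA : MeasurableSet A) (hAs : A ⊆ Ioo 0 1) (hD : Measurable D)
    (h01 : ∀ u ∈ Ioo (0 : ℝ) 1, D u ∈ Icc (0 : ℝ) 1) :
    (unitUniform.prod unitUniform).real {p | p.1 ∈ A ∧ p.2 ≤ D p.1} = ∫ u in A, D u := by
  refine measureReal_prod_of_section ((measurable_fst hA).inter
    (measurableSet_le measurable_snd (hD.comp measurable_fst))) hA hD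
    (fun u hu => (h01 u (hAs hu)).1) hAs (fun u hu => ?_) fun u hu => ?_
  · rw [← unitUniform_Iic (h01 u (hAs hu))]
    congr 1
    ext v
    simp [hu]
  · ext v
    simp [hu]

lemma measureReal_prod_lt (hA : MeasurableSet A) (hAs : A ⊆ Ioo 0 1) (hD : Measurable D)
    (h01 : ∀ u ∈ Ioo (0 : ℝ) 1, D u ∈ Icc (0 : ℝ) 1) :
    (unitUniform.prod unitUniform).real {p | p.1 ∈ A ∧ D p.1 < p.2} = ∫ u in A, (1 - D u) := by
  refine measureReal_prod_of_section ((measurable_fst hA).inter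
    (measurableSet_lt (hD.comp measurable_fst) measurable_snd)) hA (hD.const_sub 1)
    (fun u hu => sub_nonneg.2 (h01 u (hAs hu)).2) hAs (fun u hu => ?_) fun u hu => ?_
  · rw [← unitUniform_Ioi (h01 u (hAs hu))]
    congr 1
    ext v
    simp [hu]
  · ext v
    simp [hu]

lemma ae_fst_mem_Ioo :
    ∀ᵐ p ∂unitUniform.prod unitUniform, p.1 ∈ Ioo (0 : ℝ) 1 :=
  Measure.quasiMeasurePreserving_fst.ae (ae_restrict_mem measurableSet_Ioo)

variable {a b : ℝ} {μ ν : Measure ℝ} {φ G H : ℝ → ℝ} {u v : ℝ} {ρ : Measure (ℝ × ℝ)}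

/-- A Borel version of the quantile function on the unit interval. -/
def quantile (μ : Measure ℝ) : ℝ → ℝ := (Ioo 0 1).indicator (Finv μ)

lemma quantile_eq (hu : u ∈ Ioo (0 : ℝ) 1) : quantile μ u = Finv μ u := indicator_of_mem hu _

/-- The probability of moving from the quantile down to `G`. -/
def downProb (μ : Measure ℝ) (G H : ℝ → ℝ) (u : ℝ) : ℝ := (H u - quantile μ u) / (H u - G u)

lemma downProb_eq (hu : u ∈ Ioo (0 : ℝ) 1) :
    downProb μ G H u = (H u - Finv μ u) / (H u - G u) := by
  rw [downProb, quantile_eq hu]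

lemma setIntegral_downProb (hA : MeasurableSet A) (hAs : A ⊆ Ioo 0 1) :
    ∫ u in A, downProb μ G H u = ∫ u in A, (H u - Finv μ u) / (H u - G u) :=
  setIntegral_congr_fun hA fun _ hu => downProb_eq (hAs hu)

lemma setIntegral_one_sub_downProb (hA : MeasurableSet A) (hAs : A ⊆ Ioo 0 1) :
    ∫ u in A, (1 - downProb μ G H u) = ∫ u in A, (1 - (H u - Finv μ u) / (H u - G u)) :=
  setIntegral_congr_fun hA fun _ hu => by simp only [downProb_eq (hAs hu)]

variable [IsProbabilityMeasure μ]

lemma IsOptimalPair.downProb_mem_Icc (P : IsOptimalPair a b μ ν φ G H) :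
    ∀ u ∈ Ioo (0 : ℝ) 1, downProb μ G H u ∈ Icc (0 : ℝ) 1 := fun u hu => by
  rw [downProb_eq hu]
  exact P.weight_mem_Icc hu

lemma measurable_quantile : Measurable (quantile μ) := by
  refine measurable_of_Iic fun z => ?_
  have : quantile μ ⁻¹' Iic z =
      (Ioo 0 1 ∩ Iic (cdf μ z)) ∪ ((Ioo (0 : ℝ) 1)ᶜ ∩ {_u | (0 : ℝ) ≤ z}) := by
    ext u
    by_cases hu : u ∈ Ioo (0 : ℝ) 1
    · simp only [mem_preimage, quantile_eq hu, mem_Iic, Finv_le_iff hu, mem_union, mem_inter_iff,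
        hu, mem_compl_iff, true_and, not_true, false_and, or_false]
    · simp only [mem_preimage, quantile, indicator_of_notMem hu, mem_Iic, mem_union, mem_inter_iff,
        hu, mem_compl_iff, not_false_eq_true, true_and, false_and, false_or, mem_ofPred_eq]
  rw [this]
  exact (measurableSet_Ioo.inter measurableSet_Iic).union
    (measurableSet_Ioo.compl.inter (MeasurableSet.const _))

lemma map_quantile : unitUniform.map (quantile μ) = μ := by
  have : quantile μ =ᵐ[unitUniform] Finv μ := by
    filter_upwards [ae_restrict_mem measurableSet_Ioo] with u hu using quantile_eq hu
  rw [Measure.map_congr this, map_Finv]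

/-- The second coordinate of the coupling, as a function on the unit square. -/
def target (μ : Measure ℝ) (G H : ℝ → ℝ) (p : ℝ × ℝ) : ℝ :=
  if p.2 ≤ downProb μ G H p.1 then G p.1 else H p.1

/-- The joint law of the quantile and the target. -/
def squareCoupling (μ : Measure ℝ) (G H : ℝ → ℝ) : Measure (ℝ × ℝ) :=
  (unitUniform.prod unitUniform).map fun p => (quantile μ p.1, target μ G H p)

lemma measurable_downProb (hG : Measurable G) (hH : Measurable H) :
    Measurable (downProb μ G H) :=
  (hH.sub measurable_quantile).div (hH.sub hG)

lemma measurable_target (hG : Measurable G) (hH : Measurable H) :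
    Measurable (target μ G H) :=
  Measurable.ite (measurableSet_le measurable_snd ((measurable_downProb hG hH).comp measurable_fst))
    (hG.comp measurable_fst) (hH.comp measurable_fst)

lemma measurable_quantile_target (hG : Measurable G) (hH : Measurable H) :
    Measurable fun p : ℝ × ℝ => (quantile μ p.1, target μ G H p) :=
  (measurable_quantile.comp measurable_fst).prodMk (measurable_target hG hH)

variable [IsProbabilityMeasure ν]

namespace IsOptimalPair

lemma map_target (P : IsOptimalPair a b μ ν φ G H) (hG : Measurable G) (hH : Measurable H) :
    (unitUniform.prod unitUniform).map (target μ G H) = ν := by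
  have hm := measurable_target (μ := μ) hG hH
  have : IsProbabilityMeasure ((unitUniform.prod unitUniform).map (target μ G H)) :=
    Measure.isProbabilityMeasure_map hm.aemeasurable
  have hD := measurable_downProb (μ := μ) hG hH
  refine Measure.eq_of_cdf _ _ (StieltjesFunction.ext fun k => ?_)
  have hGk : MeasurableSet (Ioo 0 1 ∩ G ⁻¹' Iic k) := measurableSet_Ioo.inter (hG measurableSet_Iic)
  have hHk : MeasurableSet (Ioo 0 1 ∩ H ⁻¹' Iic k) := measurableSet_Ioo.inter (hH measurableSet_Iic)
  rw [cdf_eq_real, map_measureReal_apply hm measurableSet_Iic]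
  rcases lt_or_ge k b with hk | hk
  · rw [← P.setIntegral_weight_G hG hH hk, ← setIntegral_downProb hGk inter_subset_left,
      ← measureReal_prod_le hGk inter_subset_left hD P.downProb_mem_Icc]
    refine measureReal_congr ?_
    filter_upwards [ae_fst_mem_Ioo] with p hp
    have := P.le_H _ hp
    simp only [eq_iff_iff]
    change target μ G H p ≤ k ↔ ((_ ∧ G p.1 ≤ k) ∧ _)
    rw [target]
    grind
  · have e1 := P.setIntegral_weight_G hG hH P.lt
    have hGa : Ioo (0 : ℝ) 1 ∩ G ⁻¹' Iic a = Ioo 0 1 :=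
      inter_eq_left.2 fun u hu => P.G_le u hu
    rw [hGa, ← setIntegral_downProb measurableSet_Ioo subset_rfl,
      ← measureReal_prod_le measurableSet_Ioo subset_rfl hD P.downProb_mem_Icc,
      P.cdf_eq le_rfl P.lt.le] at e1
    have e2 := P.setIntegral_weight_H hG hH hk
    rw [← setIntegral_one_sub_downProb hHk inter_subset_left,
      ← measureReal_prod_lt hHk inter_subset_left hD P.downProb_mem_Icc] at e2
    rw [← add_sub_cancel (cdf ν b) (cdf ν k), ← e2, ← e1, ← measureReal_union]
    · refine measureReal_congr ?_
      filter_upwards [ae_fst_mem_Ioo] with p hp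
      have := P.G_le _ hp
      have := P.lt
      simp only [eq_iff_iff]
      change target μ G H p ≤ k ↔ ((_ ∧ _) ∨ ((_ ∧ H p.1 ≤ k) ∧ _))
      rw [target]
      grind
    · refine disjoint_left.2 fun p hp hp' => ?_
      exact absurd hp.2 (not_le.2 hp'.2)
    · exact (measurable_fst hHk).inter
        (measurableSet_lt (hD.comp measurable_fst) measurable_snd)

lemma integral_target (P : IsOptimalPair a b μ ν φ G H) (hu : u ∈ Ioo (0 : ℝ) 1) :
    ∫ v, (target μ G H (u, v) - quantile μ u) ∂unitUniform = 0 := by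
  have h1 : (fun v => target μ G H (u, v) - quantile μ u) =
      fun v => (Iic (downProb μ G H u)).indicator (fun _ => G u - H u) v +
        (H u - quantile μ u) := by
    funext v
    by_cases hv : v ≤ downProb μ G H u
    · simp only [target, hv, if_true, indicator_of_mem (mem_Iic.2 hv)]
      ring
    · simp only [target, hv, if_false, indicator_of_notMem (mt mem_Iic.1 hv), zero_add]
  have hD := P.downProb_mem_Icc u hu
  rw [h1, integral_add ((integrable_const _).indicator measurableSet_Iic) (integrable_const _),
    integral_indicator_const _ measurableSet_Iic, integral_const, measureReal_def,
    unitUniform_Iic hD, ENNReal.toReal_ofReal hD.1, probReal_univ, smul_eq_mul, smul_eq_mul]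
  have := (P.width_pos hu).ne'
  simp only [downProb]
  field_simp
  ring

lemma isMartingaleCoupling (P : IsOptimalPair a b μ ν φ G H) (hG : Measurable G)
    (hH : Measurable H) : IsMartingaleCoupling μ ν (squareCoupling μ G H) := by
  have hm := measurable_quantile_target (μ := μ) hG hH
  have hq := measurable_quantile (μ := μ)
  have ht := measurable_target (μ := μ) hG hH
  refine ⟨Measure.isProbabilityMeasure_map hm.aemeasurable, ?_, ?_, ?_⟩
  · rw [squareCoupling, Measure.map_map measurable_fst hm]
    change Measure.map (quantile μ ∘ Prod.fst) _ = μ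
    rw [← Measure.map_map hq measurable_fst, Measure.map_fst_prod, measure_univ,
      one_smul, map_quantile]
  · rw [squareCoupling, Measure.map_map measurable_snd hm]
    exact P.map_target hG hH
  · rintro f hf ⟨C, hC⟩
    have iY : Integrable (target μ G H) (unitUniform.prod unitUniform) := by
      have := P.integrable_right
      rw [← P.map_target hG hH] at this
      exact this.comp_measurable ht
    have iX : Integrable (quantile μ) unitUniform := by
      have := P.integrable_left
      rw [← map_quantile (μ := μ)] at this
      exact this.comp_measurable hq
    have iXY : Integrable (fun p : ℝ × ℝ => f (quantile μ p.1) * (target μ G H p - quantile μ p.1))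
        (unitUniform.prod unitUniform) :=
      (iY.sub (iX.comp_fst _)).bdd_mul (c := C)
        (hf.comp (hq.comp measurable_fst)).aestronglyMeasurable (ae_of_all _ fun p => hC _)
    rw [squareCoupling, integral_map hm.aemeasurable (by
      exact ((hf.comp measurable_fst).mul (measurable_snd.sub measurable_fst)).aestronglyMeasurable),
      integral_prod _ iXY]
    refine integral_eq_zero_of_ae ?_
    filter_upwards [ae_restrict_mem measurableSet_Ioo] with u hu
    rw [integral_const_mul, P.integral_target hu, mul_zero]
    rfl

lemma squareCoupling_real (P : IsOptimalPair a b μ ν φ G H) (hG : Measurable G)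
    (hH : Measurable H) (z : ℝ) :
    (squareCoupling μ G H).real {w | w.1 ≤ z ∧ w.2 ≤ a} =
      ∫ u in Ioo 0 1 ∩ Iic (cdf μ z), (H u - Finv μ u) / (H u - G u) := by
  have hm := measurable_quantile_target (μ := μ) hG hH
  have hz : MeasurableSet (Ioo 0 1 ∩ Iic (cdf μ z)) := measurableSet_Ioo.inter measurableSet_Iic
  have hL : MeasurableSet {w : ℝ × ℝ | w.1 ≤ z ∧ w.2 ≤ a} :=
    (measurableSet_le measurable_fst measurable_const).inter
      (measurableSet_le measurable_snd measurable_const)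
  rw [squareCoupling, map_measureReal_apply hm hL, ← setIntegral_downProb hz inter_subset_left,
    ← measureReal_prod_le hz inter_subset_left (measurable_downProb hG hH) P.downProb_mem_Icc]
  refine measureReal_congr ?_
  filter_upwards [ae_fst_mem_Ioo] with p hp
  have h1 := P.le_H _ hp
  have h2 := P.G_le _ hp
  have h3 := P.lt
  simp only [eq_iff_iff]
  change (quantile μ p.1 ≤ z ∧ target μ G H p ≤ a) ↔ ((_ ∧ p.1 ≤ cdf μ z) ∧ _)
  rw [quantile_eq hp, Finv_le_iff hp, target]
  grind

lemma squareCoupling_real_le (P : IsOptimalPair a b μ ν φ G H) (hG : Measurable G)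
    (hH : Measurable H) (hρ : IsMartingaleCoupling μ ν ρ) (z : ℝ) :
    (squareCoupling μ G H).real {w | w.1 ≤ z ∧ w.2 ≤ a} ≤ ρ.real {w | w.1 ≤ z ∧ w.2 ≤ a} := by
  have := hρ.1
  rw [P.squareCoupling_real hG hH]
  rcases (cdf_nonneg μ z).eq_or_lt with h0 | h0
  · have : Ioo (0 : ℝ) 1 ∩ Iic (cdf μ z) = ∅ := by
      rw [← h0]
      ext u
      simp only [mem_inter_iff, mem_Ioo, mem_Iic, mem_empty_iff_false]
      grind
    rw [this, setIntegral_empty]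
    exact measureReal_nonneg
  rcases (cdf_le_one μ z).eq_or_lt with h1 | h1
  · have e1 := P.setIntegral_weight_G hG hH P.lt
    have e2 : Ioo (0 : ℝ) 1 ∩ G ⁻¹' Iic a = Ioo 0 1 ∩ Iic (cdf μ z) := by
      have h2 : Ioo (0 : ℝ) 1 ⊆ G ⁻¹' Iic a := fun u hu => P.G_le u hu
      have h3 : Ioo (0 : ℝ) 1 ⊆ Iic 1 := fun u hu => hu.2.le
      rw [h1, inter_eq_left.2 h2, inter_eq_left.2 h3]
    rw [← e2, e1, cdf_eq_real, hρ.real_snd measurableSet_Iic]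
    refine (measureReal_congr ?_).le
    have h2 : ∀ᵐ x ∂μ, x ∈ Iic z := by
      rw [cdf_eq_real] at h1
      rw [ae_iff]
      have := probReal_compl_eq_one_sub (μ := μ) (measurableSet_Iic (a := z))
      rw [h1, sub_self, measureReal_eq_zero_iff] at this
      exact this
    filter_upwards [hρ.ae_fst h2] with w hw
    simp only [eq_iff_iff]
    change (w.2 ≤ a) ↔ (w.1 ≤ z ∧ w.2 ≤ a)
    exact ⟨fun h => ⟨hw, h⟩, fun h => h.2⟩
  · rw [P.setIntegral_weight_Iic hG hH ⟨h0, h1⟩]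
    exact P.slope_add_one_le hρ ⟨h0, h1⟩

lemma isGreatest_integral_abs (P : IsOptimalPair a b μ ν φ G H) (hG : Measurable G)
    (hH : Measurable H) :
    IsGreatest {r : ℝ | ∃ ρ : Measure (ℝ × ℝ), IsMartingaleCoupling μ ν ρ ∧
        r = ∫ w : ℝ × ℝ, |w.2 - w.1| ∂ρ}
      (∫ p : ℝ × ℝ, |target μ G H p - quantile μ p.1| ∂unitUniform.prod unitUniform) := by
  have h1 := P.isMartingaleCoupling hG hH
  have h2 : ∫ w : ℝ × ℝ, |w.2 - w.1| ∂squareCoupling μ G H =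
      ∫ p : ℝ × ℝ, |target μ G H p - quantile μ p.1| ∂unitUniform.prod unitUniform :=
    integral_map (measurable_quantile_target hG hH).aemeasurable (by fun_prop)
  refine ⟨⟨_, h1, h2.symm⟩, ?_⟩
  rintro _ ⟨ρ, hρ, rfl⟩
  rw [← h2]
  exact P.integral_abs_le hρ h1 fun z => P.squareCoupling_real_le hG hH hρ z

end IsOptimalPair

end Square

theorem stmt11 (a b : ℝ) (hab : a < b) (μ ν : Measure ℝ)
    [IsProbabilityMeasure μ] [IsProbabilityMeasure ν]
    (hμ1 : Integrable id μ) (hν1 : Integrable id ν)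
    (hmean : ∫ x, x ∂μ = ∫ x, x ∂ν)
    (hC : ∀ x : ℝ, Cfun μ x ≤ Cfun ν x)
    (hdisj : (μ ⊓ ν) univ = 0)
    (hsupμ : μ (Icc a b)ᶜ = 0) (hsupν : ν (Ioo a b) = 0)
    (cb' : ℝ) (hcb' : HasDerivWithinAt (Cfun ν) cb' (Ioi b) b)
    (G H : ℝ → ℝ) (hGmeas : Measurable G) (hHmeas : Measurable H)
    (hGH : ∀ u ∈ Ioo (0 : ℝ) 1, G u ≤ a ∧ b ≤ H u ∧
      phiU μ ν a b cb' u = (FfunU μ ν b cb' u (H u) - Cfun ν (G u)) / (H u - G u))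
    {Ω : Type*} [MeasurableSpace Ω] (Pr : Measure Ω) [IsProbabilityMeasure Pr]
    (U V : Ω → ℝ) (hU : Measurable U) (hV : Measurable V)
    (hUlaw : Pr.map U = volume.restrict (Ioo (0 : ℝ) 1))
    (hVlaw : Pr.map V = volume.restrict (Ioo (0 : ℝ) 1))
    (hUV : IndepFun U V Pr) :
    Pr.map (fun ω => Finv μ (U ω)) = μ ∧
    Pr.map (fun ω =>
      if V ω ≤ (H (U ω) - Finv μ (U ω)) / (H (U ω) - G (U ω))
      then G (U ω) else H (U ω)) = ν ∧
    (∫ ω, |(if V ω ≤ (H (U ω) - Finv μ (U ω)) / (H (U ω) - G (U ω))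
             then G (U ω) else H (U ω)) - Finv μ (U ω)| ∂Pr)
      = sSup {r : ℝ | ∃ ρ : Measure (ℝ × ℝ), IsMartingaleCoupling μ ν ρ ∧
          r = ∫ w : ℝ × ℝ, |w.2 - w.1| ∂ρ} := by
  have hcb := derivWithin_Cfun_eq hν1 hcb'
  subst hcb
  have P : IsOptimalPair a b μ ν (phiU μ ν a b (cdf ν b - 1)) G H := by
    refine ⟨hab, hμ1, hν1, hC, hsupμ, hsupν, fun u hu => (hGH u hu).1,
      fun u hu => (hGH u hu).2.1, fun u hu g hg h hh => ?_, fun u hu => ?_⟩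
    · rw [← div_le_iff₀ (by linarith)]
      refine le_csSup ⟨u - 1, ?_⟩ ⟨g, h, hg, hh, rfl⟩
      rintro _ ⟨g', h', hg', hh', rfl⟩
      rw [div_le_iff₀ (by linarith)]
      exact FfunU_sub_Cfun_le hμ1 hν1 hC hu hh'
    · obtain ⟨h1, h2, h3⟩ := hGH u hu
      rw [h3, div_mul_cancel₀]
      linarith
  have hUm : ∀ᵐ ω ∂Pr, U ω ∈ Ioo (0 : ℝ) 1 := by
    refine ae_of_ae_map hU.aemeasurable ?_
    rw [hUlaw]
    exact ae_restrict_mem measurableSet_Ioo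
  have hW : Measurable fun ω => (U ω, V ω) := hU.prodMk hV
  have hWlaw : Pr.map (fun ω => (U ω, V ω)) = unitUniform.prod unitUniform := by
    rw [(indepFun_iff_map_prod_eq_prod_map_map hU.aemeasurable hV.aemeasurable).1 hUV, hUlaw, hVlaw]
  have hX : (fun ω => Finv μ (U ω)) =ᵐ[Pr] quantile μ ∘ U := by
    filter_upwards [hUm] with ω hω using (quantile_eq hω).symm
  have hY : (fun ω => if V ω ≤ (H (U ω) - Finv μ (U ω)) / (H (U ω) - G (U ω))
      then G (U ω) else H (U ω)) =ᵐ[Pr] target μ G H ∘ fun ω => (U ω, V ω) := by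
    filter_upwards [hUm] with ω hω
    simp only [Function.comp_apply, target, downProb_eq hω]
  have hq := measurable_quantile (μ := μ)
  have ht := measurable_target (μ := μ) hGmeas hHmeas
  refine ⟨?_, ?_, ?_⟩
  · rw [Measure.map_congr hX, ← Measure.map_map hq hU, hUlaw, map_quantile]
  · rw [Measure.map_congr hY, ← Measure.map_map ht hW, hWlaw, P.map_target hGmeas hHmeas]
  · have hm : Measurable fun p : ℝ × ℝ => |target μ G H p - quantile μ p.1| :=
      (ht.sub (hq.comp measurable_fst)).abs
    rw [(P.isGreatest_integral_abs hGmeas hHmeas).csSup_eq, ← hWlaw,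
      integral_map hW.aemeasurable hm.aestronglyMeasurable]
    refine integral_congr_ae ?_
    filter_upwards [hX, hY] with ω h1 h2
    rw [h2, h1]
    rfl
end
end

section
/- Let a < b, let p : [a,b] → ℝ and q : [a,b] → ℝ be nonincreasing with p(x) ≤ a and q(x) ≥ b for all x ∈ [a,b], and let θ, α be the associated multipliers. Then for all a ≤ x ≤ y ≤ b: (y − x) + α(x) − α(y) + θ(x)(y − x) = ∫_x^y 2(q(z) − y)/(q(z) − p(z)) dz ≥ 0; and for all a ≤ y < x ≤ b: (x − y) + α(x) − α(y) + θ(x)(y − x) = ∫_y^x 2(y − p(z))/(q(z) − p(z)) dz ≥ 0. -/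
open Set MeasureTheory intervalIntegral
open scoped Classical

noncomputable section

/-- θ(x) = ∫_{x₀}^x 2/(q z − p z) dz -/
def thetaFn (p q : ℝ → ℝ) (x₀ x : ℝ) : ℝ := ∫ z in x₀..x, 2 / (q z - p z)

/-- α(x) = ∫_{x₀}^x (2x − q z − p z)/(q z − p z) dz -/
def alphaFn (p q : ℝ → ℝ) (x₀ x : ℝ) : ℝ :=
  ∫ z in x₀..x, (2 * x - q z - p z) / (q z - p z)

/-- right-continuous inverse of p : p_R⁻¹(y) = inf {x ∈ [a,b] : p x ≤ y}, = b if empty. -/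
def pRinv (a b : ℝ) (p : ℝ → ℝ) (y : ℝ) : ℝ :=
  if ({x | x ∈ Icc a b ∧ p x ≤ y}).Nonempty then sInf {x | x ∈ Icc a b ∧ p x ≤ y} else b

/-- left-continuous inverse of q : q_L⁻¹(y) = sup {x ∈ [a,b] : q x ≥ y}, = a if empty. -/
def qLinv (a b : ℝ) (q : ℝ → ℝ) (y : ℝ) : ℝ :=
  if ({x | x ∈ Icc a b ∧ y ≤ q x}).Nonempty then sSup {x | x ∈ Icc a b ∧ y ≤ q x} else a

def deltaFn (a b x₀ : ℝ) (p q : ℝ → ℝ) (x : ℝ) : ℝ :=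
  if x < a then thetaFn p q x₀ (pRinv a b p x)
  else if x ≤ b then thetaFn p q x₀ x
  else thetaFn p q x₀ (qLinv a b q x)

def psiFn (a b x₀ : ℝ) (p q : ℝ → ℝ) (x : ℝ) : ℝ :=
  if x < a then
    alphaFn p q x₀ (pRinv a b p x)
      + (pRinv a b p x - x) * (1 - thetaFn p q x₀ (pRinv a b p x))
  else if x ≤ b then alphaFn p q x₀ x
  else
    alphaFn p q x₀ (qLinv a b q x)
      + (qLinv a b q x - x) * (-1 - thetaFn p q x₀ (qLinv a b q x))

def LagFn (a b x₀ : ℝ) (p q : ℝ → ℝ) (x y : ℝ) : ℝ :=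
  |y - x| + psiFn a b x₀ p q x - psiFn a b x₀ p q y + deltaFn a b x₀ p q x * (y - x)

/-- Dividing an integrable function by `q - p`, which is bounded below by `b - a`, keeps it
integrable. -/
lemma integrableOn_div_sub {a b : ℝ} (hab : a < b) {p q f : ℝ → ℝ}
    (hp : AntitoneOn p (Icc a b)) (hq : AntitoneOn q (Icc a b))
    (hpa : ∀ x ∈ Icc a b, p x ≤ a) (hqb : ∀ x ∈ Icc a b, b ≤ q x)
    (hf : IntegrableOn f (Icc a b)) :
    IntegrableOn (fun z => f z / (q z - p z)) (Icc a b) := by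
  have hmeas : AEStronglyMeasurable (fun z => (q z - p z)⁻¹) (volume.restrict (Icc a b)) :=
    ((aemeasurable_restrict_of_antitoneOn measurableSet_Icc hq).sub
      (aemeasurable_restrict_of_antitoneOn measurableSet_Icc hp)).inv.aestronglyMeasurable
  have hbound : ∀ᵐ z ∂volume.restrict (Icc a b), ‖(q z - p z)⁻¹‖ ≤ (b - a)⁻¹ := by
    filter_upwards [ae_restrict_mem measurableSet_Icc] with z hz
    have hle : b - a ≤ q z - p z := by linarith [hpa z hz, hqb z hz]
    rw [norm_inv, Real.norm_of_nonneg ((sub_pos.2 hab).le.trans hle)]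
    exact inv_anti₀ (sub_pos.2 hab) hle
  simp only [div_eq_mul_inv]
  exact Integrable.mul_bdd hf hmeas hbound

lemma intervalIntegrable_div_sub {a b : ℝ} (hab : a < b) {p q f : ℝ → ℝ}
    (hp : AntitoneOn p (Icc a b)) (hq : AntitoneOn q (Icc a b))
    (hpa : ∀ x ∈ Icc a b, p x ≤ a) (hqb : ∀ x ∈ Icc a b, b ≤ q x)
    (hf : IntegrableOn f (Icc a b)) {x y : ℝ} (hx : x ∈ Icc a b) (hy : y ∈ Icc a b) :
    IntervalIntegrable (fun z => f z / (q z - p z)) volume x y :=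
  ((integrableOn_div_sub hab hp hq hpa hqb hf).mono_set
    (uIcc_subset_Icc hx hy)).intervalIntegrable

lemma alphaFn_sub_alphaFn_add_thetaFn_mul {a b x₀ : ℝ} (hab : a < b) (hx₀ : x₀ ∈ Icc a b)
    {p q : ℝ → ℝ} (hp : AntitoneOn p (Icc a b)) (hq : AntitoneOn q (Icc a b))
    (hpa : ∀ x ∈ Icc a b, p x ≤ a) (hqb : ∀ x ∈ Icc a b, b ≤ q x)
    {x y : ℝ} (hx : x ∈ Icc a b) (hy : y ∈ Icc a b) :
    alphaFn p q x₀ x - alphaFn p q x₀ y + thetaFn p q x₀ x * (y - x)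
      = ∫ z in x..y, (q z + p z - 2 * y) / (q z - p z) := by
  have hdiv {f : ℝ → ℝ} (hf : IntegrableOn f (Icc a b)) {u v : ℝ} (hu : u ∈ Icc a b)
      (hv : v ∈ Icc a b) : IntervalIntegrable (fun z => f z / (q z - p z)) volume u v :=
    intervalIntegrable_div_sub hab hp hq hpa hqb hf hu hv
  have hpi : IntegrableOn p (Icc a b) := hp.integrableOn_isCompact isCompact_Icc
  have hqi : IntegrableOn q (Icc a b) := hq.integrableOn_isCompact isCompact_Icc
  have hconst (c : ℝ) : IntegrableOn (fun _ : ℝ => c) (Icc a b) := by simp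
  have hnum (c : ℝ) : IntegrableOn (fun z => c - q z - p z) (Icc a b) :=
    ((hconst c).sub hqi).sub hpi
  have hshift : alphaFn p q x₀ x + thetaFn p q x₀ x * (y - x)
      = ∫ z in x₀..x, (2 * y - q z - p z) / (q z - p z) := by
    rw [alphaFn, thetaFn, ← intervalIntegral.integral_mul_const,
      ← integral_add (hdiv (hnum _) hx₀ hx) ((hdiv (hconst 2) hx₀ hx).mul_const _)]
    congr 1 with z
    ring
  have hsplit := integral_add_adjacent_intervals
    (hdiv (hnum (2 * y)) hx₀ hx) (hdiv (hnum (2 * y)) hx hy)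
  have hneg : ∫ z in x..y, (q z + p z - 2 * y) / (q z - p z)
      = -∫ z in x..y, (2 * y - q z - p z) / (q z - p z) := by
    rw [← intervalIntegral.integral_neg]
    congr 1 with z
    ring
  have hy' : alphaFn p q x₀ y = ∫ z in x₀..y, (2 * y - q z - p z) / (q z - p z) := rfl
  linarith

theorem stmt12 (a b x₀ : ℝ) (hab : a < b) (hx₀ : x₀ ∈ Icc a b)
    (p q : ℝ → ℝ)
    (hp : AntitoneOn p (Icc a b)) (hq : AntitoneOn q (Icc a b))
    (hpa : ∀ x ∈ Icc a b, p x ≤ a) (hqb : ∀ x ∈ Icc a b, b ≤ q x) :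
    (∀ x y : ℝ, a ≤ x → x ≤ y → y ≤ b →
      ((y - x) + alphaFn p q x₀ x - alphaFn p q x₀ y + thetaFn p q x₀ x * (y - x)
          = ∫ z in x..y, 2 * (q z - y) / (q z - p z)) ∧
      0 ≤ (y - x) + alphaFn p q x₀ x - alphaFn p q x₀ y + thetaFn p q x₀ x * (y - x)) ∧
    (∀ x y : ℝ, a ≤ y → y < x → x ≤ b →
      ((x - y) + alphaFn p q x₀ x - alphaFn p q x₀ y + thetaFn p q x₀ x * (y - x)
          = ∫ z in y..x, 2 * (y - p z) / (q z - p z)) ∧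
      0 ≤ (x - y) + alphaFn p q x₀ x - alphaFn p q x₀ y + thetaFn p q x₀ x * (y - x)) := by
  have hpos {z : ℝ} (hz : z ∈ Icc a b) : 0 < q z - p z := by linarith [hpa z hz, hqb z hz]
  have hdiv {u v : ℝ} (hu : u ∈ Icc a b) (hv : v ∈ Icc a b) (c : ℝ) :
      IntervalIntegrable (fun z => (q z + p z - c) / (q z - p z)) volume u v :=
    intervalIntegrable_div_sub hab hp hq hpa hqb
      (((hq.integrableOn_isCompact isCompact_Icc).add
        (hp.integrableOn_isCompact isCompact_Icc)).sub (by simp)) hu hv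
  refine ⟨fun x y hax hxy hyb => ?_, fun x y hay hyx hxb => ?_⟩
  · have hx : x ∈ Icc a b := ⟨hax, hxy.trans hyb⟩
    have hy : y ∈ Icc a b := ⟨hax.trans hxy, hyb⟩
    have heq : (y - x) + alphaFn p q x₀ x - alphaFn p q x₀ y + thetaFn p q x₀ x * (y - x)
        = ∫ z in x..y, 2 * (q z - y) / (q z - p z) := by
      have hone : ∫ _ in x..y, (1 : ℝ) = y - x := integral_one
      rw [add_sub_assoc, add_assoc,
        alphaFn_sub_alphaFn_add_thetaFn_mul hab hx₀ hp hq hpa hqb hx hy, ← hone,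
        ← integral_add intervalIntegrable_const (hdiv hx hy _)]
      refine integral_congr fun z hz => ?_
      have := (hpos (uIcc_subset_Icc hx hy hz)).ne'
      field_simp
      ring
    refine ⟨heq, heq ▸ integral_nonneg hxy fun z hz => ?_⟩
    have hz' : z ∈ Icc a b := Icc_subset_Icc hax hyb hz
    exact div_nonneg (by linarith [hqb z hz']) (hpos hz').le
  · have hx : x ∈ Icc a b := ⟨hay.trans hyx.le, hxb⟩
    have hy : y ∈ Icc a b := ⟨hay, hyx.le.trans hxb⟩
    have heq : (x - y) + alphaFn p q x₀ x - alphaFn p q x₀ y + thetaFn p q x₀ x * (y - x)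
        = ∫ z in y..x, 2 * (y - p z) / (q z - p z) := by
      have hone : ∫ _ in y..x, (1 : ℝ) = x - y := integral_one
      rw [add_sub_assoc, add_assoc,
        alphaFn_sub_alphaFn_add_thetaFn_mul hab hx₀ hp hq hpa hqb hx hy, integral_symm y x,
        ← sub_eq_add_neg, ← hone, ← integral_sub intervalIntegrable_const (hdiv hy hx _)]
      refine integral_congr fun z hz => ?_
      have := (hpos (uIcc_subset_Icc hy hx hz)).ne'
      field_simp
      ring
    refine ⟨heq, heq ▸ integral_nonneg hyx.le fun z hz => ?_⟩
    have hz' : z ∈ Icc a b := Icc_subset_Icc hay hxb hz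
    exact div_nonneg (by linarith [hpa z hz']) (hpos hz').le
end
end

section
/- Let a < b, let p : [a,b] → ℝ and q : [a,b] → ℝ be nonincreasing with p(x) ≤ a and q(x) ≥ b for all x ∈ [a,b], and let θ, α be the associated multipliers. For y > b set ĝ = q_L⁻¹(y) = sup{x ∈ [a,b] : q(x) ≥ y} (= a if this set is empty) and ψ(y) = α(ĝ) + (ĝ − y)(−1 − θ(ĝ)). Then for every x ∈ [a,b] and every y > b: (y − x) + α(x) − ψ(y) + θ(x)(y − x) = ∫_x^{ĝ} 2(q(z) − y)/(q(z) − p(z)) dz, where the integral is oriented (equal to −∫_{ĝ}^x when ĝ < x), and this quantity is nonnegative. -/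
open Set MeasureTheory intervalIntegral
open scoped Classical

noncomputable section

section GapWeight

variable {a b x₀ : ℝ} {p q : ℝ → ℝ}

lemma sub_le_gap (hpa : ∀ x ∈ Icc a b, p x ≤ a) (hqb : ∀ x ∈ Icc a b, b ≤ q x)
    {z : ℝ} (hz : z ∈ Icc a b) : b - a ≤ q z - p z :=
  sub_le_sub (hqb z hz) (hpa z hz)

lemma norm_inv_gap_le (hab : a < b) (hpa : ∀ x ∈ Icc a b, p x ≤ a)
    (hqb : ∀ x ∈ Icc a b, b ≤ q x) {z : ℝ} (hz : z ∈ Icc a b) :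
    ‖(q z - p z)⁻¹‖ ≤ (b - a)⁻¹ := by
  have h := sub_le_gap hpa hqb hz
  have hpos : 0 < b - a := sub_pos.2 hab
  rw [Real.norm_eq_abs, abs_of_nonneg (inv_nonneg.2 (hpos.le.trans h))]
  gcongr

lemma aestronglyMeasurable_inv_gap (hp : AntitoneOn p (Icc a b)) (hq : AntitoneOn q (Icc a b)) :
    AEStronglyMeasurable (fun z => (q z - p z)⁻¹) (volume.restrict (Icc a b)) := by
  have hp' : IntegrableOn p (Icc a b) := hp.integrableOn_isCompact isCompact_Icc
  have hq' : IntegrableOn q (Icc a b) := hq.integrableOn_isCompact isCompact_Icc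
  exact (hq'.aemeasurable.sub hp'.aemeasurable).inv.aestronglyMeasurable

lemma integrableOn_mul_inv_gap (hab : a < b) (hp : AntitoneOn p (Icc a b))
    (hq : AntitoneOn q (Icc a b)) (hpa : ∀ x ∈ Icc a b, p x ≤ a)
    (hqb : ∀ x ∈ Icc a b, b ≤ q x) {f : ℝ → ℝ} (hf : IntegrableOn f (Icc a b)) :
    IntegrableOn (fun z => f z * (q z - p z)⁻¹) (Icc a b) :=
  Integrable.mul_bdd (c := (b - a)⁻¹) hf (aestronglyMeasurable_inv_gap hp hq)
    ((ae_restrict_iff' measurableSet_Icc).2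
      (ae_of_all _ fun _ hz => norm_inv_gap_le hab hpa hqb hz))

lemma intervalIntegrable_inv_gap (hab : a < b) (hp : AntitoneOn p (Icc a b))
    (hq : AntitoneOn q (Icc a b)) (hpa : ∀ x ∈ Icc a b, p x ≤ a)
    (hqb : ∀ x ∈ Icc a b, b ≤ q x) {u v : ℝ} (hu : u ∈ Icc a b) (hv : v ∈ Icc a b) :
    IntervalIntegrable (fun z => (q z - p z)⁻¹) volume u v := by
  have h := integrableOn_mul_inv_gap hab hp hq hpa hqb (f := fun _ => 1)
    (by simp [integrableOn_const_iff])
  simp only [one_mul] at h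
  exact (h.mono_set (uIcc_subset_Icc hu hv)).intervalIntegrable

lemma intervalIntegrable_mul_inv_gap (hab : a < b) (hp : AntitoneOn p (Icc a b))
    (hq : AntitoneOn q (Icc a b)) (hpa : ∀ x ∈ Icc a b, p x ≤ a)
    (hqb : ∀ x ∈ Icc a b, b ≤ q x) {u v : ℝ} (hu : u ∈ Icc a b) (hv : v ∈ Icc a b) :
    IntervalIntegrable (fun z => q z * (q z - p z)⁻¹) volume u v :=
  ((integrableOn_mul_inv_gap hab hp hq hpa hqb
    (hq.integrableOn_isCompact isCompact_Icc)).mono_set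
      (uIcc_subset_Icc hu hv)).intervalIntegrable

lemma thetaFn_eq (x : ℝ) : thetaFn p q x₀ x = 2 * ∫ z in x₀..x, (q z - p z)⁻¹ := by
  simp only [thetaFn, div_eq_mul_inv, intervalIntegral.integral_const_mul]

lemma alphaFn_eq (hab : a < b) (hx₀ : x₀ ∈ Icc a b) (hp : AntitoneOn p (Icc a b))
    (hq : AntitoneOn q (Icc a b)) (hpa : ∀ x ∈ Icc a b, p x ≤ a)
    (hqb : ∀ x ∈ Icc a b, b ≤ q x) {x : ℝ} (hx : x ∈ Icc a b) :
    alphaFn p q x₀ x = 2 * x * (∫ z in x₀..x, (q z - p z)⁻¹)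
      - 2 * (∫ z in x₀..x, q z * (q z - p z)⁻¹) + (x - x₀) := by
  have hW := intervalIntegrable_inv_gap hab hp hq hpa hqb hx₀ hx
  have hS := intervalIntegrable_mul_inv_gap hab hp hq hpa hqb hx₀ hx
  have hcongr : alphaFn p q x₀ x = ∫ z in x₀..x,
      (2 * x * (q z - p z)⁻¹ - 2 * (q z * (q z - p z)⁻¹) + 1) := by
    refine intervalIntegral.integral_congr fun z hz => ?_
    have hgap := sub_le_gap hpa hqb (uIcc_subset_Icc hx₀ hx hz)
    have hne : q z - p z ≠ 0 := by linarith
    field_simp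
    ring
  rw [hcongr, intervalIntegral.integral_add ((hW.const_mul _).sub (hS.const_mul _))
      intervalIntegrable_const,
    intervalIntegral.integral_sub (hW.const_mul _) (hS.const_mul _),
    intervalIntegral.integral_const_mul, intervalIntegral.integral_const_mul,
    intervalIntegral.integral_const]
  simp

lemma integral_two_mul_sub_div_gap (hab : a < b) (hp : AntitoneOn p (Icc a b))
    (hq : AntitoneOn q (Icc a b)) (hpa : ∀ x ∈ Icc a b, p x ≤ a)
    (hqb : ∀ x ∈ Icc a b, b ≤ q x) {u v : ℝ} (hu : u ∈ Icc a b) (hv : v ∈ Icc a b) (y : ℝ) :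
    ∫ z in u..v, 2 * (q z - y) / (q z - p z) =
      2 * (∫ z in u..v, q z * (q z - p z)⁻¹) - 2 * y * ∫ z in u..v, (q z - p z)⁻¹ := by
  have hW := intervalIntegrable_inv_gap hab hp hq hpa hqb hu hv
  have hS := intervalIntegrable_mul_inv_gap hab hp hq hpa hqb hu hv
  rw [← intervalIntegral.integral_const_mul, ← intervalIntegral.integral_const_mul,
    ← intervalIntegral.integral_sub (hS.const_mul _) (hW.const_mul _)]
  congr 1
  ext z
  ring

end GapWeight

section LeftInverse

variable {a b y z : ℝ} {q : ℝ → ℝ}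

lemma bddAbove_superlevel : BddAbove {x | x ∈ Icc a b ∧ y ≤ q x} :=
  ⟨b, fun _ hx => hx.1.2⟩

lemma qLinv_mem_Icc (hab : a ≤ b) : qLinv a b q y ∈ Icc a b := by
  unfold qLinv
  split_ifs with h
  · obtain ⟨x, hx⟩ := h
    exact ⟨hx.1.1.trans (le_csSup bddAbove_superlevel hx), csSup_le ⟨x, hx⟩ fun _ hz => hz.1.2⟩
  · exact left_mem_Icc.2 hab

lemma le_of_lt_qLinv (hq : AntitoneOn q (Icc a b)) (hz : z ∈ Icc a b)
    (hzg : z < qLinv a b q y) : y ≤ q z := by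
  unfold qLinv at hzg
  split_ifs at hzg with h
  · obtain ⟨t, ht, hzt⟩ := exists_lt_of_lt_csSup h hzg
    exact ht.2.trans (hq hz ht.1 hzt.le)
  · exact absurd hz.1 hzg.not_ge

lemma lt_of_qLinv_lt (hz : z ∈ Icc a b) (hgz : qLinv a b q y < z) : q z < y := by
  by_contra! hy
  have hmem : z ∈ {x | x ∈ Icc a b ∧ y ≤ q x} := ⟨hz, hy⟩
  rw [qLinv, if_pos ⟨z, hmem⟩] at hgz
  exact hgz.not_ge (le_csSup bddAbove_superlevel hmem)

end LeftInverse

lemma integral_to_qLinv_nonneg {a b : ℝ} {p q : ℝ → ℝ} (hab : a < b)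
    (hq : AntitoneOn q (Icc a b)) (hpa : ∀ x ∈ Icc a b, p x ≤ a)
    (hqb : ∀ x ∈ Icc a b, b ≤ q x) {x : ℝ} (hx : x ∈ Icc a b) (y : ℝ) :
    0 ≤ ∫ z in x..(qLinv a b q y), 2 * (q z - y) / (q z - p z) := by
  have hg : qLinv a b q y ∈ Icc a b := qLinv_mem_Icc hab.le
  have hgap : ∀ z ∈ Icc a b, 0 ≤ q z - p z := fun z hz =>
    (sub_pos.2 hab).le.trans (sub_le_gap hpa hqb hz)
  rcases le_total x (qLinv a b q y) with h | h
  · rw [intervalIntegral.integral_of_le h, integral_Ioc_eq_integral_Ioo]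
    refine setIntegral_nonneg measurableSet_Ioo fun z hz => ?_
    have hzI : z ∈ Icc a b := ⟨hx.1.trans hz.1.le, hz.2.le.trans hg.2⟩
    have hyz := le_of_lt_qLinv hq hzI hz.2
    exact div_nonneg (by linarith) (hgap z hzI)
  · rw [intervalIntegral.integral_of_ge h, neg_nonneg]
    refine setIntegral_nonpos measurableSet_Ioc fun z hz => ?_
    have hzI : z ∈ Icc a b := ⟨hg.1.trans hz.1.le, hz.2.trans hx.2⟩
    have hzy := lt_of_qLinv_lt hzI hz.1
    exact div_nonpos_of_nonpos_of_nonneg (by linarith) (hgap z hzI)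

theorem stmt13 (a b x₀ : ℝ) (hab : a < b) (hx₀ : x₀ ∈ Icc a b)
    (p q : ℝ → ℝ)
    (hp : AntitoneOn p (Icc a b)) (hq : AntitoneOn q (Icc a b))
    (hpa : ∀ x ∈ Icc a b, p x ≤ a) (hqb : ∀ x ∈ Icc a b, b ≤ q x) :
    ∀ x ∈ Icc a b, ∀ y : ℝ, b < y →
      ((y - x) + alphaFn p q x₀ x
          - (alphaFn p q x₀ (qLinv a b q y)
              + (qLinv a b q y - y) * (-1 - thetaFn p q x₀ (qLinv a b q y)))
          + thetaFn p q x₀ x * (y - x)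
        = ∫ z in x..(qLinv a b q y), 2 * (q z - y) / (q z - p z)) ∧
      0 ≤ (y - x) + alphaFn p q x₀ x
          - (alphaFn p q x₀ (qLinv a b q y)
              + (qLinv a b q y - y) * (-1 - thetaFn p q x₀ (qLinv a b q y)))
          + thetaFn p q x₀ x * (y - x) := by
  intro x hx y _
  have hg : qLinv a b q y ∈ Icc a b := qLinv_mem_Icc hab.le
  have hnonneg := integral_to_qLinv_nonneg hab hq hpa hqb hx y
  set g := qLinv a b q y
  refine (and_iff_left_of_imp fun h => h ▸ hnonneg).2 ?_
  have hW := intervalIntegral.integral_add_adjacent_intervals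
    (intervalIntegrable_inv_gap hab hp hq hpa hqb hx₀ hx)
    (intervalIntegrable_inv_gap hab hp hq hpa hqb hx hg)
  have hS := intervalIntegral.integral_add_adjacent_intervals
    (intervalIntegrable_mul_inv_gap hab hp hq hpa hqb hx₀ hx)
    (intervalIntegrable_mul_inv_gap hab hp hq hpa hqb hx hg)
  rw [integral_two_mul_sub_div_gap hab hp hq hpa hqb hx hg,
    alphaFn_eq hab hx₀ hp hq hpa hqb hx, alphaFn_eq hab hx₀ hp hq hpa hqb hg,
    thetaFn_eq, thetaFn_eq, ← hW, ← hS]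
  ring
end
end

section
/- Let μ be the uniform distribution on [−1,1] and let ν = ½·(uniform on [−3,−1]) + ½·(uniform on [1,3]). Let X be uniform on [−1,1] and let Θ be independent of X with P(Θ = 2) = P(Θ = −2) = ½, and set Y = X + Θ. Then the joint law of (X,Y) is a martingale coupling of (μ,ν), E[|Y − X|] = 2, and for every martingale coupling ρ ∈ M(μ,ν) one has ∫ |y − x| ρ(dx,dy) ≤ 2; thus this coupling attains sup{∫ |y − x| ρ(dx,dy) : ρ ∈ M(μ,ν)} = 2. -/
open Set MeasureTheory
open scoped ENNReal

noncomputable section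

/-- μ = uniform distribution on [−1,1]. -/
def mu15 : Measure ℝ := (2 : ℝ≥0∞)⁻¹ • volume.restrict (Icc (-1) 1)

/-- ν = ½ uniform on [−3,−1] + ½ uniform on [1,3]. -/
def nu15 : Measure ℝ :=
  (4 : ℝ≥0∞)⁻¹ • volume.restrict (Icc (-3) (-1)) + (4 : ℝ≥0∞)⁻¹ • volume.restrict (Icc 1 3)

/-- Law of Θ: uniform on {−2, 2}. -/
def tau15 : Measure ℝ := (2 : ℝ≥0∞)⁻¹ • (Measure.dirac 2 + Measure.dirac (-2))

/-- Joint law of (X, X + Θ), X uniform on [−1,1] independent of Θ. -/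
def rho15 : Measure (ℝ × ℝ) :=
  Measure.map (fun w : ℝ × ℝ => (w.1, w.1 + w.2)) (mu15.prod tau15)

instance isProbabilityMeasure_mu15 : IsProbabilityMeasure mu15 := by
  constructor
  simp only [mu15, Measure.smul_apply, Measure.restrict_apply_univ, Real.volume_Icc, smul_eq_mul]
  norm_num
  exact ENNReal.inv_mul_cancel (by norm_num) (by norm_num)

instance isProbabilityMeasure_tau15 : IsProbabilityMeasure tau15 := by
  constructor
  simp only [tau15, Measure.smul_apply, Measure.add_apply, measure_univ, smul_eq_mul]
  rw [one_add_one_eq_two]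
  exact ENNReal.inv_mul_cancel (by norm_num) (by norm_num)

lemma measurable_pair_add : Measurable (fun w : ℝ × ℝ => (w.1, w.1 + w.2)) := by fun_prop

lemma integral_tau15 (g : ℝ → ℝ) : ∫ t, g t ∂tau15 = (g 2 + g (-2)) / 2 := by
  rw [tau15, integral_smul_measure,
    integral_add_measure (integrable_dirac (by simp)) (integrable_dirac (by simp)),
    integral_dirac, integral_dirac]
  simp
  ring

lemma integral_sub_rho15 {f g : ℝ → ℝ} (hf : Measurable f) (hg : Measurable g) :
    ∫ w : ℝ × ℝ, f w.1 * g (w.2 - w.1) ∂rho15 = (∫ x, f x ∂mu15) * ((g 2 + g (-2)) / 2) := by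
  have hm : Measurable (fun w : ℝ × ℝ => f w.1 * g (w.2 - w.1)) := by fun_prop
  rw [rho15, integral_map measurable_pair_add.aemeasurable hm.aestronglyMeasurable,
    ← integral_tau15, ← integral_prod_mul]
  simp

lemma map_add_right_volume_restrict_Icc (a b c : ℝ) :
    (volume.restrict (Icc a b)).map (fun x => x + c) = volume.restrict (Icc (a + c) (b + c)) := by
  have h := (measurePreserving_add_right (volume : Measure ℝ) c).restrict_preimage
    (measurableSet_Icc (a := a + c) (b := b + c))
  simpa using h.map_eq

lemma map_fst_rho15 : rho15.map Prod.fst = mu15 := by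
  rw [rho15, Measure.map_map measurable_fst measurable_pair_add]
  change (mu15.prod tau15).map Prod.fst = mu15
  simp [Measure.map_fst_prod]

lemma map_snd_rho15 : rho15.map Prod.snd = nu15 := by
  have hadd : Measurable (fun w : ℝ × ℝ => w.1 + w.2) := by fun_prop
  have h (c : ℝ) : (mu15.prod (Measure.dirac c)).map (fun w : ℝ × ℝ => w.1 + w.2) =
      (2 : ℝ≥0∞)⁻¹ • volume.restrict (Icc (-1 + c) (1 + c)) := by
    rw [Measure.prod_dirac, Measure.map_map hadd (by fun_prop), mu15, Measure.map_smul,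
      ← map_add_right_volume_restrict_Icc]
    rfl
  have h4 : (2 : ℝ≥0∞)⁻¹ * 2⁻¹ = 4⁻¹ := by
    rw [← ENNReal.mul_inv (by norm_num) (by norm_num)]
    norm_num
  rw [rho15, Measure.map_map measurable_snd measurable_pair_add]
  change (mu15.prod tau15).map (fun w : ℝ × ℝ => w.1 + w.2) = nu15
  rw [tau15, Measure.prod_smul_right, Measure.prod_add, Measure.map_smul,
    Measure.map_add _ _ hadd, h, h, nu15, smul_add, smul_smul, smul_smul, h4, add_comm]
  norm_num

lemma isMartingaleCoupling_rho15 : IsMartingaleCoupling mu15 nu15 rho15 := by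
  refine ⟨Measure.isProbabilityMeasure_map measurable_pair_add.aemeasurable,
    map_fst_rho15, map_snd_rho15, fun f hf _ => ?_⟩
  simpa using integral_sub_rho15 hf measurable_id

lemma integral_abs_sub_rho15 : ∫ w : ℝ × ℝ, |w.2 - w.1| ∂rho15 = 2 := by
  have h := integral_sub_rho15 (f := fun _ => 1) (g := fun t => |t|) (by fun_prop) (by fun_prop)
  simpa using h

lemma integrable_sq_restrict_Icc (a b : ℝ) :
    Integrable (fun x : ℝ => x ^ 2) (volume.restrict (Icc a b)) :=
  (continuous_pow 2).continuousOn.integrableOn_Icc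

lemma integral_sq_restrict_Icc {a b : ℝ} (h : a ≤ b) :
    ∫ x in Icc a b, x ^ 2 = (b ^ 3 - a ^ 3) / 3 := by
  rw [integral_Icc_eq_integral_Ioc, ← intervalIntegral.integral_of_le h, integral_pow]
  norm_num

lemma integrable_sq_mu15 : Integrable (fun x : ℝ => x ^ 2) mu15 :=
  (integrable_sq_restrict_Icc _ _).smul_measure (by simp)

lemma integral_sq_mu15 : ∫ x, x ^ 2 ∂mu15 = 1 / 3 := by
  rw [mu15, integral_smul_measure, integral_sq_restrict_Icc (by norm_num)]
  norm_num

lemma integrable_sq_nu15 : Integrable (fun x : ℝ => x ^ 2) nu15 :=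
  ((integrable_sq_restrict_Icc _ _).smul_measure (by simp)).add_measure
    ((integrable_sq_restrict_Icc _ _).smul_measure (by simp))

lemma integral_sq_nu15 : ∫ x, x ^ 2 ∂nu15 = 13 / 3 := by
  rw [nu15, integral_add_measure ((integrable_sq_restrict_Icc _ _).smul_measure (by simp))
    ((integrable_sq_restrict_Icc _ _).smul_measure (by simp)), integral_smul_measure,
    integral_smul_measure, integral_sq_restrict_Icc (by norm_num),
    integral_sq_restrict_Icc (by norm_num)]
  norm_num

lemma ae_mem_Icc_mu15 : ∀ᵐ x ∂mu15, x ∈ Icc (-1 : ℝ) 1 :=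
  Measure.ae_smul_measure (ae_restrict_mem measurableSet_Icc) _

/-- The bound follows from `4 * |y - x| ≤ 4 + (y - x) ^ 2` and the martingale property, which
gives `∫ (y - x) ^ 2 = ∫ y ^ 2 - ∫ x ^ 2`. -/
lemma integral_abs_sub_le_two {ρ : Measure (ℝ × ℝ)} (hρ : IsMartingaleCoupling mu15 nu15 ρ) :
    ∫ w : ℝ × ℝ, |w.2 - w.1| ∂ρ ≤ 2 := by
  obtain ⟨hprob, hfst, hsnd, hmart⟩ := hρ
  have hx2 : Integrable (fun w : ℝ × ℝ => w.1 ^ 2) ρ :=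
    Integrable.comp_measurable (g := fun x : ℝ => x ^ 2) (hfst ▸ integrable_sq_mu15) measurable_fst
  have hy2 : Integrable (fun w : ℝ × ℝ => w.2 ^ 2) ρ :=
    Integrable.comp_measurable (g := fun x : ℝ => x ^ 2) (hsnd ▸ integrable_sq_nu15) measurable_snd
  have ix2 : ∫ w : ℝ × ℝ, w.1 ^ 2 ∂ρ = 1 / 3 := by
    rw [← integral_sq_mu15, ← hfst, integral_map measurable_fst.aemeasurable
      (by fun_prop)]
  have iy2 : ∫ w : ℝ × ℝ, w.2 ^ 2 ∂ρ = 13 / 3 := by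
    rw [← integral_sq_nu15, ← hsnd, integral_map measurable_snd.aemeasurable
      (by fun_prop)]
  have hmem : ∀ᵐ w ∂ρ, w.1 ∈ Icc (-1 : ℝ) 1 :=
    ae_of_ae_map measurable_fst.aemeasurable (hfst ▸ ae_mem_Icc_mu15)
  have hxy : Integrable (fun w : ℝ × ℝ => w.1 * (w.2 - w.1)) ρ := by
    refine ((hx2.const_mul 2).add hy2).mono' (by fun_prop) (.of_forall fun w => ?_)
    rw [Real.norm_eq_abs, abs_le]
    simp only [Pi.add_apply]
    constructor <;> nlinarith [sq_nonneg (w.1 + w.2), sq_nonneg (w.1 - w.2), sq_nonneg w.1,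
      sq_nonneg w.2]
  have ixy : ∫ w : ℝ × ℝ, w.1 * (w.2 - w.1) ∂ρ = 0 := by
    rw [← hmart (fun x => max (-1) (min x 1)) (by fun_prop)
      ⟨1, fun x => abs_le.2 ⟨le_max_left _ _, max_le (by norm_num) (min_le_right _ _)⟩⟩]
    refine integral_congr_ae ?_
    filter_upwards [hmem] with w hw
    rw [min_eq_left hw.2, max_eq_right hw.1]
  have hq : Integrable (fun w : ℝ × ℝ => w.2 ^ 2 - w.1 ^ 2 - 2 * (w.1 * (w.2 - w.1))) ρ :=
    (hy2.sub hx2).sub (hxy.const_mul 2)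
  have iq : ∫ w : ℝ × ℝ, (w.2 ^ 2 - w.1 ^ 2 - 2 * (w.1 * (w.2 - w.1))) ∂ρ = 4 := by
    rw [integral_sub (by exact hy2.sub hx2) (hxy.const_mul 2), integral_sub hy2 hx2,
      integral_const_mul, ix2, iy2, ixy]
    norm_num
  calc ∫ w : ℝ × ℝ, |w.2 - w.1| ∂ρ
      ≤ ∫ w : ℝ × ℝ, (1 + (w.2 ^ 2 - w.1 ^ 2 - 2 * (w.1 * (w.2 - w.1))) / 4) ∂ρ := by
        refine integral_mono_of_nonneg (.of_forall fun w => abs_nonneg _)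
          ((integrable_const _).add (hq.div_const 4)) (.of_forall fun w => ?_)
        dsimp only
        nlinarith [sq_nonneg (|w.2 - w.1| - 2), sq_abs (w.2 - w.1)]
    _ = 2 := by
        rw [integral_add (integrable_const _) (hq.div_const 4), integral_div, iq]
        norm_num

theorem stmt15 :
    IsMartingaleCoupling mu15 nu15 rho15 ∧
    ∫ w : ℝ × ℝ, |w.2 - w.1| ∂rho15 = 2 ∧
    (∀ ρ' : Measure (ℝ × ℝ), IsMartingaleCoupling mu15 nu15 ρ' →
      ∫ w : ℝ × ℝ, |w.2 - w.1| ∂ρ' ≤ 2) ∧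
    sSup {r : ℝ | ∃ ρ' : Measure (ℝ × ℝ), IsMartingaleCoupling mu15 nu15 ρ' ∧
      r = ∫ w : ℝ × ℝ, |w.2 - w.1| ∂ρ'} = 2 := by
  have hle : ∀ ρ' : Measure (ℝ × ℝ), IsMartingaleCoupling mu15 nu15 ρ' →
      ∫ w : ℝ × ℝ, |w.2 - w.1| ∂ρ' ≤ 2 := fun _ => integral_abs_sub_le_two
  refine ⟨isMartingaleCoupling_rho15, integral_abs_sub_rho15, hle, IsGreatest.csSup_eq ⟨?_, ?_⟩⟩
  · exact ⟨rho15, isMartingaleCoupling_rho15, integral_abs_sub_rho15.symm⟩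
  · rintro r ⟨ρ', hρ', rfl⟩
    exact hle ρ' hρ'
end
end

section
/- Let E ⊆ ℝ, let α : ℝ → ℝ, let θ : E → ℝ, and let q : E → ℝ satisfy q(x) ≥ x for all x ∈ E. Suppose that for every x ∈ E and every y ≥ x one has α(y) ≤ α(x) + (y − x)(1 + θ(x)), with equality when y = q(x). Then for all x′, x″ ∈ E with x′ < x″ ≤ q(x′): (q(x′) − q(x″))(θ(x″) − θ(x′)) ≥ 0. In particular, if θ is strictly increasing on E then q(x′) ≥ q(x″). -/
open Set

theorem stmt16 (E : Set ℝ) (α θ q : ℝ → ℝ)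
    (hq : ∀ x ∈ E, x ≤ q x)
    (hub : ∀ x ∈ E, ∀ y : ℝ, x ≤ y → α y ≤ α x + (y - x) * (1 + θ x))
    (heq : ∀ x ∈ E, α (q x) = α x + (q x - x) * (1 + θ x)) :
    (∀ x' ∈ E, ∀ x'' ∈ E, x' < x'' → x'' ≤ q x' →
      0 ≤ (q x' - q x'') * (θ x'' - θ x')) ∧
    (StrictMonoOn θ E →
      ∀ x' ∈ E, ∀ x'' ∈ E, x' < x'' → x'' ≤ q x' → q x'' ≤ q x') := by
  have key : ∀ x' ∈ E, ∀ x'' ∈ E, x' < x'' → x'' ≤ q x' →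
      0 ≤ (q x' - q x'') * (θ x'' - θ x') := by
    intro a ha b hb hab hba
    have h₁ := hub b hb (q a) hba
    have h₂ := hub a ha (q b) (hab.le.trans (hq b hb))
    rw [heq a ha] at h₁
    rw [heq b hb] at h₂
    linarith
  refine ⟨key, fun hθ a ha b hb hab hba => ?_⟩
  exact sub_nonneg.mp
    (nonneg_of_mul_nonneg_left (key a ha b hb hab hba) (sub_pos.mpr (hθ ha hb hab)))
end
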